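/- arXiv:2109.14255 — 5 statements merged into one kernel-verified Lean document; each statement's English description precedes it below -/
import Mathlib

section
/- Let N ≥ 2, 1 < q ≤ 2 if N = 2 and 1 < q < N if N ≥ 3. Let α < 0 < β, γ ∈ ℝ with N + γ > 0 and N + γ + αβ < 0. Then there exists a finite constant C > 0 such that for every compactly supported φ ∈ W^{1,∞}(ℝ^N), ∫_{ℝ^N} |φ - φ̄|^q |x|^γ (1+|x|^β)^α dx ≤ C ∫_{ℝ^N} |∇φ|^q |x|^{γ+q} (1+|x|^β)^α dx, where φ̄ is the average of φ with respect to the finite measure |x|^γ (1+|x|^β)^α dx. -/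
open MeasureTheory
open scoped ENNReal NNReal

abbrev EE (N : ℕ) := EuclideanSpace ℝ (Fin N)

lemma jensen_fin {Ω : Type*} [MeasurableSpace Ω] (μ : Measure Ω) {q : ℝ} (hq : 1 < q)
    {f : Ω → ℝ≥0∞} (hf : AEMeasurable f μ) :
    (∫⁻ x, f x ∂μ) ^ q ≤ μ Set.univ ^ (q - 1) * ∫⁻ x, f x ^ q ∂μ := by
  have hc := Real.HolderConjugate.conjExponent hq
  have := ENNReal.lintegral_mul_le_Lp_mul_Lq μ hc hf (g := fun _ => 1) aemeasurable_const
  simp only [Pi.mul_apply, mul_one, ENNReal.one_rpow, lintegral_const, one_mul] at this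
  have h2 := ENNReal.rpow_le_rpow this (by linarith : 0 ≤ q)
  rw [ENNReal.mul_rpow_of_nonneg _ _ (by linarith), ← ENNReal.rpow_mul, ← ENNReal.rpow_mul] at h2
  have e1 : 1 / q * q = 1 := by field_simp
  have e2 : 1 / q.conjExponent * q = q - 1 := by
    unfold Real.conjExponent
    have : q - 1 ≠ 0 := by linarith
    field_simp
  rw [e1, e2, ENNReal.rpow_one, mul_comm] at h2
  exact h2

/-- upper gradient property -/
structure UG {N : ℕ} (q : ℝ) (φ : EE N → ℝ) (g : EE N → ℝ≥0∞) : Prop where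
  mφ : Measurable φ
  mg : Measurable g
  le : ∀ x v, ‖φ (x + v) - φ x‖ₑ ^ q ≤ ‖v‖ₑ ^ q * ∫⁻ s in Set.Icc (0:ℝ) 1, g (x + s • v)

open Classical in
/-- gradient power, infinite where not differentiable -/
noncomputable def gr {N : ℕ} (q : ℝ) (φ : EE N → ℝ) (x : EE N) : ℝ≥0∞ :=
  if DifferentiableAt ℝ φ x then ‖fderiv ℝ φ x‖ₑ ^ q else ⊤

lemma gr_measurable {N : ℕ} (q : ℝ) (φ : EE N → ℝ) : Measurable (gr q φ) := by
  unfold gr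
  refine Measurable.ite (measurableSet_of_differentiableAt ℝ φ) ?_ measurable_const
  exact (measurable_fderiv ℝ φ).enorm.pow_const q

lemma gr_ae {N : ℕ} (q : ℝ) (φ : EE N → ℝ) {L : ℝ≥0} (h : LipschitzWith L φ) :
    ∀ᵐ x, gr q φ x = ‖fderiv ℝ φ x‖ₑ ^ q := by
  filter_upwards [h.ae_differentiableAt] with x hx
  simp [gr, hx]

lemma ug_lip {N : ℕ} {q : ℝ} (hq : 1 < q) (φ : EE N → ℝ) {L : ℝ≥0} (h : LipschitzWith L φ) :
    UG q φ (gr q φ) := by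
  refine ⟨h.continuous.measurable, gr_measurable q φ, fun x v => ?_⟩
  have hq0 : 0 < q := by linarith
  by_cases hv : v = 0
  · subst hv; simp [hq0]
  by_cases hfin : ∫⁻ s in Set.Icc (0:ℝ) 1, gr q φ (x + s • v) = ⊤
  · rw [hfin, ENNReal.mul_top]
    · exact le_top
    · simp [hv]
  have hline : Measurable (fun s : ℝ => x + s • v) := by fun_prop
  have hae : ∀ᵐ s ∂(volume.restrict (Set.Icc (0:ℝ) 1)), gr q φ (x + s • v) < ⊤ :=
    ae_lt_top ((gr_measurable q φ).comp hline) hfin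
  have hdiff : ∀ᵐ s ∂(volume.restrict (Set.Icc (0:ℝ) 1)), DifferentiableAt ℝ φ (x + s • v) := by
    filter_upwards [hae] with s hs
    by_contra hc
    simp [gr, hc] at hs
  set f : ℝ → ℝ := fun s => φ (x + s • v) with hf
  have hlip : LipschitzWith (L * ‖v‖₊) f := by
    refine h.comp (LipschitzWith.of_dist_le_mul fun a b => ?_)
    simp [dist_eq_norm, ← sub_smul, norm_smul, mul_comm]
  have hac : AbsolutelyContinuousOnInterval f 0 1 :=
    (hlip.lipschitzOnWith (s := Set.uIcc 0 1)).absolutelyContinuousOnInterval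
  have hftc := hac.integral_deriv_eq_sub
  have e1 : φ (x + v) - φ x = ∫ s in Set.Icc (0:ℝ) 1, deriv f s := by
    rw [integral_Icc_eq_integral_Ioc, ← intervalIntegral.integral_of_le zero_le_one, hftc]
    simp [hf]
  have e2 : ‖φ (x + v) - φ x‖ₑ ≤ ∫⁻ s in Set.Icc (0:ℝ) 1, ‖fderiv ℝ φ (x + s • v)‖ₑ * ‖v‖ₑ := by
    rw [e1]
    refine (enorm_integral_le_lintegral_enorm _).trans (lintegral_mono_ae ?_)
    filter_upwards [hdiff] with s hs
    have hd : HasDerivAt (fun s : ℝ => x + s • v) v s := by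
      simpa using ((hasDerivAt_id s).smul_const v).const_add x
    have : deriv f s = fderiv ℝ φ (x + s • v) v :=
      (hs.hasFDerivAt.comp_hasDerivAt s hd).deriv
    rw [this]
    exact ContinuousLinearMap.le_opENorm _ _
  have mfd : Measurable (fun s : ℝ => ‖fderiv ℝ φ (x + s • v)‖ₑ) :=
    ((measurable_fderiv ℝ φ).enorm).comp hline
  calc ‖φ (x + v) - φ x‖ₑ ^ q
      ≤ (∫⁻ s in Set.Icc (0:ℝ) 1, ‖fderiv ℝ φ (x + s • v)‖ₑ * ‖v‖ₑ) ^ q :=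
        ENNReal.rpow_le_rpow e2 hq0.le
    _ ≤ _ * ∫⁻ s in Set.Icc (0:ℝ) 1, (‖fderiv ℝ φ (x + s • v)‖ₑ * ‖v‖ₑ) ^ q :=
        jensen_fin _ hq (mfd.mul_const _).aemeasurable
    _ = ‖v‖ₑ ^ q * ∫⁻ s in Set.Icc (0:ℝ) 1, ‖fderiv ℝ φ (x + s • v)‖ₑ ^ q := by
        simp_rw [ENNReal.mul_rpow_of_nonneg _ _ hq0.le]
        rw [lintegral_mul_const _ (mfd.pow_const q)]
        simp [mul_comm]
    _ = _ := by
        congr 1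
        refine lintegral_congr_ae ?_
        filter_upwards [hdiff] with s hs
        simp [gr, hs]

lemma cv {N : ℕ} {r : ℝ} (hr : r ≠ 0) (b : EE N) (f : EE N → ℝ≥0∞) :
    ∫⁻ x, f (r • x + b) = ENNReal.ofReal |(r ^ N)⁻¹| * ∫⁻ x, f x := by
  have h := Measure.map_addHaar_smul (volume : Measure (EE N)) hr
  have e := lintegral_map_equiv (μ := (volume : Measure (EE N))) (fun x => f (x + b))
    (Homeomorph.smulOfNeZero r hr).toMeasurableEquiv
  have h' : Measure.map (⇑(Homeomorph.smulOfNeZero (α := EE N) r hr).toMeasurableEquiv) volume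
     = ENNReal.ofReal |(r ^ N)⁻¹| • volume := by
    rw [finrank_euclideanSpace_fin] at h
    exact h
  rw [h', lintegral_smul_measure, lintegral_add_right_eq_self] at e
  rw [smul_eq_mul] at e
  rw [e]
  rfl

lemma dil {N : ℕ} {q : ℝ} (hq : 1 < q) {w : EE N → ℝ≥0∞} (hw : Measurable w) {Λ lam : ℝ}
    (hΛ : 1 ≤ Λ) (K : ℝ≥0∞)
    (hK : ∀ x, ∀ σ : ℝ, Λ⁻¹ ≤ σ → σ ≤ Λ → w x ≤ K * w (σ • x))
    (hl1 : Λ⁻¹ ≤ lam) (hl2 : lam ≤ Λ) {φ : EE N → ℝ} {g : EE N → ℝ≥0∞} (h : UG q φ g) :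
    ∫⁻ x, ‖φ (lam • x) - φ x‖ₑ ^ q * w x ≤
      (ENNReal.ofReal Λ ^ q * ENNReal.ofReal Λ ^ q * K * ENNReal.ofReal (Λ ^ N)) *
        ∫⁻ x, g x * (‖x‖ₑ ^ q * w x) := by
  have hq0 : 0 < q := by linarith
  have hΛ0 : 0 < Λ := by linarith
  have hΛi : 0 < Λ⁻¹ := by positivity
  have hΛi1 : Λ⁻¹ ≤ 1 := inv_le_one_of_one_le₀ hΛ
  have mg := h.mg
  set σ : ℝ → ℝ := fun s => 1 + s * (lam - 1) with hσ
  have hσ1 : ∀ s ∈ Set.Icc (0:ℝ) 1, Λ⁻¹ ≤ σ s ∧ σ s ≤ Λ := by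
    intro s ⟨h0, h1⟩
    constructor
    · simp only [hσ]; nlinarith
    · simp only [hσ]; nlinarith
  have hlam : ENNReal.ofReal |lam - 1| ≤ ENNReal.ofReal Λ := by
    apply ENNReal.ofReal_le_ofReal
    rw [abs_le]; constructor <;> linarith
  have step1 : ∀ x, ‖φ (lam • x) - φ x‖ₑ ^ q * w x ≤
      ∫⁻ s in Set.Icc (0:ℝ) 1, (ENNReal.ofReal Λ ^ q * ‖x‖ₑ ^ q * g (σ s • x) * w x) := by
    intro x
    have := h.le x ((lam - 1) • x)
    have e : x + (lam - 1) • x = lam • x := by module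
    rw [e] at this
    have e' : ∀ s : ℝ, x + s • (lam - 1) • x = σ s • x := by
      intro s; simp only [hσ]; module
    simp_rw [e'] at this
    have m1 : Measurable fun s : ℝ => g (σ s • x) := by
      apply mg.comp; simp only [hσ]; fun_prop
    rw [lintegral_mul_const _ (m1.const_mul _), lintegral_const_mul _ m1]
    gcongr
    refine this.trans ?_
    rw [enorm_smul, ENNReal.mul_rpow_of_nonneg _ _ hq0.le, Real.enorm_eq_ofReal_abs]
    gcongr
  calc _ ≤ ∫⁻ x, ∫⁻ s in Set.Icc (0:ℝ) 1,
        (ENNReal.ofReal Λ ^ q * ‖x‖ₑ ^ q * g (σ s • x) * w x) := lintegral_mono step1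
    _ = ∫⁻ s in Set.Icc (0:ℝ) 1, ∫⁻ x, 
        (ENNReal.ofReal Λ ^ q * ‖x‖ₑ ^ q * g (σ s • x) * w x) := by
        rw [lintegral_lintegral_swap]
        apply Measurable.aemeasurable
        have : Measurable (fun p : EE N × ℝ => g (σ p.2 • p.1)) := by
          apply mg.comp; simp only [hσ]; fun_prop
        simp only [Function.uncurry_def]
        fun_prop
    _ ≤ ∫⁻ s in Set.Icc (0:ℝ) 1, (ENNReal.ofReal Λ ^ q * ENNReal.ofReal Λ ^ q * K * ENNReal.ofReal (Λ ^ N)) *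
        ∫⁻ x, g x * (‖x‖ₑ ^ q * w x) := by
        refine setLIntegral_mono' measurableSet_Icc fun s hs => ?_
        obtain ⟨a1, a2⟩ := hσ1 s hs
        have a0 : 0 < σ s := by linarith
        have hn : ∀ x : EE N, ‖x‖ₑ ^ q ≤ ENNReal.ofReal Λ ^ q * ‖σ s • x‖ₑ ^ q := by
          intro x
          rw [← ENNReal.mul_rpow_of_nonneg _ _ hq0.le]
          gcongr
          rw [enorm_smul, ← mul_assoc, Real.enorm_eq_ofReal a0.le, ← ENNReal.ofReal_mul hΛ0.le]
          have : 1 ≤ Λ * σ s := by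
            calc (1:ℝ) = Λ * Λ⁻¹ := by field_simp
              _ ≤ _ := by gcongr
          calc ‖x‖ₑ = ENNReal.ofReal 1 * ‖x‖ₑ := by simp
            _ ≤ _ := by gcongr
        calc _ ≤ ∫⁻ x, ENNReal.ofReal Λ ^ q * ENNReal.ofReal Λ ^ q * K *
              (g (σ s • x) * (‖σ s • x‖ₑ ^ q * w (σ s • x))) := by
              refine lintegral_mono fun x => ?_
              calc _ ≤ ENNReal.ofReal Λ ^ q * (ENNReal.ofReal Λ ^ q * ‖σ s • x‖ₑ ^ q) *
                    g (σ s • x) * (K * w (σ s • x)) := by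
                    gcongr
                    · exact hn x
                    · exact hK x _ a1 a2
                _ = _ := by ring
          _ = ENNReal.ofReal Λ ^ q * ENNReal.ofReal Λ ^ q * K *
              (ENNReal.ofReal |(σ s ^ N)⁻¹| * ∫⁻ x, g x * (‖x‖ₑ ^ q * w x)) := by
              rw [lintegral_const_mul]
              · rw [← cv a0.ne' 0 (fun x => g x * (‖x‖ₑ ^ q * w x))]
                simp
              · have : Measurable (fun x : EE N => g (σ s • x)) := mg.comp (by fun_prop)
                have : Measurable (fun x : EE N => w (σ s • x)) := hw.comp (by fun_prop)
                fun_prop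
          _ ≤ _ := by
              rw [← mul_assoc]
              gcongr
              rw [abs_of_pos (by positivity), ← inv_pow]
              gcongr
              rw [inv_le_comm₀ a0 hΛ0]; exact a1
    _ = _ := by simp

lemma poin_ball {N : ℕ} {q : ℝ} (hq : 1 < q) {φ : EE N → ℝ} {g : EE N → ℝ≥0∞} (h : UG q φ g)
    (a : EE N) (r : ℝ) :
    ∫⁻ z in Metric.ball a r, ∫⁻ z' in Metric.ball a r, ‖φ z - φ z'‖ₑ ^ q ≤
      ENNReal.ofReal (2 * r) ^ q * (2 ^ N * volume (Metric.ball a r)) *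
        ∫⁻ z in Metric.ball a r, g z := by
  have hq0 : 0 < q := by linarith
  have mg := h.mg
  set B := Metric.ball a r with hB
  have hBm : MeasurableSet B := measurableSet_ball
  have hconv : Convex ℝ B := convex_ball a r
  -- single s estimate
  have key : ∀ t : ℝ, 1/2 ≤ t → t ≤ 1 → ∀ b ∈ B, ∫⁻ z in B, g (t • z + (1 - t) • b) ≤
      2 ^ N * ∫⁻ z in B, g z := by
    intro t ht ht1 b hb
    have t0 : 0 < t := by linarith
    calc _ ≤ ∫⁻ z, B.indicator g (t • z + (1 - t) • b) := by
          rw [← lintegral_indicator hBm]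
          refine lintegral_mono fun z => ?_
          by_cases hz : z ∈ B
          · have : t • z + (1 - t) • b ∈ B := hconv hz hb t0.le (by linarith) (by ring)
            simp [hz, this]
          · simp [hz]
      _ = ENNReal.ofReal |(t ^ N)⁻¹| * ∫⁻ z in B, g z := by
          rw [cv t0.ne', lintegral_indicator hBm]
      _ ≤ _ := by
          gcongr
          rw [abs_of_pos (by positivity), ← inv_pow, ENNReal.ofReal_pow (by positivity)]
          gcongr
          rw [show (2:ℝ≥0∞) = ENNReal.ofReal 2 by simp]
          apply ENNReal.ofReal_le_ofReal
          rw [inv_le_comm₀ t0 (by norm_num)]; linarith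
  have key2 : ∀ s ∈ Set.Icc (0:ℝ) 1, ∫⁻ z in B, ∫⁻ z' in B, g ((1 - s) • z + s • z') ≤
      (2 ^ N * volume B) * ∫⁻ z in B, g z := by
    intro s ⟨hs0, hs1⟩
    rcases le_total s (1/2) with hs | hs
    · rw [lintegral_lintegral_swap]
      · calc _ ≤ ∫⁻ _ in B, 2 ^ N * ∫⁻ z in B, g z := by
              refine setLIntegral_mono' hBm fun b hb => ?_
              have := key (1 - s) (by linarith) (by linarith) b hb
              simpa using this
          _ = _ := by simp; ring
      · apply Measurable.aemeasurable
        simp only [Function.uncurry_def]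
        apply mg.comp; fun_prop
    · calc _ ≤ ∫⁻ _ in B, 2 ^ N * ∫⁻ z in B, g z := by
              refine setLIntegral_mono' hBm fun b hb => ?_
              have := key s (by linarith) (by linarith) b hb
              simpa [add_comm] using this
          _ = _ := by simp; ring
  have mg3 : Measurable (fun p : (EE N × EE N) × ℝ => g ((1 - p.2) • p.1.1 + p.2 • p.1.2)) := by
    apply mg.comp; fun_prop
  calc _ ≤ ∫⁻ z in B, ∫⁻ z' in B, ENNReal.ofReal (2 * r) ^ q *
        ∫⁻ s in Set.Icc (0:ℝ) 1, g ((1 - s) • z + s • z') := by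
        refine setLIntegral_mono' hBm fun z hz => setLIntegral_mono' hBm fun z' hz' => ?_
        have := h.le z (z' - z)
        have e : ∀ s : ℝ, z + s • (z' - z) = (1 - s) • z + s • z' := by intro s; module
        simp_rw [e] at this
        rw [add_sub_cancel] at this
        rw [← enorm_neg, neg_sub]
        refine this.trans ?_
        gcongr
        rw [← ofReal_norm, ← dist_eq_norm]
        apply ENNReal.ofReal_le_ofReal
        have h1 : dist z a < r := hz
        have h2 : dist z' a < r := hz'
        linarith [dist_triangle_right z' z a]
    _ = ENNReal.ofReal (2 * r) ^ q * ∫⁻ s in Set.Icc (0:ℝ) 1, ∫⁻ z in B, ∫⁻ z' in B,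
          g ((1 - s) • z + s • z') := by
        have m1 : Measurable (fun p : EE N × EE N =>
            ∫⁻ s in Set.Icc (0:ℝ) 1, g ((1 - s) • p.1 + s • p.2)) := mg3.lintegral_prod_right'
        have m2 : ∀ z, Measurable (fun z' : EE N =>
            ∫⁻ s in Set.Icc (0:ℝ) 1, g ((1 - s) • z + s • z')) := fun z =>
            m1.comp (measurable_const.prodMk measurable_id)
        have m3 : Measurable (fun z : EE N => ∫⁻ z' in B,
            ∫⁻ s in Set.Icc (0:ℝ) 1, g ((1 - s) • z + s • z')) := m1.lintegral_prod_right'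
        simp_rw [lintegral_const_mul _ (m2 _)]
        rw [lintegral_const_mul _ m3]
        congr 1
        have sw : ∀ z : EE N, ∫⁻ z' in B, ∫⁻ s in Set.Icc (0:ℝ) 1, g ((1 - s) • z + s • z') =
            ∫⁻ s in Set.Icc (0:ℝ) 1, ∫⁻ z' in B, g ((1 - s) • z + s • z') := by
          intro z
          rw [lintegral_lintegral_swap]
          apply Measurable.aemeasurable
          simp only [Function.uncurry_def]
          apply mg.comp; fun_prop
        simp_rw [sw]
        rw [lintegral_lintegral_swap]
        apply Measurable.aemeasurable
        simp only [Function.uncurry_def]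
        have m4 : Measurable (fun p : (EE N × ℝ) × EE N => g ((1 - p.1.2) • p.1.1 + p.1.2 • p.2)) := by
          apply mg.comp; fun_prop
        exact m4.lintegral_prod_right'
    _ ≤ ENNReal.ofReal (2 * r) ^ q * ∫⁻ s in Set.Icc (0:ℝ) 1,
          (2 ^ N * volume B) * ∫⁻ z in B, g z := by
        gcongr _ * ?_
        exact setLIntegral_mono' measurableSet_Icc key2
    _ = _ := by simp; ring

lemma tri {q : ℝ} (hq : 1 < q) (a b c : ℝ) :
    ‖a - c‖ₑ ^ q ≤ 2 ^ q * (‖a - b‖ₑ ^ q + ‖b - c‖ₑ ^ q) := by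
  calc ‖a - c‖ₑ ^ q ≤ (‖a - b‖ₑ + ‖b - c‖ₑ) ^ q := by
        gcongr
        calc ‖a - c‖ₑ = ‖(a - b) + (b - c)‖ₑ := by congr 1; ring
          _ ≤ _ := enorm_add_le _ _
    _ ≤ 2 ^ (q - 1) * (‖a - b‖ₑ ^ q + ‖b - c‖ₑ ^ q) :=
        ENNReal.rpow_add_le_mul_rpow_add_rpow _ _ hq.le
    _ ≤ _ := by
        gcongr
        · norm_num
        · linarith

lemma absorb {N : ℕ} {q : ℝ} (hq : 1 < q) {w : EE N → ℝ≥0∞} (hw : Measurable w) {lam : ℝ}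
    (hlam : lam ≠ 0) {E F : Set (EE N)} (hE : MeasurableSet E) (hF : MeasurableSet F)
    (hEF : ∀ x ∈ E, lam • x ∈ E ∪ F) (ε K : ℝ≥0∞) (hε : 2 ^ q * ε ≤ 2⁻¹)
    (h1 : ∀ y ∈ E, ENNReal.ofReal |(lam ^ N)⁻¹| * w (lam⁻¹ • y) ≤ ε * w y)
    (h2 : ∀ y ∈ F, w (lam⁻¹ • y) ≤ K * w y)
    {φ : EE N → ℝ} (mφ : Measurable φ) (c : ℝ) (hfin : ∫⁻ x in E, ‖φ x - c‖ₑ ^ q * w x ≠ ⊤) :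
    ∫⁻ x in E, ‖φ x - c‖ₑ ^ q * w x ≤ 2 * (2 ^ q *
      (ENNReal.ofReal |(lam ^ N)⁻¹| * K * (∫⁻ x in F, ‖φ x - c‖ₑ ^ q * w x) +
        ∫⁻ x, ‖φ (lam • x) - φ x‖ₑ ^ q * w x)) := by
  set M := ENNReal.ofReal |(lam ^ N)⁻¹|
  set X := ∫⁻ x in E, ‖φ x - c‖ₑ ^ q * w x
  set Y := ∫⁻ x in F, ‖φ x - c‖ₑ ^ q * w x
  set Z := ∫⁻ x, ‖φ (lam • x) - φ x‖ₑ ^ q * w x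
  have ml : Measurable (fun x : EE N => φ (lam • x)) := mφ.comp (by fun_prop)
  have mli : Measurable (fun x : EE N => w (lam⁻¹ • x)) := hw.comp (by fun_prop)
  have s1 : X ≤ 2 ^ q * (Z + ∫⁻ x in E, ‖φ (lam • x) - c‖ₑ ^ q * w x) := by
    calc X ≤ ∫⁻ x in E, 2 ^ q * (‖φ (lam • x) - φ x‖ₑ ^ q * w x +
          ‖φ (lam • x) - c‖ₑ ^ q * w x) := by
          refine lintegral_mono fun x => ?_
          calc _ ≤ 2 ^ q * (‖φ x - φ (lam • x)‖ₑ ^ q + ‖φ (lam • x) - c‖ₑ ^ q) * w x := by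
                gcongr; exact tri hq _ _ _
            _ = _ := by rw [← enorm_neg (φ x - _), neg_sub]; ring
      _ = 2 ^ q * ((∫⁻ x in E, ‖φ (lam • x) - φ x‖ₑ ^ q * w x) +
          ∫⁻ x in E, ‖φ (lam • x) - c‖ₑ ^ q * w x) := by
          rw [lintegral_const_mul _ (by fun_prop), lintegral_add_left (by fun_prop)]
      _ ≤ _ := by
          gcongr
          exact setLIntegral_le_lintegral _ _
  have s2 : ∫⁻ x in E, ‖φ (lam • x) - c‖ₑ ^ q * w x ≤ ε * X + M * K * Y := by
    set G : EE N → ℝ≥0∞ := (E ∪ F).indicator (fun y => ‖φ y - c‖ₑ ^ q * w (lam⁻¹ • y)) with hG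
    calc _ ≤ ∫⁻ x, G (lam • x + 0) := by
          rw [← lintegral_indicator hE]
          refine lintegral_mono fun x => ?_
          by_cases hx : x ∈ E
          · have := hEF x hx
            simp only [hG, hx, add_zero, Set.indicator_of_mem, this]
            rw [inv_smul_smul₀ hlam]
          · simp [hx]
      _ = M * ∫⁻ y in E ∪ F, ‖φ y - c‖ₑ ^ q * w (lam⁻¹ • y) := by
          rw [cv hlam, lintegral_indicator (hE.union hF)]
      _ ≤ M * ((∫⁻ y in E, ‖φ y - c‖ₑ ^ q * w (lam⁻¹ • y)) +
            ∫⁻ y in F, ‖φ y - c‖ₑ ^ q * w (lam⁻¹ • y)) := by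
          gcongr; exact lintegral_union_le _ _ _
      _ = (∫⁻ y in E, M * (‖φ y - c‖ₑ ^ q * w (lam⁻¹ • y))) +
            M * ∫⁻ y in F, ‖φ y - c‖ₑ ^ q * w (lam⁻¹ • y) := by
          rw [mul_add, lintegral_const_mul _ (by fun_prop)]
      _ ≤ (∫⁻ y in E, ε * (‖φ y - c‖ₑ ^ q * w y)) +
            M * ∫⁻ y in F, K * (‖φ y - c‖ₑ ^ q * w y) := by
          gcongr ?_ + _ * ?_
          · refine setLIntegral_mono' hE fun y hy => ?_
            calc _ = ‖φ y - c‖ₑ ^ q * (M * w (lam⁻¹ • y)) := by ring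
              _ ≤ ‖φ y - c‖ₑ ^ q * (ε * w y) := mul_le_mul_right (h1 y hy) _
              _ = _ := by ring
          · refine setLIntegral_mono' hF fun y hy => ?_
            calc _ ≤ ‖φ y - c‖ₑ ^ q * (K * w y) := by gcongr; exact h2 y hy
              _ = _ := by ring
      _ = _ := by
          rw [lintegral_const_mul _ (by fun_prop), lintegral_const_mul _ (by fun_prop)]
          ring
  have s3 : X ≤ X / 2 + 2 ^ q * (M * K * Y + Z) := by
    calc X ≤ 2 ^ q * (Z + (ε * X + M * K * Y)) := s1.trans (by gcongr)
      _ = 2 ^ q * ε * X + 2 ^ q * (M * K * Y + Z) := by ring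
      _ ≤ 2⁻¹ * X + 2 ^ q * (M * K * Y + Z) := by gcongr
      _ = _ := by rw [mul_comm, ENNReal.div_eq_inv_mul, mul_comm X]
  have hX2 : X / 2 ≠ ⊤ := ENNReal.div_ne_top hfin (by norm_num)
  have s4 : X / 2 ≤ 2 ^ q * (M * K * Y + Z) := by
    have : X / 2 + X / 2 ≤ X / 2 + 2 ^ q * (M * K * Y + Z) := by rwa [ENNReal.add_halves]
    exact (ENNReal.add_le_add_iff_left hX2).1 this
  calc X = 2 * (X / 2) := (ENNReal.mul_div_cancel (by norm_num) (by norm_num)).symm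
    _ ≤ _ := by gcongr

noncomputable def vv (α β γ r : ℝ) : ℝ := r ^ γ * (1 + r ^ β) ^ α

lemma vv_nonneg (α β γ : ℝ) {r : ℝ} (hr : 0 ≤ r) : 0 ≤ vv α β γ r := by
  unfold vv; positivity

lemma vv_pos (α β γ : ℝ) {r : ℝ} (hr : 0 < r) : 0 < vv α β γ r := by
  unfold vv; positivity

lemma vv_doubling {α β γ : ℝ} (hα : α < 0) (hβ : 0 < β) {Λ : ℝ} (hΛ : 1 ≤ Λ) {r σ : ℝ}
    (hr : 0 ≤ r) (h1 : Λ⁻¹ ≤ σ) (h2 : σ ≤ Λ) :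
    vv α β γ r ≤ Λ ^ (|γ| - α * β) * vv α β γ (σ * r) := by
  have hΛ0 : 0 < Λ := by linarith
  have hσ : 0 < σ := lt_of_lt_of_le (by positivity) h1
  have hK : 1 ≤ Λ ^ (|γ| - α * β) := Real.one_le_rpow hΛ (by nlinarith [abs_nonneg γ])
  rcases hr.eq_or_lt with rfl | hr
  · rw [mul_zero]
    exact le_mul_of_one_le_left (vv_nonneg _ _ _ le_rfl) hK
  unfold vv
  have a1 : 1 ≤ Λ ^ |γ| * σ ^ γ := by
    have : Λ ^ (-|γ|) ≤ σ ^ γ := by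
      rcases le_total 0 γ with hg | hg
      · rw [abs_of_nonneg hg, Real.rpow_neg hΛ0.le, ← Real.inv_rpow hΛ0.le]
        exact Real.rpow_le_rpow (by positivity) h1 hg
      · rw [abs_of_nonpos hg, neg_neg]
        exact Real.rpow_le_rpow_of_nonpos hσ h2 hg
    calc 1 = Λ ^ |γ| * Λ ^ (-|γ|) := by rw [← Real.rpow_add hΛ0]; simp
      _ ≤ _ := by gcongr
  have a2 : (1 + r ^ β) ^ α ≤ Λ ^ (-(α * β)) * (1 + (σ * r) ^ β) ^ α := by
    have : (Λ ^ β * (1 + r ^ β)) ^ α ≤ (1 + (σ * r) ^ β) ^ α := by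
      apply Real.rpow_le_rpow_of_nonpos (by positivity) _ hα.le
      rw [Real.mul_rpow hσ.le hr.le, mul_add, mul_one]
      have := Real.one_le_rpow hΛ hβ.le
      gcongr
    rw [Real.mul_rpow (by positivity) (by positivity), ← Real.rpow_mul hΛ0.le] at this
    calc (1 + r ^ β) ^ α = Λ ^ (-(α * β)) * (Λ ^ (β * α) * (1 + r ^ β) ^ α) := by
          rw [← mul_assoc, ← Real.rpow_add hΛ0]; simp [mul_comm]
      _ ≤ _ := by gcongr
  calc r ^ γ * (1 + r ^ β) ^ α ≤ ((Λ ^ |γ| * σ ^ γ) * r ^ γ) *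
        (Λ ^ (-(α * β)) * (1 + (σ * r) ^ β) ^ α) := by
        gcongr
        exact le_mul_of_one_le_left (by positivity) a1
    _ = _ := by
        rw [Real.mul_rpow (z := γ) hσ.le hr.le, sub_eq_add_neg, Real.rpow_add hΛ0]; ring

lemma vv_zero {α β γ : ℝ} (hα : α < 0) (hβ : 0 < β) (N : ℕ) {Λ : ℝ} (hΛ : 1 ≤ Λ) {r : ℝ}
    (hr : 0 < r) (hr1 : r ≤ 1) :
    (Λ ^ N)⁻¹ * vv α β γ (Λ⁻¹ * r) ≤ (Λ ^ (-(N + γ)) * 2 ^ (-α)) * vv α β γ r := by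
  have hΛ0 : 0 < Λ := by linarith
  unfold vv
  have a1 : (1 + (Λ⁻¹ * r) ^ β) ^ α ≤ 1 :=
    Real.rpow_le_one_of_one_le_of_nonpos (by linarith [show 0 ≤ (Λ⁻¹ * r) ^ β by positivity]) hα.le
  have a2 : 1 ≤ 2 ^ (-α) * (1 + r ^ β) ^ α := by
    have : (2:ℝ) ^ α ≤ (1 + r ^ β) ^ α := by
      apply Real.rpow_le_rpow_of_nonpos (by positivity) _ hα.le
      linarith [Real.rpow_le_one hr.le hr1 hβ.le]
    calc 1 = (2:ℝ) ^ (-α) * 2 ^ α := by rw [← Real.rpow_add (by norm_num)]; simp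
      _ ≤ _ := by gcongr
  calc _ ≤ (Λ ^ N)⁻¹ * ((Λ⁻¹ * r) ^ γ * 1) := by gcongr
    _ = Λ ^ (-(N + γ)) * r ^ γ * 1 := by
      rw [Real.mul_rpow (by positivity) hr.le, Real.inv_rpow hΛ0.le, neg_add, Real.rpow_add hΛ0,
        Real.rpow_neg hΛ0.le, Real.rpow_neg hΛ0.le, Real.rpow_natCast]
      ring
    _ ≤ Λ ^ (-(N + γ)) * r ^ γ * (2 ^ (-α) * (1 + r ^ β) ^ α) := by gcongr
    _ = _ := by ring

lemma vv_inf {α β γ : ℝ} (hα : α < 0) (hβ : 0 < β) (N : ℕ) {Λ : ℝ} (hΛ : 1 ≤ Λ) {r : ℝ}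
    (hr1 : 1 ≤ r) :
    Λ ^ N * vv α β γ (Λ * r) ≤ (Λ ^ (N + γ + α * β) * 2 ^ (-α)) * vv α β γ r := by
  have hΛ0 : 0 < Λ := by linarith
  have hr : 0 < r := by linarith
  unfold vv
  have a1 : (1 + (Λ * r) ^ β) ^ α ≤ Λ ^ (α * β) * (r ^ β) ^ α := by
    calc _ ≤ ((Λ * r) ^ β) ^ α :=
          Real.rpow_le_rpow_of_nonpos (by positivity) (by linarith) hα.le
      _ = _ := by
        rw [Real.mul_rpow hΛ0.le hr.le, Real.mul_rpow (by positivity) (by positivity),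
          ← Real.rpow_mul hΛ0.le, mul_comm β α]
  have a2 : (r ^ β) ^ α ≤ 2 ^ (-α) * (1 + r ^ β) ^ α := by
    have : (2 * r ^ β) ^ α ≤ (1 + r ^ β) ^ α := by
      apply Real.rpow_le_rpow_of_nonpos (by positivity) _ hα.le
      linarith [Real.one_le_rpow hr1 hβ.le]
    rw [Real.mul_rpow (by norm_num) (by positivity)] at this
    calc (r ^ β) ^ α = (2:ℝ) ^ (-α) * (2 ^ α * (r ^ β) ^ α) := by
          rw [← mul_assoc, ← Real.rpow_add (by norm_num)]; simp
      _ ≤ _ := by gcongr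
  calc _ ≤ Λ ^ N * ((Λ * r) ^ γ * (Λ ^ (α * β) * (2 ^ (-α) * (1 + r ^ β) ^ α))) := by
        gcongr
        exact a1.trans (by gcongr)
    _ = _ := by
      rw [Real.mul_rpow hΛ0.le hr.le, Real.rpow_add hΛ0, Real.rpow_add hΛ0, Real.rpow_natCast]
      ring

lemma vv_meas (α β γ : ℝ) : Measurable (vv α β γ) := by unfold vv; fun_prop

lemma vv_int {N : ℕ} (hN : 2 ≤ N) {α β γ : ℝ} (hα : α < 0) (hβ : 0 < β)
    (h1 : 0 < (N : ℝ) + γ) (h2 : (N : ℝ) + γ + α * β < 0) :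
    Integrable (fun x : EE N => vv α β γ ‖x‖) := by
  have : Nonempty (Fin N) := ⟨⟨0, by omega⟩⟩
  rw [integrable_fun_norm_addHaar (volume : Measure (EE N)) (f := vv α β γ),
    finrank_euclideanSpace_fin, ← Set.Ioc_union_Ioi_eq_Ioi (zero_le_one' ℝ)]
  have hcast : ((N - 1 : ℕ) : ℝ) = N - 1 := by push_cast [Nat.cast_sub (by omega : 1 ≤ N)]; ring
  have mm : Measurable (fun y : ℝ => y ^ (N - 1) • vv α β γ y) :=
    (measurable_id.pow_const _).smul (vv_meas α β γ)
  refine IntegrableOn.union ?_ ?_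
  · have : IntegrableOn (fun y : ℝ => y ^ (N - 1 + γ : ℝ)) (Set.Ioc 0 1) := by
      rw [← intervalIntegrable_iff_integrableOn_Ioc_of_le zero_le_one]
      exact intervalIntegral.intervalIntegrable_rpow' (by linarith)
    refine Integrable.mono' this mm.aestronglyMeasurable ?_
    refine (ae_restrict_iff' measurableSet_Ioc).2 (Filter.Eventually.of_forall fun y hy => ?_)
    have hy0 : 0 < y := hy.1
    rw [Real.norm_of_nonneg (smul_nonneg (by positivity) (vv_nonneg _ _ _ hy0.le)), smul_eq_mul]
    unfold vv
    rw [Real.rpow_add hy0, ← hcast, Real.rpow_natCast]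
    gcongr
    have : (1 + y ^ β) ^ α ≤ 1 :=
      Real.rpow_le_one_of_one_le_of_nonpos (by linarith [show 0 ≤ y ^ β by positivity]) hα.le
    exact mul_le_of_le_one_right (by positivity) this
  · have : IntegrableOn (fun y : ℝ => y ^ (N - 1 + γ + β * α : ℝ)) (Set.Ioi 1) :=
      integrableOn_Ioi_rpow_of_lt (by linarith) one_pos
    refine Integrable.mono' this mm.aestronglyMeasurable ?_
    refine (ae_restrict_iff' measurableSet_Ioi).2 (Filter.Eventually.of_forall fun y hy => ?_)
    have hy0 : 0 < y := lt_trans one_pos hy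
    rw [Real.norm_of_nonneg (smul_nonneg (by positivity) (vv_nonneg _ _ _ hy0.le)), smul_eq_mul]
    unfold vv
    rw [Real.rpow_add hy0, Real.rpow_add hy0, ← hcast, Real.rpow_natCast, Real.rpow_mul hy0.le,
      mul_assoc]
    have hyb : 0 < y ^ β := Real.rpow_pos_of_pos hy0 _
    have : (1 + y ^ β) ^ α ≤ (y ^ β) ^ α :=
      Real.rpow_le_rpow_of_nonpos hyb (by linarith) hα.le
    gcongr

lemma exists_big {a b : ℝ} (ha : a < 0) (hb : b < 0) (δ : ℝ) (hδ : 0 < δ) :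
    ∃ Λ : ℝ, 1 ≤ Λ ∧ Λ ^ a ≤ δ ∧ Λ ^ b ≤ δ := by
  have t1 := tendsto_rpow_neg_atTop (y := -a) (by linarith)
  have t2 := tendsto_rpow_neg_atTop (y := -b) (by linarith)
  rw [neg_neg] at t1 t2
  have := ((Filter.eventually_ge_atTop (1:ℝ)).and
    ((t1.eventually_le_const hδ).and (t2.eventually_le_const hδ))).exists
  exact this

lemma conn {N : ℕ} (hN : 2 ≤ N) {q : ℝ} (hq : 1 < q) {ρ : EE N → ℝ}
    (hρc : ContinuousOn ρ {0}ᶜ) (hρ : ∀ x, x ≠ 0 → 0 < ρ x) (e : EE N) (he : e ≠ 0) :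
    ∀ x : EE N, x ≠ 0 → ∃ C : ℝ≥0∞, C ≠ ⊤ ∧ ∃ r > 0, ∀ (φ : EE N → ℝ) (g : EE N → ℝ≥0∞),
      UG q φ g → ∫⁻ z in Metric.ball x r, ∫⁻ z' in Metric.ball e (‖e‖ / 2), ‖φ z - φ z'‖ₑ ^ q ≤
        C * ∫⁻ y, g y * ENNReal.ofReal (ρ y) := by
  set B0 := Metric.ball e (‖e‖ / 2) with hB0
  -- local Poincare
  have loc : ∀ x : EE N, x ≠ 0 → ∃ C : ℝ≥0∞, C ≠ ⊤ ∧ ∀ (φ : EE N → ℝ) (g : EE N → ℝ≥0∞),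
      UG q φ g → ∫⁻ z in Metric.ball x (‖x‖ / 2), ∫⁻ z' in Metric.ball x (‖x‖ / 2),
        ‖φ z - φ z'‖ₑ ^ q ≤ C * ∫⁻ y, g y * ENNReal.ofReal (ρ y) := by
    intro x hx
    have hxn : 0 < ‖x‖ := norm_pos_iff.2 hx
    have hsub : Metric.closedBall x (‖x‖ / 2) ⊆ {0}ᶜ := by
      intro y hy h0
      rw [Set.mem_singleton_iff] at h0
      subst h0
      rw [Metric.mem_closedBall, dist_zero_left] at hy
      linarith
    obtain ⟨y0, hy0, hmin⟩ := (isCompact_closedBall x (‖x‖ / 2)).exists_isMinOn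
      ⟨x, Metric.mem_closedBall_self (by positivity)⟩ (hρc.mono hsub)
    have hm : 0 < ρ y0 := hρ y0 (hsub hy0)
    refine ⟨ENNReal.ofReal (2 * (‖x‖ / 2)) ^ q * (2 ^ N * volume (Metric.ball x (‖x‖ / 2))) *
      (ENNReal.ofReal (ρ y0))⁻¹, ?_, ?_⟩
    · refine ENNReal.mul_ne_top (ENNReal.mul_ne_top ?_ (ENNReal.mul_ne_top ?_ ?_)) ?_
      · exact ENNReal.rpow_ne_top_of_nonneg (by linarith) ENNReal.ofReal_ne_top
      · exact ENNReal.pow_ne_top (by norm_num)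
      · exact measure_ball_lt_top.ne
      · exact ENNReal.inv_ne_top.2 (ENNReal.ofReal_pos.2 hm).ne'
    · intro φ g h
      refine (poin_ball hq h x (‖x‖ / 2)).trans ?_
      rw [mul_assoc _ (ENNReal.ofReal (ρ y0))⁻¹]
      gcongr
      calc ∫⁻ z in Metric.ball x (‖x‖ / 2), g z
          ≤ ∫⁻ z in Metric.ball x (‖x‖ / 2),
            (ENNReal.ofReal (ρ y0))⁻¹ * (g z * ENNReal.ofReal (ρ z)) := by
            refine setLIntegral_mono' measurableSet_ball fun z hz => ?_
            have : ρ y0 ≤ ρ z := hmin (Metric.ball_subset_closedBall hz)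
            calc g z = (ENNReal.ofReal (ρ y0))⁻¹ * (g z * ENNReal.ofReal (ρ y0)) := by
                  rw [mul_comm (g z), ← mul_assoc, ENNReal.inv_mul_cancel
                    (ENNReal.ofReal_pos.2 hm).ne' ENNReal.ofReal_ne_top, one_mul]
              _ ≤ _ := by gcongr
        _ = (ENNReal.ofReal (ρ y0))⁻¹ * ∫⁻ z in Metric.ball x (‖x‖ / 2),
              (g z * ENNReal.ofReal (ρ z)) := by
            rw [lintegral_const_mul' _ _ (ENNReal.inv_ne_top.2 (ENNReal.ofReal_pos.2 hm).ne')]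
        _ ≤ _ := by gcongr; exact Measure.restrict_le_self
  set S : Set (EE N) := {x | ∃ C : ℝ≥0∞, C ≠ ⊤ ∧ ∃ r > 0, ∀ (φ : EE N → ℝ) (g : EE N → ℝ≥0∞),
      UG q φ g → ∫⁻ z in Metric.ball x r, ∫⁻ z' in B0, ‖φ z - φ z'‖ₑ ^ q ≤
        C * ∫⁻ y, g y * ENNReal.ofReal (ρ y)} with hS
  have hopen : IsOpen S := by
    rw [Metric.isOpen_iff]
    rintro x ⟨C, hC, r, hr, H⟩
    refine ⟨r / 2, by positivity, fun y hy => ⟨C, hC, r / 2, by positivity, fun φ g h => ?_⟩⟩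
    refine le_trans ?_ (H φ g h)
    refine lintegral_mono_set (Metric.ball_subset_ball' ?_)
    have : dist y x < r / 2 := hy
    linarith
  have hU : IsPreconnected ({0}ᶜ : Set (EE N)) := by
    apply (isConnected_compl_singleton_of_one_lt_rank _ _).isPreconnected
    rw [← Module.finrank_eq_rank, finrank_euclideanSpace_fin]
    exact_mod_cast hN
  have hne : (({0}ᶜ : Set (EE N)) ∩ S).Nonempty := by
    refine ⟨e, he, ?_⟩
    obtain ⟨C, hC, H⟩ := loc e he
    exact ⟨C, hC, ‖e‖ / 2, by have := norm_pos_iff.2 he; positivity, H⟩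
  have hcl : closure S ∩ {0}ᶜ ⊆ S := by
    rintro x ⟨hx, hx0⟩
    have hxn : 0 < ‖x‖ := norm_pos_iff.2 hx0
    obtain ⟨C1, hC1, H1⟩ := loc x hx0
    obtain ⟨y, hyS, hy⟩ := Metric.mem_closure_iff.1 hx (‖x‖ / 2) (by positivity)
    obtain ⟨C2, hC2, r2, hr2, H2⟩ := hyS
    set Bx := Metric.ball x (‖x‖ / 2) with hBx
    have hyB : y ∈ Bx := by rw [hBx, Metric.mem_ball, dist_comm]; exact hy
    obtain ⟨r3, hr3, hsub3⟩ := Metric.isOpen_iff.1 (Metric.isOpen_ball (x := x) (ε := ‖x‖ / 2)) y hyB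
    set r := min r2 r3
    have hr : 0 < r := lt_min hr2 hr3
    set By := Metric.ball y r
    have hBy1 : By ⊆ Metric.ball y r2 := Metric.ball_subset_ball (min_le_left _ _)
    have hBy2 : By ⊆ Bx := (Metric.ball_subset_ball (min_le_right _ _)).trans hsub3
    have hvy : volume By ≠ 0 := (Metric.measure_ball_pos _ _ hr).ne'
    have hvyt : volume By ≠ ⊤ := measure_ball_lt_top.ne
    refine ⟨(volume By)⁻¹ * (2 ^ q * (volume B0 * C1 + volume Bx * C2)), ?_, ‖x‖ / 2,
      by positivity, fun φ g h => ?_⟩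
    · refine ENNReal.mul_ne_top (ENNReal.inv_ne_top.2 hvy) (ENNReal.mul_ne_top ?_
        (ENNReal.add_ne_top.2 ⟨ENNReal.mul_ne_top ?_ hC1, ENNReal.mul_ne_top ?_ hC2⟩))
      · exact ENNReal.rpow_ne_top_of_nonneg (by linarith) (by norm_num)
      · exact measure_ball_lt_top.ne
      · exact measure_ball_lt_top.ne
    set D := ∫⁻ y, g y * ENNReal.ofReal (ρ y)
    have mφ := h.mφ
    have m2 : Measurable fun p : EE N × EE N => ‖φ p.1 - φ p.2‖ₑ ^ q := by fun_prop
    have mI : Measurable fun z : EE N => ∫⁻ z' in B0, ‖φ z - φ z'‖ₑ ^ q := m2.lintegral_prod_right'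
    have mI2 : Measurable fun z : EE N => ∫⁻ z' in By, ‖φ z - φ z'‖ₑ ^ q := m2.lintegral_prod_right'
    have main : volume By * ∫⁻ z in Bx, ∫⁻ z' in B0, ‖φ z - φ z'‖ₑ ^ q ≤
        2 ^ q * (volume B0 * C1 + volume Bx * C2) * D := by
      calc _ = ∫⁻ u in By, ∫⁻ z in Bx, ∫⁻ z' in B0, ‖φ z - φ z'‖ₑ ^ q := by
            rw [setLIntegral_const, mul_comm]
        _ ≤ ∫⁻ u in By, ∫⁻ z in Bx, ∫⁻ z' in B0,
              2 ^ q * (‖φ z - φ u‖ₑ ^ q + ‖φ u - φ z'‖ₑ ^ q) := by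
            gcongr with u z z'
            exact tri hq _ _ _
        _ = ∫⁻ u in By, 2 ^ q * (volume B0 * (∫⁻ z in Bx, ‖φ z - φ u‖ₑ ^ q) +
              volume Bx * ∫⁻ z' in B0, ‖φ u - φ z'‖ₑ ^ q) := by
            congr 1; ext u
            have : ∀ z, ∫⁻ z' in B0, 2 ^ q * (‖φ z - φ u‖ₑ ^ q + ‖φ u - φ z'‖ₑ ^ q) =
                2 ^ q * (volume B0 * ‖φ z - φ u‖ₑ ^ q + ∫⁻ z' in B0, ‖φ u - φ z'‖ₑ ^ q) := by
              intro z
              rw [lintegral_const_mul _ (by fun_prop), lintegral_add_left (by fun_prop),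
                setLIntegral_const, mul_comm (volume B0)]
            simp_rw [this]
            rw [lintegral_const_mul _ (by fun_prop), lintegral_add_left (by fun_prop),
                setLIntegral_const, lintegral_const_mul _ (by fun_prop), mul_comm (volume Bx)]
        _ = 2 ^ q * (volume B0 * (∫⁻ u in By, ∫⁻ z in Bx, ‖φ z - φ u‖ₑ ^ q) +
              volume Bx * ∫⁻ u in By, ∫⁻ z' in B0, ‖φ u - φ z'‖ₑ ^ q) := by
            have m3 : Measurable fun u : EE N => ∫⁻ z in Bx, ‖φ z - φ u‖ₑ ^ q :=
              m2.lintegral_prod_left'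
            rw [lintegral_const_mul _ (by fun_prop), lintegral_add_left (by fun_prop),
                lintegral_const_mul _ (by fun_prop), lintegral_const_mul _ (by fun_prop)]
        _ ≤ 2 ^ q * (volume B0 * (C1 * D) + volume Bx * (C2 * D)) := by
            gcongr 2 ^ q * (_ * ?_ + _ * ?_)
            · refine (lintegral_mono_set hBy2).trans ?_
              rw [lintegral_lintegral_swap]
              · exact H1 φ g h
              · apply Measurable.aemeasurable
                simp only [Function.uncurry_def]; fun_prop
            · exact (lintegral_mono_set hBy1).trans (H2 φ g h)
        _ = _ := by ring
    rw [mul_assoc _ _ D]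
    calc _ = (volume By)⁻¹ * (volume By * ∫⁻ z in Bx, ∫⁻ z' in B0, ‖φ z - φ z'‖ₑ ^ q) := by
          rw [← mul_assoc, ENNReal.inv_mul_cancel hvy hvyt, one_mul]
      _ ≤ _ := by gcongr
  have := hU.subset_of_closure_inter_subset hopen hne hcl
  exact fun x hx => this hx

lemma poin_cpt {N : ℕ} (hN : 2 ≤ N) {q : ℝ} (hq : 1 < q) {ρ : EE N → ℝ}
    (hρc : ContinuousOn ρ {0}ᶜ) (hρ : ∀ x, x ≠ 0 → 0 < ρ x) (e : EE N) (he : e ≠ 0)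
    {K : Set (EE N)} (hK : IsCompact K) (hK0 : K ⊆ {0}ᶜ) :
    ∃ C : ℝ≥0∞, C ≠ ⊤ ∧ ∀ (φ : EE N → ℝ) (g : EE N → ℝ≥0∞),
      UG q φ g → ∫⁻ z in K, ∫⁻ z' in Metric.ball e (‖e‖ / 2), ‖φ z - φ z'‖ₑ ^ q ≤
        C * ∫⁻ y, g y * ENNReal.ofReal (ρ y) := by
  refine hK.induction_on (p := fun K => ∃ C : ℝ≥0∞, C ≠ ⊤ ∧ ∀ (φ : EE N → ℝ) (g : EE N → ℝ≥0∞),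
      UG q φ g → ∫⁻ z in K, ∫⁻ z' in Metric.ball e (‖e‖ / 2), ‖φ z - φ z'‖ₑ ^ q ≤
        C * ∫⁻ y, g y * ENNReal.ofReal (ρ y)) ?_ ?_ ?_ ?_
  · exact ⟨0, by simp, by simp⟩
  · rintro s t hst ⟨C, hC, H⟩
    exact ⟨C, hC, fun φ g h => (lintegral_mono_set hst).trans (H φ g h)⟩
  · rintro s t ⟨C, hC, H⟩ ⟨C', hC', H'⟩
    refine ⟨C + C', ENNReal.add_ne_top.2 ⟨hC, hC'⟩, fun φ g h => ?_⟩
    rw [add_mul]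
    exact (lintegral_union_le _ _ _).trans (add_le_add (H φ g h) (H' φ g h))
  · intro x hx
    obtain ⟨C, hC, r, hr, H⟩ := conn hN hq hρc hρ e he x (hK0 hx)
    exact ⟨Metric.ball x r, mem_nhdsWithin_of_mem_nhds (Metric.ball_mem_nhds x hr), C, hC, H⟩

lemma vv_cont {N : ℕ} (α β γ : ℝ) (hβ : 0 < β) :
    ContinuousOn (fun x : EE N => vv α β γ ‖x‖) {0}ᶜ := by
  unfold vv
  intro x hx
  have hxn : 0 < ‖x‖ := norm_pos_iff.2 hx
  have hc : ContinuousAt (fun x : EE N => ‖x‖) x := continuous_norm.continuousAt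
  refine ContinuousAt.continuousWithinAt ?_
  refine (hc.rpow_const (Or.inl hxn.ne')).mul (ContinuousAt.rpow_const ?_ (Or.inl ?_))
  · exact continuousAt_const.add (hc.rpow_const (Or.inl hxn.ne'))
  · positivity

lemma reduce {N : ℕ} (hN : 2 ≤ N) {q α β γ : ℝ} (hq : 1 < q) (hα : α < 0) (hβ : 0 < β)
    (h1 : 0 < (N : ℝ) + γ) (h2 : (N : ℝ) + γ + α * β < 0) :
    ∃ K : Set (EE N), IsCompact K ∧ K ⊆ {0}ᶜ ∧ ∃ A : ℝ≥0∞, A ≠ ⊤ ∧ ∃ B : ℝ≥0∞, B ≠ ⊤ ∧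
      ∀ (φ : EE N → ℝ) (g : EE N → ℝ≥0∞), UG q φ g → (∃ M : ℝ, ∀ x, |φ x| ≤ M) → ∀ c : ℝ,
      ∫⁻ x, ‖φ x - c‖ₑ ^ q * ENNReal.ofReal (vv α β γ ‖x‖) ≤
        A * (∫⁻ x in K, ‖φ x - c‖ₑ ^ q) +
        B * ∫⁻ x, g x * ENNReal.ofReal (‖x‖ ^ q * vv α β γ ‖x‖) := by
  have hq0 : 0 < q := by linarith
  obtain ⟨Λ, hΛ, hb1, hb2⟩ := exists_big (a := -(N + γ)) (b := N + γ + α * β) (by linarith) h2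
    (2 ^ α * (2 ^ q)⁻¹ * 2⁻¹) (by positivity)
  have hΛ0 : 0 < Λ := by linarith
  have hΛi : 0 < Λ⁻¹ := by positivity
  have hΛi1 : Λ⁻¹ ≤ 1 := inv_le_one_of_one_le₀ hΛ
  set W : EE N → ℝ≥0∞ := fun x => ENNReal.ofReal (vv α β γ ‖x‖) with hW
  have mW : Measurable W := ((vv_meas α β γ).comp measurable_norm).ennreal_ofReal
  set Kd : ℝ≥0∞ := ENNReal.ofReal (Λ ^ (|γ| - α * β)) with hKd
  have hdoub : ∀ x, ∀ σ : ℝ, Λ⁻¹ ≤ σ → σ ≤ Λ → W x ≤ Kd * W (σ • x) := by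
    intro x σ s1 s2
    have s0 : 0 < σ := by linarith
    simp only [hW, hKd]
    rw [← ENNReal.ofReal_mul (by positivity), norm_smul, Real.norm_of_nonneg s0.le]
    exact ENNReal.ofReal_le_ofReal (vv_doubling hα hβ hΛ (norm_nonneg x) s1 s2)
  set ε : ℝ≥0∞ := ENNReal.ofReal ((2 ^ q)⁻¹ * 2⁻¹) with hε
  have hε2 : 2 ^ q * ε ≤ 2⁻¹ := by
    rw [hε, show (2:ℝ≥0∞) ^ q = ENNReal.ofReal (2 ^ q) by
      rw [← ENNReal.ofReal_rpow_of_pos (by norm_num)]; simp]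
    rw [← ENNReal.ofReal_mul (by positivity), ← mul_assoc, mul_inv_cancel₀ (by positivity), one_mul,
      ENNReal.ofReal_inv_of_pos (by norm_num)]
    simp
  have hδ : (2:ℝ) ^ α * (2 ^ q)⁻¹ * 2⁻¹ * 2 ^ (-α) = (2 ^ q)⁻¹ * 2⁻¹ := by
    rw [Real.rpow_neg (by norm_num)]
    have : (2:ℝ) ^ α ≠ 0 := by positivity
    field_simp
  set E0 : Set (EE N) := {x | 0 < ‖x‖ ∧ ‖x‖ ≤ 1} with hE0
  set E1 : Set (EE N) := {x | 1 ≤ ‖x‖} with hE1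
  set F0 : Set (EE N) := {x | 1 ≤ ‖x‖ ∧ ‖x‖ ≤ Λ} with hF0
  set F1 : Set (EE N) := {x | Λ⁻¹ ≤ ‖x‖ ∧ ‖x‖ ≤ 1} with hF1
  set K : Set (EE N) := {x | Λ⁻¹ ≤ ‖x‖ ∧ ‖x‖ ≤ Λ} with hK
  have hFK0 : F0 ⊆ K := fun x hx => ⟨hΛi1.trans hx.1, hx.2⟩
  have hFK1 : F1 ⊆ K := fun x hx => ⟨hx.1, hx.2.trans hΛ⟩
  have mE0 : MeasurableSet E0 := (measurableSet_lt measurable_const measurable_norm).inter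
    (measurableSet_le measurable_norm measurable_const)
  have mE1 : MeasurableSet E1 := measurableSet_le measurable_const measurable_norm
  have mF0 : MeasurableSet F0 := (measurableSet_le measurable_const measurable_norm).inter
    (measurableSet_le measurable_norm measurable_const)
  have mF1 : MeasurableSet F1 := (measurableSet_le measurable_const measurable_norm).inter
    (measurableSet_le measurable_norm measurable_const)
  have hKc : IsCompact K := by
    have hcl : IsClosed K := (isClosed_le continuous_const continuous_norm).inter
      (isClosed_le continuous_norm continuous_const)
    refine (isCompact_closedBall (0 : EE N) Λ).of_isClosed_subset hcl fun x hx => ?_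
    rw [mem_closedBall_zero_iff]; exact hx.2
  have hK0 : K ⊆ {0}ᶜ := by
    intro x hx h0
    rw [Set.mem_singleton_iff] at h0
    subst h0
    have : Λ⁻¹ ≤ ‖(0 : EE N)‖ := hx.1
    rw [norm_zero] at this
    linarith
  obtain ⟨b, hb⟩ := hKc.exists_bound_of_continuousOn ((vv_cont (N := N) α β γ hβ).mono hK0)
  have hWb : ∀ x ∈ K, W x ≤ ENNReal.ofReal b := fun x hx =>
    ENNReal.ofReal_le_ofReal ((le_abs_self _).trans (hb x hx))
  set M0 := ENNReal.ofReal |(Λ ^ N)⁻¹| with hM0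
  set M1 := ENNReal.ofReal |(Λ⁻¹ ^ N)⁻¹| with hM1
  set CD := (ENNReal.ofReal Λ ^ q * ENNReal.ofReal Λ ^ q * Kd * ENNReal.ofReal (Λ ^ N)) with hCD
  have hCDt : CD ≠ ⊤ := by
    refine ENNReal.mul_ne_top (ENNReal.mul_ne_top (ENNReal.mul_ne_top ?_ ?_) ENNReal.ofReal_ne_top)
      ENNReal.ofReal_ne_top <;>
    exact ENNReal.rpow_ne_top_of_nonneg hq0.le ENNReal.ofReal_ne_top
  have h2q : (2:ℝ≥0∞) ^ q ≠ ⊤ := ENNReal.rpow_ne_top_of_nonneg hq0.le (by norm_num)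
  refine ⟨K, hKc, hK0, 2 * (2 ^ q * (M0 * Kd + M1 * Kd)) * ENNReal.ofReal b, ?_,
    2 * (2 ^ q * (CD + CD)), ?_, ?_⟩
  · refine ENNReal.mul_ne_top (ENNReal.mul_ne_top (by norm_num) (ENNReal.mul_ne_top h2q
      (ENNReal.add_ne_top.2 ⟨ENNReal.mul_ne_top ?_ ?_, ENNReal.mul_ne_top ?_ ?_⟩))) ?_ <;>
    exact ENNReal.ofReal_ne_top
  · exact ENNReal.mul_ne_top (by norm_num) (ENNReal.mul_ne_top h2q
      (ENNReal.add_ne_top.2 ⟨hCDt, hCDt⟩))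
  intro φ g h ⟨M, hM⟩ c
  have mφ := h.mφ
  have hWfin : ∫⁻ x, W x ≠ ⊤ := (Integrable.lintegral_lt_top (vv_int hN hα hβ h1 h2)).ne
  have hfin : ∫⁻ x, ‖φ x - c‖ₑ ^ q * W x ≠ ⊤ := by
    refine ne_top_of_le_ne_top (ENNReal.mul_ne_top (a := ENNReal.ofReal (M + |c|) ^ q)
      (ENNReal.rpow_ne_top_of_nonneg hq0.le ENNReal.ofReal_ne_top) hWfin) ?_
    rw [← lintegral_const_mul _ mW]
    refine lintegral_mono fun x => ?_
    gcongr
    rw [Real.enorm_eq_ofReal_abs]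
    apply ENNReal.ofReal_le_ofReal
    exact (abs_sub _ _).trans (by linarith [hM x])
  set D := ∫⁻ x, g x * ENNReal.ofReal (‖x‖ ^ q * vv α β γ ‖x‖) with hD
  have hD' : ∫⁻ x, g x * (‖x‖ₑ ^ q * W x) = D := by
    congr 1; ext x
    rw [ENNReal.ofReal_mul (by positivity), ← ENNReal.ofReal_rpow_of_nonneg (norm_nonneg x) hq0.le,
      ofReal_norm]
  have dl0 := dil hq mW hΛ Kd hdoub (lam := Λ) (hΛi1.trans hΛ) le_rfl h
  have dl1 := dil hq mW hΛ Kd hdoub (lam := Λ⁻¹) le_rfl (hΛi1.trans hΛ) h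
  rw [hD'] at dl0 dl1
  have ab0 := absorb hq mW hΛ0.ne' mE0 mF0 (by
      intro x hx
      have hn : ‖Λ • x‖ = Λ * ‖x‖ := by rw [norm_smul, Real.norm_of_nonneg hΛ0.le]
      rcases le_total (‖Λ • x‖) 1 with hc | hc
      · exact Or.inl ⟨by rw [hn]; exact mul_pos hΛ0 hx.1, hc⟩
      · exact Or.inr ⟨hc, by rw [hn]; exact mul_le_of_le_one_right hΛ0.le hx.2⟩) ε Kd hε2
    (by
      intro y hy
      simp only [hW, hε]
      rw [← ENNReal.ofReal_mul (by positivity), ← ENNReal.ofReal_mul (by positivity), norm_smul,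
        Real.norm_of_nonneg hΛi.le, abs_of_pos (by positivity)]
      apply ENNReal.ofReal_le_ofReal
      refine (vv_zero hα hβ N hΛ hy.1 hy.2).trans ?_
      rw [← hδ]
      have := vv_nonneg α β γ (norm_nonneg y)
      gcongr)
    (by
      intro y hy
      have := hdoub (Λ⁻¹ • y) Λ (hΛi1.trans hΛ) le_rfl
      rwa [smul_inv_smul₀ hΛ0.ne'] at this)
    mφ c (ne_top_of_le_ne_top hfin (setLIntegral_le_lintegral _ _))
  have ab1 := absorb hq mW hΛi.ne' mE1 mF1 (by
      intro x hx
      have hx' : 1 ≤ ‖x‖ := hx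
      have hn : ‖Λ⁻¹ • x‖ = Λ⁻¹ * ‖x‖ := by rw [norm_smul, Real.norm_of_nonneg hΛi.le]
      rcases le_total 1 (‖Λ⁻¹ • x‖) with hc | hc
      · exact Or.inl hc
      · exact Or.inr ⟨by rw [hn]; exact le_mul_of_one_le_right hΛi.le hx', hc⟩) ε Kd hε2
    (by
      intro y hy
      simp only [hW, hε]
      rw [← ENNReal.ofReal_mul (by positivity), ← ENNReal.ofReal_mul (by positivity), norm_smul,
        inv_inv, Real.norm_of_nonneg hΛ0.le, abs_of_pos (by positivity), inv_pow, inv_inv]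
      apply ENNReal.ofReal_le_ofReal
      refine (vv_inf hα hβ N hΛ hy).trans ?_
      rw [← hδ]
      have := vv_nonneg α β γ (norm_nonneg y)
      gcongr)
    (by
      intro y hy
      have := hdoub (Λ • y) Λ⁻¹ le_rfl (hΛi1.trans hΛ)
      rw [inv_smul_smul₀ hΛ0.ne'] at this
      rwa [inv_inv])
    mφ c (ne_top_of_le_ne_top hfin (setLIntegral_le_lintegral _ _))
  have hKb : ∫⁻ x in K, ‖φ x - c‖ₑ ^ q * W x ≤
      ENNReal.ofReal b * ∫⁻ x in K, ‖φ x - c‖ₑ ^ q := by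
    rw [← lintegral_const_mul _ (by fun_prop)]
    refine setLIntegral_mono' hKc.measurableSet fun x hx => ?_
    rw [mul_comm]
    gcongr
    exact hWb x hx
  set Y := ∫⁻ x in K, ‖φ x - c‖ₑ ^ q
  have hY0 := (lintegral_mono_set (μ := volume) (f := fun x => ‖φ x - c‖ₑ ^ q * W x) hFK0).trans hKb
  have hY1 := (lintegral_mono_set (μ := volume) (f := fun x => ‖φ x - c‖ₑ ^ q * W x) hFK1).trans hKb
  have : Nonempty (Fin N) := ⟨⟨0, by omega⟩⟩
  have hcover : (Set.univ : Set (EE N)) ⊆ {0} ∪ (E0 ∪ E1) := by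
    intro x _
    by_cases hx : x = 0
    · left; exact hx
    · right
      rcases le_total ‖x‖ 1 with hc | hc
      · left; exact ⟨norm_pos_iff.2 hx, hc⟩
      · right; exact hc
  calc ∫⁻ x, ‖φ x - c‖ₑ ^ q * W x = ∫⁻ x in Set.univ, ‖φ x - c‖ₑ ^ q * W x := by simp
    _ ≤ ∫⁻ x in {0} ∪ (E0 ∪ E1), ‖φ x - c‖ₑ ^ q * W x := lintegral_mono_set hcover
    _ ≤ (∫⁻ x in {0}, ‖φ x - c‖ₑ ^ q * W x) + ∫⁻ x in E0 ∪ E1, ‖φ x - c‖ₑ ^ q * W x :=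
        lintegral_union_le _ _ _
    _ = ∫⁻ x in E0 ∪ E1, ‖φ x - c‖ₑ ^ q * W x := by simp
    _ ≤ (∫⁻ x in E0, ‖φ x - c‖ₑ ^ q * W x) + ∫⁻ x in E1, ‖φ x - c‖ₑ ^ q * W x :=
        lintegral_union_le _ _ _
    _ ≤ 2 * (2 ^ q * (M0 * Kd * (ENNReal.ofReal b * Y) + CD * D)) +
        2 * (2 ^ q * (M1 * Kd * (ENNReal.ofReal b * Y) + CD * D)) := by
        refine add_le_add (ab0.trans ?_) (ab1.trans ?_)
        · gcongr
        · gcongr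
    _ = _ := by ring

lemma main_l {N : ℕ} (hN : 2 ≤ N) {q α β γ : ℝ} (hq : 1 < q) (hα : α < 0) (hβ : 0 < β)
    (h1 : 0 < (N : ℝ) + γ) (h2 : (N : ℝ) + γ + α * β < 0) :
    ∃ C : ℝ≥0∞, C ≠ ⊤ ∧
      ∀ (φ : EE N → ℝ) (g : EE N → ℝ≥0∞), UG q φ g → (∃ M : ℝ, ∀ x, |φ x| ≤ M) → ∀ m : ℝ,
      (∀ c : ℝ, ∫⁻ x, ‖φ x - m‖ₑ ^ q * ENNReal.ofReal (vv α β γ ‖x‖) ≤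
        2 ^ q * (2 * ∫⁻ x, ‖φ x - c‖ₑ ^ q * ENNReal.ofReal (vv α β γ ‖x‖))) →
      ∫⁻ x, ‖φ x - m‖ₑ ^ q * ENNReal.ofReal (vv α β γ ‖x‖) ≤
        C * ∫⁻ x, g x * ENNReal.ofReal (‖x‖ ^ q * vv α β γ ‖x‖) := by
  have hq0 : 0 < q := by linarith
  obtain ⟨K, hKc, hK0, A, hA, B, hB, H⟩ := reduce hN hq hα hβ h1 h2
  have : Nonempty (Fin N) := ⟨⟨0, by omega⟩⟩
  obtain ⟨e, he⟩ := exists_ne (0 : EE N)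
  have hρc : ContinuousOn (fun x : EE N => ‖x‖ ^ q * vv α β γ ‖x‖) {0}ᶜ :=
    ((continuous_norm.rpow_const (fun _ => Or.inr hq0.le)).continuousOn).mul (vv_cont α β γ hβ)
  have hρ : ∀ x : EE N, x ≠ 0 → 0 < ‖x‖ ^ q * vv α β γ ‖x‖ := by
    intro x hx
    have := norm_pos_iff.2 hx
    exact mul_pos (by positivity) (vv_pos _ _ _ this)
  obtain ⟨C, hC, HP⟩ := poin_cpt hN hq hρc hρ e he hKc hK0
  set B0 := Metric.ball e (‖e‖ / 2) with hB0
  have hv0 : volume B0 ≠ 0 := (Metric.measure_ball_pos _ _ (by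
    have := norm_pos_iff.2 he; positivity)).ne'
  have hvt : volume B0 ≠ ⊤ := measure_ball_lt_top.ne
  refine ⟨(volume B0)⁻¹ * (2 ^ q * (2 * (A * C + B * volume B0))), ?_, ?_⟩
  · exact ENNReal.mul_ne_top (ENNReal.inv_ne_top.2 hv0) (ENNReal.mul_ne_top
      (ENNReal.rpow_ne_top_of_nonneg hq0.le (by norm_num)) (ENNReal.mul_ne_top (by norm_num)
      (ENNReal.add_ne_top.2 ⟨ENNReal.mul_ne_top hA hC, ENNReal.mul_ne_top hB hvt⟩)))
  intro φ g h hM m hm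
  set X := ∫⁻ x, ‖φ x - m‖ₑ ^ q * ENNReal.ofReal (vv α β γ ‖x‖)
  have hP := HP φ g h
  set D := ∫⁻ x, g x * ENNReal.ofReal (‖x‖ ^ q * vv α β γ ‖x‖)
  have mφ := h.mφ
  have m2 : Measurable fun p : EE N × EE N => ‖φ p.1 - φ p.2‖ₑ ^ q := by fun_prop
  have m3 : Measurable fun u : EE N => ∫⁻ z in K, ‖φ z - φ u‖ₑ ^ q := m2.lintegral_prod_left'
  have key : volume B0 * X ≤ 2 ^ q * (2 * (A * C + B * volume B0)) * D := by
    calc volume B0 * X = ∫⁻ u in B0, X := by rw [setLIntegral_const, mul_comm]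
      _ ≤ ∫⁻ u in B0, 2 ^ q * (2 * (A * (∫⁻ z in K, ‖φ z - φ u‖ₑ ^ q) + B * D)) := by
          refine lintegral_mono fun u => (hm (φ u)).trans ?_
          gcongr
          exact H φ g h hM (φ u)
      _ = 2 ^ q * (2 * (A * (∫⁻ u in B0, ∫⁻ z in K, ‖φ z - φ u‖ₑ ^ q) + B * D * volume B0)) := by
          rw [lintegral_const_mul _ (by fun_prop), lintegral_const_mul _ (by fun_prop),
            lintegral_add_left (by fun_prop), lintegral_const_mul _ (by fun_prop),
            setLIntegral_const]
      _ ≤ 2 ^ q * (2 * (A * (C * D) + B * D * volume B0)) := by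
          gcongr
          rw [lintegral_lintegral_swap]
          · exact hP
          · apply Measurable.aemeasurable
            simp only [Function.uncurry_def]; fun_prop
      _ = _ := by ring
  rw [mul_assoc _ _ D]
  calc X = (volume B0)⁻¹ * (volume B0 * X) := by
          rw [← mul_assoc, ENNReal.inv_mul_cancel hv0 hvt, one_mul]
    _ ≤ _ := by gcongr

lemma mean_opt {N : ℕ} (hN : 2 ≤ N) {q α β γ : ℝ} (hq : 1 < q) (hα : α < 0) (hβ : 0 < β)
    (h1 : 0 < (N : ℝ) + γ) (h2 : (N : ℝ) + γ + α * β < 0) {φ : EE N → ℝ} (mφ : Measurable φ)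
    (hM : ∃ M : ℝ, ∀ x, |φ x| ≤ M) (c : ℝ) :
    ∫⁻ x, ‖φ x - (∫ y, φ y * vv α β γ ‖y‖) / (∫ y : EE N, vv α β γ ‖y‖)‖ₑ ^ q *
        ENNReal.ofReal (vv α β γ ‖x‖) ≤
      2 ^ q * (2 * ∫⁻ x, ‖φ x - c‖ₑ ^ q * ENNReal.ofReal (vv α β γ ‖x‖)) := by
  have hq0 : 0 < q := by linarith
  obtain ⟨M, hM⟩ := hM
  have hint := vv_int hN hα hβ h1 h2
  set I := ∫ y : EE N, vv α β γ ‖y‖ with hI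
  set m := (∫ y, φ y * vv α β γ ‖y‖) / I with hm
  set W : EE N → ℝ≥0∞ := fun x => ENNReal.ofReal (vv α β γ ‖x‖) with hW
  have mW : Measurable W := ((vv_meas α β γ).comp measurable_norm).ennreal_ofReal
  set T := ∫⁻ x, W x with hT
  have hTt : T ≠ ⊤ := (Integrable.lintegral_lt_top hint).ne
  have hTI : T = ENNReal.ofReal I := by
    rw [hT, hI, ofReal_integral_eq_lintegral_ofReal hint
      (Filter.Eventually.of_forall fun x => vv_nonneg _ _ _ (norm_nonneg x))]
  set Xc := ∫⁻ x, ‖φ x - c‖ₑ ^ q * W x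
  have key : ‖c - m‖ₑ ^ q * T ≤ Xc := by
    by_cases hT0 : T = 0
    · simp [hT0]
    have hI0 : 0 < I := by
      rw [hTI] at hT0
      exact ENNReal.ofReal_pos.1 (pos_iff_ne_zero.2 hT0)
    have hφi : Integrable (fun x => φ x * vv α β γ ‖x‖) :=
      hint.bdd_mul (c := M) mφ.aestronglyMeasurable (Filter.Eventually.of_forall hM)
    have e1 : (c - m) * I = ∫ x, (c - φ x) * vv α β γ ‖x‖ := by
      simp_rw [sub_mul]
      rw [integral_sub (hint.const_mul c) hφi, integral_const_mul, hm, ← hI]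
      field_simp
    have e2 : ‖c - m‖ₑ * T ≤ ∫⁻ x, ‖φ x - c‖ₑ * W x := by
      rw [hTI, ← Real.enorm_eq_ofReal hI0.le, ← enorm_mul, e1]
      refine (enorm_integral_le_lintegral_enorm _).trans (lintegral_mono fun x => ?_)
      rw [enorm_mul, Real.enorm_eq_ofReal (vv_nonneg _ _ _ (norm_nonneg x)), ← enorm_neg, neg_sub]
    have J := jensen_fin (volume.withDensity W) hq (f := fun x => ‖φ x - c‖ₑ)
      (by fun_prop : Measurable _).aemeasurable
    rw [withDensity_apply _ MeasurableSet.univ, lintegral_withDensity_eq_lintegral_mul _ mW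
      (by fun_prop), lintegral_withDensity_eq_lintegral_mul _ mW (by fun_prop)] at J
    simp only [Pi.mul_apply, Measure.restrict_univ] at J
    simp_rw [mul_comm (W _)] at J
    have e3 : (‖c - m‖ₑ ^ q * T) * T ^ (q - 1) ≤ Xc * T ^ (q - 1) := by
      calc _ = (‖c - m‖ₑ * T) ^ q := by
            rw [ENNReal.mul_rpow_of_nonneg _ _ hq0.le, mul_assoc]
            congr 1
            nth_rewrite 1 [← ENNReal.rpow_one T]
            rw [← ENNReal.rpow_add _ _ hT0 hTt]
            congr 1; ring
        _ ≤ _ := (ENNReal.rpow_le_rpow e2 hq0.le).trans (J.trans (le_of_eq (mul_comm _ _)))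
    refine (ENNReal.mul_le_mul_iff_left ?_ ?_).1 e3
    · simp [ENNReal.rpow_eq_zero_iff, hT0, hTt]
    · exact ENNReal.rpow_ne_top_of_nonneg (by linarith) hTt
  calc _ ≤ ∫⁻ x, 2 ^ q * (‖φ x - c‖ₑ ^ q * W x + ‖c - m‖ₑ ^ q * W x) := by
        refine lintegral_mono fun x => ?_
        calc _ ≤ 2 ^ q * (‖φ x - c‖ₑ ^ q + ‖c - m‖ₑ ^ q) * W x := by
              gcongr; exact tri hq _ _ _
          _ = _ := by ring
    _ = 2 ^ q * (Xc + ‖c - m‖ₑ ^ q * T) := by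
        rw [lintegral_const_mul _ (by fun_prop), lintegral_add_left (by fun_prop),
          lintegral_const_mul _ mW]
    _ ≤ 2 ^ q * (Xc + Xc) := by gcongr
    _ = _ := by rw [two_mul]

theorem hardy_poincare_example
    (N : ℕ) (q α β γ : ℝ) (hN : 2 ≤ N) (hq1 : 1 < q)
    (hq2 : N = 2 → q ≤ 2) (hq3 : 3 ≤ N → q < N)
    (hα : α < 0) (hβ : 0 < β)
    (h1 : 0 < (N : ℝ) + γ) (h2 : (N : ℝ) + γ + α * β < 0) :
    ∃ C : ℝ, 0 < C ∧
      ∀ φ : EuclideanSpace ℝ (Fin N) → ℝ,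
        (∃ L, LipschitzWith L φ) → HasCompactSupport φ →
        ∫ x, |φ x - (∫ y, φ y * (‖y‖ ^ γ * (1 + ‖y‖ ^ β) ^ α)) /
              (∫ y : EuclideanSpace ℝ (Fin N), ‖y‖ ^ γ * (1 + ‖y‖ ^ β) ^ α)| ^ q *
            (‖x‖ ^ γ * (1 + ‖x‖ ^ β) ^ α) ≤
          C * ∫ x, ‖fderiv ℝ φ x‖ ^ q * (‖x‖ ^ (γ + q) * (1 + ‖x‖ ^ β) ^ α) := by
  have hq0 : 0 < q := by linarith
  obtain ⟨C, hC, H⟩ := main_l hN hq1 hα hβ h1 h2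
  refine ⟨C.toReal + 1, by positivity, ?_⟩
  rintro φ ⟨L, hL⟩ hsupp
  have mφ : Measurable φ := hL.continuous.measurable
  have hM : ∃ M : ℝ, ∀ x, |φ x| ≤ M := hsupp.exists_bound_of_continuous hL.continuous
  have hmain := H φ _ (ug_lip hq1 φ hL) hM _ (fun c => mean_opt hN hq1 hα hβ h1 h2 mφ hM c)
  have : Nonempty (Fin N) := ⟨⟨0, by omega⟩⟩
  have hint := vv_int hN hα hβ h1 h2
  change ∫ x, |φ x - (∫ y, φ y * vv α β γ ‖y‖) / (∫ y : EE N, vv α β γ ‖y‖)| ^ q *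
    vv α β γ ‖x‖ ≤ _
  set m := (∫ y, φ y * vv α β γ ‖y‖) / (∫ y : EE N, vv α β γ ‖y‖) with hm
  have mv : Measurable (fun x : EE N => vv α β γ ‖x‖) := (vv_meas α β γ).comp measurable_norm
  have mfd : Measurable (fun x => ‖fderiv ℝ φ x‖) := (measurable_fderiv ℝ φ).norm
  set D := ∫⁻ x, gr q φ x * ENNReal.ofReal (‖x‖ ^ q * vv α β γ ‖x‖) with hD
  have hae0 : ∀ᵐ x : EE N, x ≠ 0 := by
    simp [ae_iff]
  have hlhs : ∫ x, |φ x - m| ^ q * vv α β γ ‖x‖ =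
      (∫⁻ x, ‖φ x - m‖ₑ ^ q * ENNReal.ofReal (vv α β γ ‖x‖)).toReal := by
    rw [integral_eq_lintegral_of_nonneg_ae]
    · congr 2; ext x
      rw [ENNReal.ofReal_mul (by positivity), Real.enorm_eq_ofReal_abs,
        ENNReal.ofReal_rpow_of_nonneg (abs_nonneg _) hq0.le]
    · exact Filter.Eventually.of_forall fun x =>
        mul_nonneg (by positivity) (vv_nonneg _ _ _ (norm_nonneg x))
    · have : Measurable fun x => |φ x - m| := by
        simp_rw [← Real.norm_eq_abs]; fun_prop
      exact ((this.pow_const q).mul mv).aestronglyMeasurable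
  have hrhs : ∫ x, ‖fderiv ℝ φ x‖ ^ q * (‖x‖ ^ (γ + q) * (1 + ‖x‖ ^ β) ^ α) = D.toReal := by
    rw [integral_eq_lintegral_of_nonneg_ae]
    · congr 1
      refine lintegral_congr_ae ?_
      filter_upwards [gr_ae q φ hL, hae0] with x hx hx0
      have hxn : 0 < ‖x‖ := norm_pos_iff.2 hx0
      rw [hx, ENNReal.ofReal_mul (by positivity), ← ENNReal.ofReal_rpow_of_nonneg (norm_nonneg _) hq0.le,
        ofReal_norm]
      congr 2
      unfold vv
      rw [Real.rpow_add hxn]; ring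
    · exact Filter.Eventually.of_forall fun x => by positivity
    · refine Measurable.aestronglyMeasurable ?_
      fun_prop
  have hDt : D ≠ ⊤ := by
    obtain ⟨R, hR⟩ := hsupp.isCompact.isBounded.exists_norm_le
    have hfin : ∫⁻ x : EE N, ENNReal.ofReal (vv α β γ ‖x‖) ≠ ⊤ := (Integrable.lintegral_lt_top hint).ne
    refine ne_top_of_le_ne_top (ENNReal.mul_ne_top
      (a := (L : ℝ≥0∞) ^ q * ENNReal.ofReal (|R| ^ q)) (ENNReal.mul_ne_top
        (ENNReal.rpow_ne_top_of_nonneg hq0.le (by simp)) ENNReal.ofReal_ne_top) hfin) ?_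
    rw [← lintegral_const_mul _ mv.ennreal_ofReal]
    refine lintegral_mono_ae ?_
    filter_upwards [gr_ae q φ hL] with x hx
    rw [hx]
    by_cases hxs : x ∈ tsupport φ
    · rw [ENNReal.ofReal_mul (by positivity), mul_assoc]
      gcongr
      · rw [enorm_eq_nnnorm]
        exact_mod_cast norm_fderiv_le_of_lipschitz ℝ hL
      · exact (hR x hxs).trans (le_abs_self R)
    · have : fderiv ℝ φ x = 0 := by
        by_contra hne
        exact hxs (support_fderiv_subset ℝ hne)
      have h0 : ‖fderiv ℝ φ x‖ₑ = 0 := by rw [← ofReal_norm, this, norm_zero, ENNReal.ofReal_zero]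
      rw [h0, ENNReal.zero_rpow_of_pos hq0, zero_mul]
      exact zero_le
  rw [hlhs, hrhs]
  calc _ ≤ (C * D).toReal := ENNReal.toReal_mono (ENNReal.mul_ne_top hC hDt) hmain
    _ = C.toReal * D.toReal := ENNReal.toReal_mul
    _ ≤ _ := by
      have : 0 ≤ D.toReal := ENNReal.toReal_nonneg
      nlinarith
end

section
/- Let q > 1, α < 0 < β, γ ∈ ℝ with γ + N > 0, |αβ + γ + 2| ≥ |γ + 2|, sgn(αβ + γ + 2) = sgn(γ + 2), and αβ + γ + N > 0. Then there exists a finite constant C_H > 0 such that for every compactly supported φ ∈ W^{1,∞}(ℝ^N), ∫_{ℝ^N} |φ|^q |x|^γ(1+|x|^β)^α dx ≤ C_H ∫_{ℝ^N} |∇φ|^q |x|^{γ+q}(1+|x|^β)^α dx. -/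
open MeasureTheory

lemma ray_bound {E : Type*} [NormedAddCommGroup E] [NormedSpace ℝ E]
    (φ : E → ℝ) (L : NNReal) (hL : LipschitzWith L φ) (hc : HasCompactSupport φ)
    (x : E) (hx : x ≠ 0)
    (hd : ∀ᵐ t ∂(volume.restrict (Set.Ioi (1:ℝ))), DifferentiableAt ℝ φ (t • x)) :
    ‖φ x‖ₑ ≤ ∫⁻ t in Set.Ioi (1:ℝ), ‖fderiv ℝ φ (t • x)‖ₑ * ‖x‖ₑ := by
  obtain ⟨R, hR⟩ := hc.isCompact.isBounded.subset_closedBall (0:E)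
  have hxn : 0 < ‖x‖ := norm_pos_iff.2 hx
  obtain ⟨T, hT1, hT⟩ : ∃ T : ℝ, 1 ≤ T ∧ φ (T • x) = 0 := by
    refine ⟨max 1 ((|R| + 1) / ‖x‖), le_max_left _ _, ?_⟩
    apply image_eq_zero_of_notMem_tsupport
    intro h
    have h := hR h
    rw [mem_closedBall_zero_iff, norm_smul, Real.norm_eq_abs, abs_of_pos (by positivity)] at h
    have h2 : (|R| + 1) / ‖x‖ * ‖x‖ ≤ R := le_trans (by gcongr; exact le_max_right _ _) h
    rw [div_mul_cancel₀ _ hxn.ne'] at h2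
    linarith [le_abs_self R]
  have hlip : LipschitzWith (L * ‖x‖₊) (fun t : ℝ => φ (t • x)) := by
    apply hL.comp
    apply LipschitzWith.of_dist_le_mul
    intro s t
    rw [dist_eq_norm, ← sub_smul, norm_smul, mul_comm, dist_eq_norm]; rfl
  have hac := (hlip.lipschitzOnWith (s := Set.uIcc 1 T)).absolutelyContinuousOnInterval
  have hftc := hac.integral_deriv_eq_sub
  simp only [hT, one_smul, zero_sub] at hftc
  rw [← enorm_neg, ← hftc, intervalIntegral.integral_of_le hT1]
  refine (enorm_integral_le_lintegral_enorm _).trans ?_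
  refine (lintegral_mono_set Set.Ioc_subset_Ioi_self).trans ?_
  apply lintegral_mono_ae
  filter_upwards [hd] with t ht
  have : HasDerivAt (fun t : ℝ => φ (t • x)) (fderiv ℝ φ (t • x) x) t := by
    have h1 : HasDerivAt (fun t : ℝ => t • x) x t := by
      simpa using (hasDerivAt_id t).smul_const x
    exact ht.hasFDerivAt.comp_hasDerivAt t h1
  rw [this.deriv]
  exact ContinuousLinearMap.le_opENorm _ _

lemma holder_ray (q a : ℝ) (hq : 1 < q) (f : ℝ → ENNReal) (hf : Measurable f) :
    (∫⁻ t in Set.Ioi (1:ℝ), f t) ^ q ≤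
      (∫⁻ t in Set.Ioi (1:ℝ), ENNReal.ofReal (t ^ (-a * q.conjExponent))) ^ (q - 1) *
      ∫⁻ t in Set.Ioi (1:ℝ), f t ^ q * ENNReal.ofReal (t ^ (a * q)) := by
  have hpq := (Real.HolderConjugate.conjExponent hq)
  have hm : ∀ s : ℝ, Measurable (fun t : ℝ => ENNReal.ofReal (t ^ s)) := fun s => by fun_prop
  have h := ENNReal.lintegral_mul_le_Lp_mul_Lq (volume.restrict (Set.Ioi (1:ℝ))) hpq
    (f := fun t => f t * ENNReal.ofReal (t ^ a)) (g := fun t => ENNReal.ofReal (t ^ (-a)))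
    (hf.mul (hm a)).aemeasurable (hm _).aemeasurable
  have e1 : ∫⁻ t in Set.Ioi (1:ℝ), ((fun t => f t * ENNReal.ofReal (t ^ a)) * (fun t => ENNReal.ofReal (t ^ (-a)))) t = ∫⁻ t in Set.Ioi (1:ℝ), f t := by
    apply setLIntegral_congr_fun measurableSet_Ioi
    intro t ht
    have ht0 : (0:ℝ) < t := lt_trans one_pos ht
    simp only [Pi.mul_apply]
    rw [mul_assoc, ← ENNReal.ofReal_mul (by positivity), ← Real.rpow_add ht0]
    simp
  have e2 : ∫⁻ t in Set.Ioi (1:ℝ), (f t * ENNReal.ofReal (t ^ a)) ^ q = ∫⁻ t in Set.Ioi (1:ℝ), f t ^ q * ENNReal.ofReal (t ^ (a * q)) := by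
    apply setLIntegral_congr_fun measurableSet_Ioi
    intro t ht
    have ht0 : (0:ℝ) < t := lt_trans one_pos ht
    simp only
    rw [ENNReal.mul_rpow_of_nonneg _ _ (by linarith), ENNReal.ofReal_rpow_of_nonneg (by positivity) (by linarith), ← Real.rpow_mul ht0.le]
  have e3 : ∫⁻ t in Set.Ioi (1:ℝ), (ENNReal.ofReal (t ^ (-a))) ^ q.conjExponent = ∫⁻ t in Set.Ioi (1:ℝ), ENNReal.ofReal (t ^ (-a * q.conjExponent)) := by
    apply setLIntegral_congr_fun measurableSet_Ioi
    intro t ht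
    have ht0 : (0:ℝ) < t := lt_trans one_pos ht
    simp only
    rw [ENNReal.ofReal_rpow_of_nonneg (by positivity) hpq.symm.nonneg, ← Real.rpow_mul ht0.le]
  rw [e1, e2, e3] at h
  calc _ ≤ _ := ENNReal.rpow_le_rpow h (by linarith : 0 ≤ q)
    _ = _ := by
      rw [ENNReal.mul_rpow_of_nonneg _ _ (by linarith), ← ENNReal.rpow_mul, ← ENNReal.rpow_mul, mul_comm]
      congr 2
      · rw [Real.conjExponent]; field_simp
      · rw [one_div_mul_cancel (by linarith)]; simp

lemma pow_fin (s : ℝ) (hs : s < -1) : ∫⁻ t in Set.Ioi (1:ℝ), ENNReal.ofReal (t ^ s) < ⊤ :=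
  (integrableOn_Ioi_rpow_of_lt hs one_pos).lintegral_lt_top

lemma weight_le (α β γ q r t : ℝ) (hα : α < 0) (hβ : 0 < β) (hr : 0 < r) (ht : 1 ≤ t) :
    r ^ q * (r ^ γ * (1 + r ^ β) ^ α) ≤
      t ^ (-(q + γ + α * β)) * ((t * r) ^ (γ + q) * (1 + (t * r) ^ β) ^ α) := by
  have ht0 : 0 < t := by linarith
  have h1 : (t ^ β * (1 + r ^ β)) ^ α ≤ (1 + (t * r) ^ β) ^ α := by
    apply Real.rpow_le_rpow_of_nonpos (by positivity) _ hα.le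
    rw [Real.mul_rpow ht0.le hr.le]
    have := Real.one_le_rpow ht hβ.le
    nlinarith
  rw [Real.mul_rpow (by positivity) (by positivity), ← Real.rpow_mul ht0.le] at h1
  calc _ = t ^ (-(q + γ + α * β)) * ((t * r) ^ (γ + q) * (t ^ (β * α) * (1 + r ^ β) ^ α)) := by
        rw [Real.mul_rpow ht0.le hr.le, Real.rpow_add hr]
        have : t ^ (-(q + γ + α * β)) * t ^ (γ + q) * t ^ (β * α) = 1 := by
          rw [← Real.rpow_add ht0, ← Real.rpow_add ht0, ← Real.rpow_zero t]; congr 1; ring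
        linear_combination (- r ^ γ * r ^ q * (1 + r ^ β) ^ α) * this
    _ ≤ _ := by gcongr

lemma ae_ray {N : ℕ} (φ : EuclideanSpace ℝ (Fin N) → ℝ) (L : NNReal) (hL : LipschitzWith L φ) :
    ∀ᵐ x, ∀ᵐ t ∂(volume.restrict (Set.Ioi (1:ℝ))), DifferentiableAt ℝ φ (t • x) := by
  rw [Measure.ae_ae_comm]
  · filter_upwards [ae_restrict_mem measurableSet_Ioi] with t ht
    have ht0 : t ≠ 0 := by have : (1:ℝ) < t := ht; linarith
    have hq : Measure.QuasiMeasurePreserving (fun x : EuclideanSpace ℝ (Fin N) => t • x) volume volume := by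
      refine ⟨by fun_prop, ?_⟩
      rw [Measure.map_addHaar_smul _ ht0]
      exact Measure.smul_absolutelyContinuous
    exact hq.ae hL.ae_differentiableAt
  · exact (by fun_prop : Measurable (fun p : EuclideanSpace ℝ (Fin N) × ℝ => p.2 • p.1)) (measurableSet_of_differentiableAt ℝ φ)

lemma dil_s11 {N : ℕ} (H : EuclideanSpace ℝ (Fin N) → ENNReal) (hH : Measurable H) (t : ℝ) (ht : 0 < t) :
    ∫⁻ x, H (t • x) = ENNReal.ofReal (t ^ (-(N:ℝ))) * ∫⁻ x, H x := by
  rw [← lintegral_map (f := H) (g := fun x => t • x) hH (by fun_prop), Measure.map_addHaar_smul _ ht.ne',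
    lintegral_smul_measure, finrank_euclideanSpace_fin, abs_of_pos (by positivity), Real.rpow_neg ht.le, Real.rpow_natCast]
  rfl

lemma integ {N : ℕ} (hN : 1 ≤ N) (q α β γ : ℝ) (hq : 1 < q) (hα : α < 0) (hβ : 0 < β) (h1 : 0 < γ + N)
    (φ : EuclideanSpace ℝ (Fin N) → ℝ) (L : NNReal) (hL : LipschitzWith L φ) (hc : HasCompactSupport φ) :
    Integrable (fun x => ‖fderiv ℝ φ x‖ ^ q * (‖x‖ ^ (γ + q) * (1 + ‖x‖ ^ β) ^ α)) := by
  haveI : Nonempty (Fin N) := ⟨⟨0, hN⟩⟩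
  obtain ⟨R, hR⟩ := hc.isCompact.isBounded.subset_ball (0 : EuclideanSpace ℝ (Fin N))
  have hR' : ∀ x, x ∉ Metric.ball (0 : EuclideanSpace ℝ (Fin N)) R → fderiv ℝ φ x = 0 := by
    intro x hx
    by_contra h
    exact hx (hR (support_fderiv_subset ℝ h))
  have hi : IntegrableOn (fun x : EuclideanSpace ℝ (Fin N) => (L:ℝ) ^ q * ‖x‖ ^ (γ + q)) (Metric.ball 0 R) := by
    apply Integrable.const_mul
    apply (integrableOn_fun_norm_addHaar (E := EuclideanSpace ℝ (Fin N)) volume (f := fun y => y ^ (γ + q)) (r := R)).2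
    have h0 : IntegrableOn (fun y : ℝ => y ^ ((N:ℝ) - 1 + (γ + q))) (Set.Ioo 0 R) := by
      rcases le_or_gt R 0 with h | h
      · simp [Set.Ioo_eq_empty (not_lt.2 h)]
      · exact (intervalIntegral.integrableOn_Ioo_rpow_iff h).2 (by linarith)
    refine h0.congr_fun ?_ measurableSet_Ioo
    intro y hy
    simp only [finrank_euclideanSpace_fin, smul_eq_mul]
    rw [Real.rpow_add hy.1, ← Real.rpow_natCast]
    push_cast [hN]; rfl
  rw [← integrableOn_iff_integrable_of_support_subset (s := Metric.ball 0 R)]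
  · refine Integrable.mono' hi ?_ ?_
    · have := measurable_fderiv ℝ φ
      exact (by fun_prop : Measurable _).aestronglyMeasurable
    · refine Filter.Eventually.of_forall fun x => ?_
      rw [Real.norm_of_nonneg (by positivity)]
      have := norm_fderiv_le_of_lipschitz ℝ hL (x₀ := x)
      have h2 : (1 + ‖x‖ ^ β) ^ α ≤ 1 := Real.rpow_le_one_of_one_le_of_nonpos (le_add_of_nonneg_right (by positivity)) hα.le
      have h3 : ‖x‖ ^ (γ + q) * (1 + ‖x‖ ^ β) ^ α ≤ ‖x‖ ^ (γ + q) := mul_le_of_le_one_right (by positivity) h2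
      gcongr
  · intro x hx
    by_contra h
    apply hx
    simp only [hR' x h]
    rw [norm_zero, Real.zero_rpow (by linarith), zero_mul]

lemma main_lint {N : ℕ} (hN : 1 ≤ N) (q α β γ : ℝ) (hq : 1 < q) (hα : α < 0) (hβ : 0 < β)
    (a : ℝ) (φ : EuclideanSpace ℝ (Fin N) → ℝ) (L : NNReal) (hL : LipschitzWith L φ)
    (hc : HasCompactSupport φ) :
    ∫⁻ x, ENNReal.ofReal (|φ x| ^ q * (‖x‖ ^ γ * (1 + ‖x‖ ^ β) ^ α)) ≤
      (∫⁻ t in Set.Ioi (1:ℝ), ENNReal.ofReal (t ^ (-a * q.conjExponent))) ^ (q - 1) *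
      ((∫⁻ t in Set.Ioi (1:ℝ), ENNReal.ofReal (t ^ (a * q - (q + γ + α * β) - N))) *
      ∫⁻ x, ENNReal.ofReal (‖fderiv ℝ φ x‖ ^ q * (‖x‖ ^ (γ + q) * (1 + ‖x‖ ^ β) ^ α))) := by
  haveI : Nonempty (Fin N) := ⟨⟨0, hN⟩⟩
  set A := ∫⁻ t in Set.Ioi (1:ℝ), ENNReal.ofReal (t ^ (-a * q.conjExponent)) with hA
  have hq0 : 0 ≤ q := by linarith
  have hfd := measurable_fderiv ℝ φ
  let H : EuclideanSpace ℝ (Fin N) → ENNReal := fun x =>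
    ENNReal.ofReal (‖fderiv ℝ φ x‖ ^ q * (‖x‖ ^ (γ + q) * (1 + ‖x‖ ^ β) ^ α))
  have hH : Measurable H := by fun_prop
  let K : EuclideanSpace ℝ (Fin N) → ℝ → ENNReal := fun x t =>
    (‖fderiv ℝ φ (t • x)‖ₑ * ‖x‖ₑ) ^ q * ENNReal.ofReal (t ^ (a * q)) *
      ENNReal.ofReal (‖x‖ ^ γ * (1 + ‖x‖ ^ β) ^ α)
  have hK : Measurable (Function.uncurry K) := by
    have h1 : Measurable (fun p : EuclideanSpace ℝ (Fin N) × ℝ => fderiv ℝ φ (p.2 • p.1)) :=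
      hfd.comp (by fun_prop)
    have h2 : Measurable (fun p : EuclideanSpace ℝ (Fin N) × ℝ => ‖fderiv ℝ φ (p.2 • p.1)‖ₑ) :=
      h1.enorm
    simp only [K, Function.uncurry_def]
    fun_prop
  have hne : ∀ᵐ x : EuclideanSpace ℝ (Fin N), x ≠ 0 := Measure.ae_ne volume 0
  calc _ ≤ ∫⁻ x, A ^ (q - 1) * ∫⁻ t in Set.Ioi (1:ℝ), K x t := by
        apply lintegral_mono_ae
        filter_upwards [ae_ray φ L hL, hne] with x hx hx0
        have hm : Measurable (fun t : ℝ => ‖fderiv ℝ φ (t • x)‖ₑ * ‖x‖ₑ) := by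
          have h1 : Measurable (fun t : ℝ => fderiv ℝ φ (t • x)) := hfd.comp (by fun_prop)
          exact h1.enorm.mul_const _
        have h1 := (ENNReal.rpow_le_rpow (ray_bound φ L hL hc x hx0 hx) hq0).trans
          (holder_ray q a hq _ hm)
        rw [ENNReal.ofReal_mul (by positivity), ← ENNReal.ofReal_rpow_of_nonneg (abs_nonneg _) hq0,
          ← Real.enorm_eq_ofReal_abs]
        refine (mul_le_mul_left h1 _).trans ?_
        rw [mul_assoc, ← lintegral_mul_const]
        have := hm
        fun_prop
    _ = A ^ (q - 1) * ∫⁻ t in Set.Ioi (1:ℝ), ∫⁻ x, K x t := by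
        rw [lintegral_const_mul _ hK.lintegral_prod_right, lintegral_lintegral_swap hK.aemeasurable]
    _ ≤ A ^ (q - 1) * ∫⁻ t in Set.Ioi (1:ℝ),
          ENNReal.ofReal (t ^ (a * q - (q + γ + α * β) - N)) * ∫⁻ x, H x := by
        refine mul_le_mul_right (setLIntegral_mono' measurableSet_Ioi ?_) _
        intro t ht
        have ht1 : (1:ℝ) ≤ t := le_of_lt ht
        have ht0 : 0 < t := by linarith
        calc _ ≤ ∫⁻ x, ENNReal.ofReal (t ^ (a * q - (q + γ + α * β))) * H (t • x) := by
              apply lintegral_mono_ae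
              filter_upwards [hne] with x hx0
              have hr : 0 < ‖x‖ := norm_pos_iff.2 hx0
              simp only [K, H]
              rw [← ofReal_norm, ← ofReal_norm, ← ENNReal.ofReal_mul (by positivity),
                ENNReal.ofReal_rpow_of_nonneg (by positivity) hq0,
                ← ENNReal.ofReal_mul (by positivity), ← ENNReal.ofReal_mul (by positivity),
                ← ENNReal.ofReal_mul (by positivity)]
              apply ENNReal.ofReal_le_ofReal
              rw [norm_smul, Real.norm_of_nonneg ht0.le,
                Real.mul_rpow (norm_nonneg _) (norm_nonneg _)]
              have h := weight_le α β γ q ‖x‖ t hα hβ hr ht1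
              have h' := mul_le_mul_of_nonneg_left h
                (by positivity : 0 ≤ ‖fderiv ℝ φ (t • x)‖ ^ q * t ^ (a * q))
              rw [sub_eq_add_neg, Real.rpow_add ht0]
              linarith
          _ = _ := by
              have hHt : Measurable (fun x : EuclideanSpace ℝ (Fin N) => H (t • x)) :=
                hH.comp (measurable_const_smul t)
              rw [lintegral_const_mul _ hHt, dil_s11 H hH t ht0, ← mul_assoc,
                ← ENNReal.ofReal_mul (by positivity), ← Real.rpow_add ht0, ← sub_eq_add_neg]
    _ = _ := by rw [lintegral_mul_const _ (by fun_prop)]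

/-- Hardy-type inequality on `ℝ^N` with weights `|x|^γ(1+|x|^β)^α` and
`|x|^{γ+q}(1+|x|^β)^α`. -/
theorem hardy_example
    (N : ℕ) (q α β γ : ℝ) (hq : 1 < q)
    (hα : α < 0) (hβ : 0 < β)
    (h1 : 0 < γ + N) (h2 : |γ + 2| ≤ |α * β + γ + 2|)
    (h3 : Real.sign (α * β + γ + 2) = Real.sign (γ + 2))
    (h4 : 0 < α * β + γ + N) :
    ∃ CH : ℝ, 0 < CH ∧
      ∀ φ : EuclideanSpace ℝ (Fin N) → ℝ,
        (∃ L, LipschitzWith L φ) → HasCompactSupport φ →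
        ∫ x, |φ x| ^ q * (‖x‖ ^ γ * (1 + ‖x‖ ^ β) ^ α) ≤
          CH * ∫ x, ‖fderiv ℝ φ x‖ ^ q * (‖x‖ ^ (γ + q) * (1 + ‖x‖ ^ β) ^ α) := by
  rcases Nat.eq_zero_or_pos N with rfl | hN
  · refine ⟨1, one_pos, fun φ _ _ => ?_⟩
    have hγ : γ ≠ 0 := by
      rintro rfl
      simp at h1
    have e : (fun x : EuclideanSpace ℝ (Fin 0) => |φ x| ^ q * (‖x‖ ^ γ * (1 + ‖x‖ ^ β) ^ α)) =
        fun _ => 0 := by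
      funext x
      rw [Subsingleton.elim x 0, norm_zero, Real.zero_rpow hγ]
      simp
    rw [e, integral_zero, one_mul]
    exact integral_nonneg fun x => by positivity
  · set c := α * β + γ + N with hc
    set a := (q - 1 + c / 2) / q with ha
    have hq1 : 0 < q - 1 := by linarith
    have haq : a * q = q - 1 + c / 2 := by rw [ha]; field_simp
    have hA := pow_fin (-a * q.conjExponent) (by
      have : -a * q.conjExponent = -1 - c / (2 * (q - 1)) := by
        rw [ha, Real.conjExponent]; field_simp
        ring
      rw [this]
      have : 0 < c / (2 * (q - 1)) := by positivity
      linarith)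
    have hB := pow_fin (a * q - (q + γ + α * β) - N) (by rw [haq]; linarith)
    set A := ∫⁻ t in Set.Ioi (1:ℝ), ENNReal.ofReal (t ^ (-a * q.conjExponent))
    set B := ∫⁻ t in Set.Ioi (1:ℝ), ENNReal.ofReal (t ^ (a * q - (q + γ + α * β) - N))
    refine ⟨(A ^ (q - 1) * B).toReal + 1, by positivity, ?_⟩
    rintro φ ⟨L, hL⟩ hcs
    have hint := integ hN q α β γ hq hα hβ h1 φ L hL hcs
    have hm := main_lint hN q α β γ hq hα hβ a φ L hL hcs
    rw [← mul_assoc] at hm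
    have hnn : 0 ≤ ∫ x, ‖fderiv ℝ φ x‖ ^ q * (‖x‖ ^ (γ + q) * (1 + ‖x‖ ^ β) ^ α) :=
      integral_nonneg fun x => by positivity
    have hφ : Continuous φ := hL.continuous
    rw [integral_eq_lintegral_of_nonneg_ae (Filter.Eventually.of_forall fun x => by positivity)
      (by
        have := hφ.measurable
        exact (by fun_prop : Measurable _).aestronglyMeasurable)]
    rw [← ofReal_integral_eq_lintegral_ofReal hint
      (Filter.Eventually.of_forall fun x => by positivity)] at hm
    have hfin : A ^ (q - 1) * B ≠ ⊤ :=
      ENNReal.mul_ne_top (ENNReal.rpow_ne_top_of_nonneg hq1.le hA.ne) hB.ne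
    have h5 := ENNReal.toReal_mono (ENNReal.mul_ne_top hfin ENNReal.ofReal_ne_top) hm
    rw [ENNReal.toReal_mul, ENNReal.toReal_ofReal hnn] at h5
    linarith
end

section
/- Let q > 1, α < 0 < β, γ ∈ ℝ with γ + N > 0, |αβ+γ+2| ≥ |γ+2|, sgn(αβ+γ+2) = sgn(γ+2), αβ+γ+N > 0, and additionally αβ + 2(γ+1) + N ≤ 0. Then the optimal constant in the inequality ∫_{ℝ^N} |φ|^q |x|^γ(1+|x|^β)^α dx ≤ C_H ∫_{ℝ^N} |∇φ|^q |x|^{γ+q}(1+|x|^β)^α dx (over all compactly supported φ ∈ W^{1,∞}(ℝ^N)) equals C_H = (q/(αβ+γ+N))^q. -/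
open MeasureTheory

lemma hx_lint_pow (u : ℝ) (hu : 0 < u) :
    ∫⁻ t in Set.Ioi (1:ℝ), ENNReal.ofReal (t ^ (-(u+1))) = ENNReal.ofReal (1 / u) := by
  rw [← ofReal_integral_eq_lintegral_ofReal]
  · rw [integral_Ioi_rpow_of_lt (by linarith) zero_lt_one]
    congr 1
    rw [Real.one_rpow]
    have : -(u+1)+1 = -u := by ring
    rw [this, neg_div_neg_eq]
  · exact integrableOn_Ioi_rpow_of_lt (by linarith) zero_lt_one
  · filter_upwards [ae_restrict_mem measurableSet_Ioi] with t ht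
    exact Real.rpow_nonneg (by linarith [Set.mem_Ioi.1 ht]) _

lemma hx_holder (q u : ℝ) (hq : 1 < q) (hu : 0 < u) (f : ℝ → ENNReal) (hf : Measurable f) :
    (∫⁻ t in Set.Ioi (1:ℝ), f t) ^ q ≤ ENNReal.ofReal (1/u) ^ (q-1) *
      ∫⁻ t in Set.Ioi (1:ℝ), ENNReal.ofReal (t ^ ((u+1)*(q-1))) * f t ^ q := by
  have hq0 : 0 < q := by linarith
  have hconj : (Real.conjExponent q).HolderConjugate q := (Real.HolderConjugate.conjExponent hq).symm
  have hp : Real.conjExponent q = q / (q-1) := rfl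
  have hq1 : q - 1 ≠ 0 := by linarith
  set s : ℝ := (u+1)*(q-1)/q with hs
  have key := ENNReal.lintegral_mul_le_Lp_mul_Lq (volume.restrict (Set.Ioi (1:ℝ))) hconj
    (f := fun t => ENNReal.ofReal (t ^ (-s))) (g := fun t => ENNReal.ofReal (t ^ s) * f t)
    (by fun_prop) (by fun_prop)
  have e1 : ∫⁻ t in Set.Ioi (1:ℝ), f t = ∫⁻ t in Set.Ioi (1:ℝ),
      ((fun t => ENNReal.ofReal (t ^ (-s))) * (fun t => ENNReal.ofReal (t ^ s) * f t)) t := by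
    apply setLIntegral_congr_fun measurableSet_Ioi
    intro t ht
    have ht0 : (0:ℝ) < t := by linarith [Set.mem_Ioi.1 ht]
    simp only [Pi.mul_apply]
    rw [← mul_assoc, ← ENNReal.ofReal_mul (by positivity), ← Real.rpow_add ht0]
    simp
  have e2 : ∫⁻ t in Set.Ioi (1:ℝ), (ENNReal.ofReal (t ^ (-s))) ^ (Real.conjExponent q)
      = ENNReal.ofReal (1/u) := by
    rw [← hx_lint_pow u hu]
    apply setLIntegral_congr_fun measurableSet_Ioi
    intro t ht
    have ht0 : (0:ℝ) < t := by linarith [Set.mem_Ioi.1 ht]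
    simp only
    rw [ENNReal.ofReal_rpow_of_pos (by positivity), ← Real.rpow_mul ht0.le]
    congr 2
    rw [hp, hs]; field_simp
  have e3 : ∫⁻ t in Set.Ioi (1:ℝ), (ENNReal.ofReal (t ^ s) * f t) ^ q
      = ∫⁻ t in Set.Ioi (1:ℝ), ENNReal.ofReal (t ^ ((u+1)*(q-1))) * f t ^ q := by
    apply setLIntegral_congr_fun measurableSet_Ioi
    intro t ht
    have ht0 : (0:ℝ) < t := by linarith [Set.mem_Ioi.1 ht]
    simp only
    rw [ENNReal.mul_rpow_of_nonneg _ _ hq0.le, ENNReal.ofReal_rpow_of_pos (by positivity),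
      ← Real.rpow_mul ht0.le]
    congr 3
    rw [hs]; field_simp
  rw [← e1, e2, e3] at key
  calc _ ≤ _ := ENNReal.rpow_le_rpow key hq0.le
    _ = _ := by
      rw [ENNReal.mul_rpow_of_nonneg _ _ hq0.le, ← ENNReal.rpow_mul, ← ENNReal.rpow_mul, hp]
      congr 1
      · congr 1; field_simp
      · rw [one_div, inv_mul_cancel₀ hq0.ne', ENNReal.rpow_one]

lemma hx_ftc {N : ℕ} (φ : EuclideanSpace ℝ (Fin N) → ℝ) (L : NNReal) (hL : LipschitzWith L φ)
    (hc : HasCompactSupport φ) (x : EuclideanSpace ℝ (Fin N)) (hx : x ≠ 0)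
    (hd : ∀ᵐ t ∂(volume.restrict (Set.Ioi (1:ℝ))), DifferentiableAt ℝ φ (t • x)) :
    ENNReal.ofReal |φ x| ≤
      ∫⁻ t in Set.Ioi (1:ℝ), ENNReal.ofReal (‖fderiv ℝ φ (t • x)‖ * ‖x‖) := by
  obtain ⟨R, hR⟩ := hc.isBounded.exists_norm_le
  have hxn : 0 < ‖x‖ := norm_pos_iff.2 hx
  obtain ⟨T, hT1, hT⟩ : ∃ T : ℝ, 1 < T ∧ R < T * ‖x‖ := by
    refine ⟨max 2 ((|R|+1) / ‖x‖), lt_of_lt_of_le (by norm_num) (le_max_left _ _), ?_⟩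
    calc R < |R| + 1 := by linarith [le_abs_self R]
      _ = (|R|+1) / ‖x‖ * ‖x‖ := by field_simp
      _ ≤ _ := by gcongr; exact le_max_right _ _
  have hT0 : φ (T • x) = 0 := by
    by_contra h
    have := hR _ (subset_tsupport φ h)
    rw [norm_smul, Real.norm_of_nonneg (by linarith)] at this
    linarith
  have hlip : LipschitzWith (L * ‖x‖₊) (fun t : ℝ => φ (t • x)) := by
    refine hL.comp (LipschitzWith.of_dist_le_mul fun a b => ?_)
    rw [dist_eq_norm, ← sub_smul, norm_smul, dist_eq_norm, mul_comm]; simp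
  have h := (hlip.lipschitzOnWith (s := Set.uIcc 1 T)).absolutelyContinuousOnInterval.integral_deriv_eq_sub
  simp only [hT0, one_smul, zero_sub] at h
  have h2 : |φ x| = ‖∫ t in Set.Ioc 1 T, deriv (fun t : ℝ => φ (t • x)) t‖ := by
    rw [← intervalIntegral.integral_of_le hT1.le, h]; simp
  rw [h2, ofReal_norm]
  calc _ ≤ ∫⁻ t in Set.Ioc 1 T, ‖deriv (fun t : ℝ => φ (t • x)) t‖ₑ :=
        enorm_integral_le_lintegral_enorm _
    _ ≤ ∫⁻ t in Set.Ioi 1, ‖deriv (fun t : ℝ => φ (t • x)) t‖ₑ :=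
        lintegral_mono_set Set.Ioc_subset_Ioi_self
    _ ≤ _ := by
      apply lintegral_mono_ae
      filter_upwards [hd] with t ht
      have hg : HasDerivAt (fun t : ℝ => t • x) x t := by
        simpa using (hasDerivAt_id t).smul_const x
      have := (ht.hasFDerivAt.comp_hasDerivAt t hg).deriv
      rw [← ofReal_norm]
      apply ENNReal.ofReal_le_ofReal
      have h3 : deriv (fun t : ℝ => φ (t • x)) t = (fderiv ℝ φ (t • x)) x := this
      rw [h3]
      exact ContinuousLinearMap.le_opNorm _ _

lemma hx_ae {N : ℕ} (φ : EuclideanSpace ℝ (Fin N) → ℝ) (L : NNReal) (hL : LipschitzWith L φ) :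
    ∀ᵐ x : EuclideanSpace ℝ (Fin N), ∀ᵐ t ∂(volume.restrict (Set.Ioi (1:ℝ))),
      DifferentiableAt ℝ φ (t • x) := by
  have hms : MeasurableSet {p : ℝ × EuclideanSpace ℝ (Fin N) | DifferentiableAt ℝ φ (p.1 • p.2)} :=
    (measurableSet_of_differentiableAt ℝ φ).preimage (by fun_prop)
  have : ∀ᵐ t ∂(volume.restrict (Set.Ioi (1:ℝ))), ∀ᵐ x : EuclideanSpace ℝ (Fin N),
      DifferentiableAt ℝ φ (t • x) := by
    filter_upwards [ae_restrict_mem measurableSet_Ioi] with t ht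
    have ht0 : t ≠ 0 := by have := Set.mem_Ioi.1 ht; positivity
    exact (Measure.quasiMeasurePreserving_smul volume ht0).ae (hL.ae_differentiableAt (μ := volume))
  exact (Measure.ae_ae_comm hms).1 this

lemma hx_pt (q α β γ r t D : ℝ) (hq : 1 < q) (hα : α < 0) (hβ : 0 < β) (hr : 0 ≤ r) (ht : 1 < t)
    (hD : 0 ≤ D) :
    (D * r) ^ q * (r ^ γ * (1 + r ^ β) ^ α) ≤
      t ^ (-q - γ - α * β) * (D ^ q * ((t * r) ^ (γ + q) * (1 + (t * r) ^ β) ^ α)) := by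
  have ht0 : 0 < t := by linarith
  rcases hr.eq_or_lt with rfl | hr
  · rw [mul_zero, Real.zero_rpow (by linarith), zero_mul]; positivity
  have h1 : (t ^ β * (1 + r ^ β)) ^ α ≤ (1 + (t * r) ^ β) ^ α := by
    apply Real.rpow_le_rpow_of_nonpos (by positivity) _ hα.le
    rw [Real.mul_rpow ht0.le hr.le]
    have := Real.one_le_rpow ht.le hβ.le
    nlinarith [Real.rpow_pos_of_pos hr β]
  have h2 : (t ^ β * (1 + r ^ β)) ^ α = t ^ (α * β) * (1 + r ^ β) ^ α := by
    rw [Real.mul_rpow (by positivity) (by positivity), ← Real.rpow_mul ht0.le, mul_comm β]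
  rw [h2] at h1
  calc _ = t ^ (-q - γ - α * β) * (D ^ q * ((t * r) ^ (γ + q) * (t ^ (α * β) * (1 + r ^ β) ^ α))) := by
        rw [Real.mul_rpow hD hr.le, Real.mul_rpow ht0.le hr.le, Real.rpow_add hr]
        have : t ^ (-q - γ - α * β) * (t ^ (γ+q) * t ^ (α * β)) = 1 := by
          rw [← Real.rpow_add ht0, ← Real.rpow_add ht0]
          ring_nf; simp
        linear_combination (-(D^q * r^q * r^γ * (1+r^β)^α)) * this
    _ ≤ _ := by gcongr

lemma hx_scale {N : ℕ} (F : EuclideanSpace ℝ (Fin N) → ENNReal) (hF : Measurable F) (t : ℝ) (ht : 0 < t) :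
    ∫⁻ x, F (t • x) = ENNReal.ofReal (t ^ (-(N:ℝ))) * ∫⁻ x, F x := by
  have := lintegral_map (μ := volume) hF (measurable_const_smul t (α := EuclideanSpace ℝ (Fin N)))
  rw [← this]
  have h := Measure.map_addHaar_smul (volume : Measure (EuclideanSpace ℝ (Fin N))) ht.ne'
  rw [h, lintegral_smul_measure]
  simp only [finrank_euclideanSpace, Fintype.card_fin, smul_eq_mul]
  rw [abs_of_pos (by positivity), Real.rpow_neg ht.le, Real.rpow_natCast]

lemma hx_main {N : ℕ} (q α β γ : ℝ) (hq : 1 < q)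
    (hα : α < 0) (hβ : 0 < β) (h4 : 0 < α * β + γ + N) (hN : 1 ≤ N)
    (φ : EuclideanSpace ℝ (Fin N) → ℝ) (L : NNReal) (hL : LipschitzWith L φ)
    (hc : HasCompactSupport φ) :
    ∫⁻ x, ENNReal.ofReal (|φ x| ^ q * (‖x‖ ^ γ * (1 + ‖x‖ ^ β) ^ α)) ≤
      ENNReal.ofReal ((q / (α * β + γ + N)) ^ q) *
      ∫⁻ x, ENNReal.ofReal (‖fderiv ℝ φ x‖ ^ q * (‖x‖ ^ (γ + q) * (1 + ‖x‖ ^ β) ^ α)) := by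
  have : Nonempty (Fin N) := ⟨⟨0, hN⟩⟩
  set a := α * β + γ + N with ha
  have hq0 : 0 < q := by linarith
  set u := a / q with hu
  have hu0 : 0 < u := by positivity
  have hmD : Measurable (fderiv ℝ φ) := measurable_fderiv ℝ φ
  set F : EuclideanSpace ℝ (Fin N) → ENNReal := fun x =>
    ENNReal.ofReal (‖fderiv ℝ φ x‖ ^ q * (‖x‖ ^ (γ + q) * (1 + ‖x‖ ^ β) ^ α)) with hF
  have hFm : Measurable F := by fun_prop
  set K := ENNReal.ofReal (1/u) ^ (q-1) with hK
  set H : EuclideanSpace ℝ (Fin N) → ℝ → ENNReal := fun x t =>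
    ENNReal.ofReal (t ^ ((u+1)*(q-1))) * (ENNReal.ofReal (t ^ (-q - γ - α * β)) * F (t • x)) with hH
  have hHm : Measurable (Function.uncurry H) := by
    simp only [hH, Function.uncurry_def]
    have : Measurable (fun p : EuclideanSpace ℝ (Fin N) × ℝ => F (p.2 • p.1)) :=
      hFm.comp (by fun_prop)
    fun_prop
  have step1 : ∀ᵐ x : EuclideanSpace ℝ (Fin N),
      ENNReal.ofReal (|φ x| ^ q * (‖x‖ ^ γ * (1 + ‖x‖ ^ β) ^ α)) ≤
        K * ∫⁻ t in Set.Ioi (1:ℝ), H x t := by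
    filter_upwards [hx_ae φ L hL, Measure.ae_ne volume (0 : EuclideanSpace ℝ (Fin N))] with x hx hx0
    have f1 := hx_ftc φ L hL hc x hx0 hx
    have hcm : Measurable (fun t : ℝ => fderiv ℝ φ (t • x)) := hmD.comp (by fun_prop)
    have f2 := hx_holder q u hq hu0 (fun t => ENNReal.ofReal (‖fderiv ℝ φ (t • x)‖ * ‖x‖))
      (by fun_prop)
    rw [ENNReal.ofReal_mul (by positivity), ← ENNReal.ofReal_rpow_of_nonneg (abs_nonneg _) hq0.le]
    calc _ ≤ (K * ∫⁻ t in Set.Ioi (1:ℝ), ENNReal.ofReal (t ^ ((u+1)*(q-1))) *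
              ENNReal.ofReal (‖fderiv ℝ φ (t • x)‖ * ‖x‖) ^ q)
            * ENNReal.ofReal (‖x‖ ^ γ * (1 + ‖x‖ ^ β) ^ α) := by
          gcongr
          exact (ENNReal.rpow_le_rpow f1 hq0.le).trans f2
      _ = K * ∫⁻ t in Set.Ioi (1:ℝ), (ENNReal.ofReal (t ^ ((u+1)*(q-1))) *
              ENNReal.ofReal (‖fderiv ℝ φ (t • x)‖ * ‖x‖) ^ q)
            * ENNReal.ofReal (‖x‖ ^ γ * (1 + ‖x‖ ^ β) ^ α) := by
          rw [lintegral_mul_const _ (by fun_prop), mul_assoc]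
      _ ≤ _ := by
          gcongr K * ?_
          apply setLIntegral_mono' measurableSet_Ioi
          intro t ht
          have ht1 : 1 < t := ht
          have ht0 : 0 < t := by linarith
          rw [hH]
          simp only
          rw [mul_assoc]
          gcongr ENNReal.ofReal (t ^ ((u+1)*(q-1))) * ?_
          rw [ENNReal.ofReal_rpow_of_nonneg (by positivity) hq0.le,
            ← ENNReal.ofReal_mul (by positivity), hF]
          simp only
          rw [← ENNReal.ofReal_mul (by positivity)]
          apply ENNReal.ofReal_le_ofReal
          have := hx_pt q α β γ ‖x‖ t ‖fderiv ℝ φ (t • x)‖ hq hα hβ (norm_nonneg _) ht1 (norm_nonneg _)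
          rwa [norm_smul, Real.norm_of_nonneg ht0.le]
  calc _ ≤ ∫⁻ x, K * ∫⁻ t in Set.Ioi (1:ℝ), H x t := lintegral_mono_ae step1
    _ = K * ∫⁻ x, ∫⁻ t in Set.Ioi (1:ℝ), H x t :=
        lintegral_const_mul _ hHm.lintegral_prod_right
    _ = K * ∫⁻ t in Set.Ioi (1:ℝ), ∫⁻ x, H x t := by
        rw [lintegral_lintegral_swap hHm.aemeasurable]
    _ = K * ∫⁻ t in Set.Ioi (1:ℝ), ENNReal.ofReal (t ^ (-(u+1))) * ∫⁻ x, F x := by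
        congr 1
        apply setLIntegral_congr_fun measurableSet_Ioi
        intro t ht
        have ht1 : 1 < t := ht
        have ht0 : 0 < t := by linarith
        have hm : Measurable (fun x : EuclideanSpace ℝ (Fin N) => F (t • x)) :=
          hFm.comp (by fun_prop)
        simp only [hH]
        rw [lintegral_const_mul _ (by fun_prop), lintegral_const_mul _ hm, hx_scale F hFm t ht0,
          ← mul_assoc, ← mul_assoc, ← ENNReal.ofReal_mul (by positivity),
          ← ENNReal.ofReal_mul (by positivity), ← Real.rpow_add ht0, ← Real.rpow_add ht0]
        congr 3
        have : u * q = a := by rw [hu]; field_simp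
        linear_combination this + ha
    _ = K * (ENNReal.ofReal (1/u) * ∫⁻ x, F x) := by
        rw [lintegral_mul_const _ (by fun_prop), hx_lint_pow u hu0]
    _ = _ := by
        rw [← mul_assoc, hK]
        congr 1
        rw [ENNReal.ofReal_rpow_of_pos (by positivity), ← ENNReal.ofReal_mul (by positivity)]
        congr 1
        have : q / a = 1 / u := by rw [hu]; field_simp
        rw [this, Real.rpow_sub_one (by positivity)]
        field_simp

lemma hx_int {N : ℕ} (α β p : ℝ) (hα : α < 0) (hN : 1 ≤ N) (hp : 0 < p + N)
    (f : EuclideanSpace ℝ (Fin N) → ℝ) (hf : Measurable f) (M R : ℝ) (hM : ∀ x, |f x| ≤ M)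
    (hR : ∀ x, R ≤ ‖x‖ → f x = 0) :
    Integrable (fun x => f x * (‖x‖ ^ p * (1 + ‖x‖ ^ β) ^ α)) := by
  have hs : Function.support (fun x => f x * (‖x‖ ^ p * (1 + ‖x‖ ^ β) ^ α)) ⊆ Metric.ball 0 R := by
    intro x hx
    by_contra h
    apply hx
    simp only
    rw [hR x (by simpa using h), zero_mul]
  rw [← integrableOn_iff_integrable_of_support_subset hs]
  refine integrableOn_ball_of_norm_le_rpow (C := M) (α := -p) ?_ ?_ ?_ ?_
  · simpa using hN
  · simp only [finrank_euclideanSpace, Fintype.card_fin]; linarith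
  · refine Filter.Eventually.of_forall fun x => ?_
    have h1 : (1 + ‖x‖ ^ β) ^ α ≤ 1 := by
      apply Real.rpow_le_one_of_one_le_of_nonpos _ hα.le
      have : 0 ≤ ‖x‖ ^ β := by positivity
      linarith
    have hM0 : 0 ≤ M := (abs_nonneg _).trans (hM 0)
    have h0 : 0 ≤ (1 + ‖x‖ ^ β) ^ α := by positivity
    rw [norm_mul, Real.norm_eq_abs, neg_neg, Real.norm_of_nonneg (by positivity)]
    calc _ ≤ M * (‖x‖ ^ p * 1) := by gcongr; exact hM x
      _ = _ := by ring
  · exact Measurable.aestronglyMeasurable (by fun_prop)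

lemma hx_upper {N : ℕ} (q α β γ : ℝ) (hq : 1 < q)
    (hα : α < 0) (hβ : 0 < β) (h1 : 0 < γ + N) (h4 : 0 < α * β + γ + N) (hN : 1 ≤ N)
    (φ : EuclideanSpace ℝ (Fin N) → ℝ) (L : NNReal) (hL : LipschitzWith L φ)
    (hc : HasCompactSupport φ) :
    ∫ x, |φ x| ^ q * (‖x‖ ^ γ * (1 + ‖x‖ ^ β) ^ α) ≤
          (q / (α * β + γ + N)) ^ q *
            ∫ x, ‖fderiv ℝ φ x‖ ^ q * (‖x‖ ^ (γ + q) * (1 + ‖x‖ ^ β) ^ α) := by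
  have hq0 : 0 < q := by linarith
  have hmD : Measurable (fderiv ℝ φ) := measurable_fderiv ℝ φ
  have hmφ : Measurable φ := hL.continuous.measurable
  obtain ⟨R, hR⟩ := hc.isBounded.exists_norm_le
  have hint : Integrable (fun x => ‖fderiv ℝ φ x‖ ^ q * (‖x‖ ^ (γ + q) * (1 + ‖x‖ ^ β) ^ α)) := by
    refine hx_int α β (γ+q) hα hN (by linarith) (fun x => ‖fderiv ℝ φ x‖ ^ q) (by fun_prop)
      ((L:ℝ)^q) (R+1) (fun x => ?_) (fun x hx => ?_)
    · rw [abs_of_nonneg (by positivity)]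
      have := norm_fderiv_le_of_lipschitz ℝ hL (x₀ := x)
      gcongr
    · have : fderiv ℝ φ x = 0 := by
        by_contra h
        have := hR x (support_fderiv_subset ℝ h)
        linarith
      rw [this, norm_zero, Real.zero_rpow hq0.ne']
  rw [integral_eq_lintegral_of_nonneg_ae (Filter.Eventually.of_forall fun x => by positivity)
      (Measurable.aestronglyMeasurable (by fun_prop)),
    integral_eq_lintegral_of_nonneg_ae (Filter.Eventually.of_forall fun x => by positivity)
      hint.aestronglyMeasurable]
  have hfin := (hasFiniteIntegral_iff_ofReal (Filter.Eventually.of_forall fun x => by positivity)).1 hint.2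
  have hm := ENNReal.toReal_mono (ENNReal.mul_ne_top ENNReal.ofReal_ne_top hfin.ne)
    (hx_main q α β γ hq hα hβ h4 hN φ L hL hc)
  rwa [ENNReal.toReal_mul, ENNReal.toReal_ofReal (by positivity)] at hm

noncomputable def hxφ (N : ℕ) (b T : ℝ) (x : EuclideanSpace ℝ (Fin N)) : ℝ :=
  max ((max ‖x‖ 1) ^ (-b) - T ^ (-b)) 0

lemma hxφ_lip (N : ℕ) (b T : ℝ) (hb : 0 < b) : ∃ L, LipschitzWith L (hxφ N b T) := by
  have h1 : LipschitzOnWith b.toNNReal (fun r : ℝ => r ^ (-b)) (Set.Ici 1) := by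
    apply (convex_Ici 1).lipschitzOnWith_of_nnnorm_hasDerivWithin_le
      (f' := fun r => -b * r ^ (-b - 1))
    · intro r hr
      have : (1:ℝ) ≤ r := hr
      exact (Real.hasDerivAt_rpow_const (Or.inl (by positivity))).hasDerivWithinAt
    · intro r hr
      have hr : (1:ℝ) ≤ r := hr
      rw [← NNReal.coe_le_coe, coe_nnnorm, Real.coe_toNNReal b hb.le, norm_mul, norm_neg, Real.norm_of_nonneg hb.le,
        Real.norm_of_nonneg (by positivity)]
      have := Real.rpow_le_one_of_one_le_of_nonpos hr (show -b - 1 ≤ 0 by linarith)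
      nlinarith
  have h2 : LipschitzWith 1 (fun x : EuclideanSpace ℝ (Fin N) => max ‖x‖ 1) :=
    lipschitzWith_one_norm.max_const 1
  have h3 := h1.comp (h2.lipschitzOnWith (s := Set.univ)) (fun x _ => Set.mem_Ici.2 (le_max_right _ _))
  rw [lipschitzOnWith_univ] at h3
  exact ⟨_, (h3.sub (LipschitzWith.const (T ^ (-b)))).max_const 0⟩

lemma hxφ_zero (N : ℕ) (b T : ℝ) (hb : 0 < b) (hT : 1 < T) (x : EuclideanSpace ℝ (Fin N))
    (hx : T ≤ ‖x‖) : hxφ N b T x = 0 := by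
  unfold hxφ
  rw [max_eq_left (by linarith : (1:ℝ) ≤ ‖x‖)]
  apply max_eq_right
  have := Real.rpow_le_rpow_of_nonpos (by linarith) hx (show -b ≤ 0 by linarith)
  linarith

lemma hxφ_nonneg (N : ℕ) (b T : ℝ) (x : EuclideanSpace ℝ (Fin N)) : 0 ≤ hxφ N b T x :=
  le_max_right _ _

lemma hxφ_le (N : ℕ) (b T : ℝ) (hT : 1 < T) (x : EuclideanSpace ℝ (Fin N)) :
    hxφ N b T x ≤ (max ‖x‖ 1) ^ (-b) := by
  unfold hxφ
  have : 0 ≤ T ^ (-b) := by positivity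
  apply max_le
  · linarith
  · positivity

lemma hxφ_compact (N : ℕ) (b T : ℝ) (hb : 0 < b) (hT : 1 < T) : HasCompactSupport (hxφ N b T) := by
  apply HasCompactSupport.intro (isCompact_closedBall (0 : EuclideanSpace ℝ (Fin N)) T)
  intro x hx
  apply hxφ_zero N b T hb hT
  simp at hx
  exact hx.le

lemma hxφ_fderiv (N : ℕ) (b T : ℝ) (hb : 0 < b) (hT : 1 < T) (x : EuclideanSpace ℝ (Fin N))
    (h1 : ‖x‖ ≠ 1) (h2 : ‖x‖ ≠ T) :
    ‖fderiv ℝ (hxφ N b T) x‖ ≤ if 1 < ‖x‖ then b * ‖x‖ ^ (-b - 1) else 0 := by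
  have hcn : Continuous (fun y : EuclideanSpace ℝ (Fin N) => ‖y‖) := continuous_norm
  split_ifs with h
  · rcases lt_or_gt_of_ne h2 with h2 | h2
    · have he : hxφ N b T =ᶠ[nhds x] fun y => ‖y‖ ^ (-b) - T ^ (-b) := by
        filter_upwards [hcn.continuousAt.eventually (lt_mem_nhds h),
          hcn.continuousAt.eventually (gt_mem_nhds h2)] with y hy1 hy2
        unfold hxφ
        rw [max_eq_left hy1.le, max_eq_left]
        have := Real.rpow_le_rpow_of_nonpos (by linarith) hy2.le (show -b ≤ 0 by linarith)
        linarith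
      rw [he.fderiv_eq]
      have hx0 : x ≠ 0 := by rintro rfl; simp at h; linarith
      have hd : DifferentiableAt ℝ (fun y : EuclideanSpace ℝ (Fin N) => ‖y‖) x :=
        (contDiffAt_norm ℝ hx0 (n := 1)).differentiableAt (by simp)
      have hd2 := (Real.hasDerivAt_rpow_const (x := ‖x‖) (p := -b) (Or.inl (by linarith))).comp_hasFDerivAt x hd.hasFDerivAt
      have hd3 := (hd2.sub_const (T ^ (-b))).fderiv
      have e : (fun y : EuclideanSpace ℝ (Fin N) => ‖y‖ ^ (-b) - T ^ (-b)) =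
        fun y => ((fun r : ℝ => r ^ (-b)) ∘ fun y : EuclideanSpace ℝ (Fin N) => ‖y‖) y - T ^ (-b) := rfl
      rw [e, hd3, norm_smul, norm_mul, norm_neg, Real.norm_of_nonneg hb.le,
        Real.norm_of_nonneg (by positivity)]
      have := norm_fderiv_le_of_lipschitz ℝ (lipschitzWith_one_norm (E := EuclideanSpace ℝ (Fin N))) (x₀ := x)
      simp only [NNReal.coe_one] at this
      have hpos : 0 ≤ b * ‖x‖ ^ (-b-1) := by positivity
      nlinarith
    · have he : hxφ N b T =ᶠ[nhds x] fun y => 0 := by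
        filter_upwards [hcn.continuousAt.eventually (lt_mem_nhds h2)] with y hy1
        exact hxφ_zero N b T hb hT y hy1.le
      rw [he.fderiv_eq]
      simp; positivity
  · have h : ‖x‖ < 1 := lt_of_le_of_ne (not_lt.1 h) h1
    have he : hxφ N b T =ᶠ[nhds x] fun y => hxφ N b T 0 := by
      filter_upwards [hcn.continuousAt.eventually (gt_mem_nhds h)] with y hy1
      unfold hxφ
      rw [max_eq_right hy1.le]; simp
    rw [he.fderiv_eq]
    simp

lemma hx_lower {N : ℕ} (q α β γ : ℝ) (hq : 1 < q)
    (hα : α < 0) (hβ : 0 < β) (h1 : 0 < γ + N) (h4 : 0 < α * β + γ + N) (hN : 1 ≤ N)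
    (C : ℝ) (hC0 : 0 ≤ C)
    (hC : ∀ φ : EuclideanSpace ℝ (Fin N) → ℝ,
        (∃ L, LipschitzWith L φ) → HasCompactSupport φ →
        ∫ x, |φ x| ^ q * (‖x‖ ^ γ * (1 + ‖x‖ ^ β) ^ α) ≤
          C * ∫ x, ‖fderiv ℝ φ x‖ ^ q * (‖x‖ ^ (γ + q) * (1 + ‖x‖ ^ β) ^ α))
    (b : ℝ) (hb : (α * β + γ + N) / q < b) : 1 ≤ C * b ^ q := by
  have : Nonempty (Fin N) := ⟨⟨0, hN⟩⟩
  have hq0 : 0 < q := by linarith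
  have hb0 : 0 < b := lt_trans (by positivity) hb
  have hbq : α * β + γ + N < b * q := by rwa [div_lt_iff₀ hq0] at hb
  set S : Set (EuclideanSpace ℝ (Fin N)) := {x | 1 < ‖x‖} with hS
  have hSo : IsOpen S := isOpen_lt continuous_const continuous_norm
  set J : EuclideanSpace ℝ (Fin N) → ℝ :=
    S.indicator (fun x => ‖x‖ ^ (-b*q) * (‖x‖ ^ γ * (1 + ‖x‖ ^ β) ^ α)) with hJ
  have hJm : Measurable J := Measurable.indicator (by fun_prop) hSo.measurableSet
  have hJ0 : ∀ x, 0 ≤ J x := fun x => Set.indicator_nonneg (fun x _ => by positivity) x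
  have hJint : Integrable J := by
    set p := b*q - γ - α*β with hp
    have hpN : (N:ℝ) < p := by linarith
    have hp0 : 0 < p := lt_of_le_of_lt (Nat.cast_nonneg _) hpN
    have hi : Integrable (fun x : EuclideanSpace ℝ (Fin N) => (1 + ‖x‖) ^ (-p)) :=
      integrable_one_add_norm (by simpa using hpN)
    refine (hi.const_mul (2 ^ p)).mono' hJm.aestronglyMeasurable (Filter.Eventually.of_forall fun x => ?_)
    rw [Real.norm_of_nonneg (hJ0 x)]
    by_cases hx : x ∈ S
    · rw [hJ, Set.indicator_of_mem hx]
      have hx1 : 1 < ‖x‖ := hx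
      have hx0 : 0 < ‖x‖ := by linarith
      calc _ ≤ ‖x‖ ^ (-b*q) * (‖x‖ ^ γ * (‖x‖ ^ β) ^ α) := by
            gcongr 1
            gcongr 1
            exact Real.rpow_le_rpow_of_nonpos (by positivity) (by linarith) hα.le
        _ = ‖x‖ ^ (-p) := by
            rw [← Real.rpow_mul hx0.le, ← Real.rpow_add hx0, ← Real.rpow_add hx0]
            congr 1; rw [hp]; ring
        _ = 2 ^ p * (2 * ‖x‖) ^ (-p) := by
            rw [Real.mul_rpow (by norm_num) hx0.le, ← mul_assoc, ← Real.rpow_add (by norm_num)]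
            simp
        _ ≤ _ := by
            gcongr 1
            exact Real.rpow_le_rpow_of_nonpos (by positivity) (by linarith) (by linarith)
    · rw [hJ, Set.indicator_of_notMem hx]; positivity
  have hI : 0 < ∫ x, J x := by
    rw [integral_pos_iff_support_of_nonneg hJ0 hJint]
    have : S ⊆ Function.support J := by
      intro x hx
      rw [Function.mem_support, hJ, Set.indicator_of_mem hx]
      have hx1 : 1 < ‖x‖ := hx
      positivity
    refine lt_of_lt_of_le (hSo.measure_pos volume ?_) (measure_mono this)
    obtain ⟨x, hx⟩ := NormedSpace.exists_lt_norm ℝ (EuclideanSpace ℝ (Fin N)) 1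
    exact ⟨x, hx⟩
  set g : ℕ → EuclideanSpace ℝ (Fin N) → ℝ := fun n =>
    S.indicator (fun x => |hxφ N b (n+2) x| ^ q * (‖x‖ ^ γ * (1 + ‖x‖ ^ β) ^ α)) with hg
  have hTn : ∀ n : ℕ, (1:ℝ) < n + 2 := fun n => by
    have : (0:ℝ) ≤ n := Nat.cast_nonneg _
    linarith
  have hmφ : ∀ n : ℕ, Measurable (hxφ N b (n+2)) := fun n => by
    obtain ⟨L, hL⟩ := hxφ_lip N b (n+2) hb0
    exact hL.continuous.measurable
  have hbound : ∀ n, ∫ x, g n x ≤ C * (b ^ q * ∫ x, J x) := by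
    intro n
    have hT := hTn n
    have i1 : Integrable (fun x => |hxφ N b (n+2) x| ^ q * (‖x‖ ^ γ * (1 + ‖x‖ ^ β) ^ α)) := by
      have := hmφ n
      refine hx_int α β γ hα hN h1 (fun x => |hxφ N b (n+2) x| ^ q) (by fun_prop) 1 (n+2)
        (fun x => ?_) (fun x hx => ?_)
      · rw [abs_of_nonneg (by positivity), abs_of_nonneg (hxφ_nonneg _ _ _ _)]
        apply Real.rpow_le_one (hxφ_nonneg _ _ _ _) _ hq0.le
        exact (hxφ_le N b _ hT x).trans
          (Real.rpow_le_one_of_one_le_of_nonpos (le_max_right _ _) (by linarith))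
      · rw [hxφ_zero N b _ hb0 hT x hx, abs_zero, Real.zero_rpow hq0.ne']
    calc ∫ x, g n x ≤ ∫ x, |hxφ N b (n+2) x| ^ q * (‖x‖ ^ γ * (1 + ‖x‖ ^ β) ^ α) := by
          apply integral_mono (i1.indicator hSo.measurableSet) i1
          intro x
          exact Set.indicator_le_self' (fun x _ => by positivity) x
      _ ≤ C * ∫ x, ‖fderiv ℝ (hxφ N b (n+2)) x‖ ^ q * (‖x‖ ^ (γ + q) * (1 + ‖x‖ ^ β) ^ α) :=
          hC _ (hxφ_lip N b _ hb0) (hxφ_compact N b _ hb0 hT)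
      _ ≤ C * ∫ x, b ^ q * J x := by
          gcongr 1
          apply integral_mono_of_nonneg (Filter.Eventually.of_forall fun x => by positivity)
            (hJint.const_mul _)
          have s1 : ∀ r : ℝ, r ≠ 0 → ∀ᵐ x : EuclideanSpace ℝ (Fin N), ‖x‖ ≠ r := by
            intro r hr
            have := Measure.addHaar_sphere_of_ne_zero (volume : Measure (EuclideanSpace ℝ (Fin N))) 0 hr
            filter_upwards [measure_eq_zero_iff_ae_notMem.1 this] with x hx h
            exact hx (by simpa using h)
          filter_upwards [s1 1 one_ne_zero, s1 (n+2) (by positivity)] with x hx1 hx2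
          have hd := hxφ_fderiv N b _ hb0 hT x hx1 hx2
          by_cases hx : 1 < ‖x‖
          · rw [if_pos hx] at hd
            have hx0 : 0 < ‖x‖ := by linarith
            rw [hJ, Set.indicator_of_mem (show x ∈ S from hx)]
            calc _ ≤ (b * ‖x‖ ^ (-b - 1)) ^ q * (‖x‖ ^ (γ + q) * (1 + ‖x‖ ^ β) ^ α) := by gcongr
              _ = _ := by
                have e1 : ‖x‖ ^ ((-b-1)*q) * ‖x‖ ^ (γ + q) = ‖x‖ ^ (-b*q) * ‖x‖ ^ γ := by
                  rw [← Real.rpow_add hx0, ← Real.rpow_add hx0]; congr 1; ring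
                rw [Real.mul_rpow hb0.le (by positivity), ← Real.rpow_mul hx0.le]
                linear_combination (b^q * (1 + ‖x‖ ^ β) ^ α) * e1
          · rw [if_neg hx] at hd
            have hd0 : ‖fderiv ℝ (hxφ N b (n+2)) x‖ = 0 := le_antisymm hd (norm_nonneg _)
            rw [hd0, Real.zero_rpow hq0.ne', zero_mul]
            exact mul_nonneg (by positivity) (hJ0 x)
      _ = _ := by rw [integral_const_mul]
  have hlim : Filter.Tendsto (fun n => ∫ x, g n x) Filter.atTop (nhds (∫ x, J x)) := by
    apply tendsto_integral_of_dominated_convergence J _ hJint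
    · intro n
      refine Filter.Eventually.of_forall fun x => ?_
      by_cases hx : x ∈ S
      · simp only [hg, hJ]
        rw [Set.indicator_of_mem hx, Set.indicator_of_mem hx, Real.norm_of_nonneg (by positivity)]
        gcongr
        have hx1 : 1 < ‖x‖ := hx
        have := hxφ_le N b _ (hTn n) x
        rw [max_eq_left hx1.le] at this
        rw [abs_of_nonneg (hxφ_nonneg _ _ _ _), Real.rpow_mul (norm_nonneg _)]
        exact Real.rpow_le_rpow (hxφ_nonneg _ _ _ _) this hq0.le
      · simp only [hg, hJ]
        rw [Set.indicator_of_notMem hx, Set.indicator_of_notMem hx]; simp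
    · refine Filter.Eventually.of_forall fun x => ?_
      by_cases hx : x ∈ S
      · simp only [hg, hJ, Set.indicator_of_mem hx]
        have hx1 : 1 < ‖x‖ := hx
        apply Filter.Tendsto.mul_const
        rw [Real.rpow_mul (norm_nonneg _)]
        apply Filter.Tendsto.rpow_const _ (Or.inr hq0.le)
        have t0 : Filter.Tendsto (fun n : ℕ => ((n:ℝ)+2) ^ (-b)) Filter.atTop (nhds 0) :=
          (tendsto_rpow_neg_atTop hb0).comp
            (Filter.tendsto_atTop_add_const_right _ _ tendsto_natCast_atTop_atTop)
        have t1 := ((t0.const_sub (‖x‖ ^ (-b))).max (tendsto_const_nhds (x := (0:ℝ)))).abs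
        rw [sub_zero, max_eq_left (by positivity), abs_of_nonneg (by positivity)] at t1
        simpa only [hxφ, max_eq_left hx1.le] using t1
      · simp only [hg, hJ, Set.indicator_of_notMem hx]
        exact tendsto_const_nhds
    · intro n
      have := hmφ n
      exact (Measurable.indicator (by fun_prop) hSo.measurableSet).aestronglyMeasurable
  have := le_of_tendsto' hlim hbound
  nlinarith



/-- Under the additional assumption `αβ + 2(γ+1) + N ≤ 0`, the optimal
constant in the Hardy inequality with weights `|x|^γ(1+|x|^β)^α` and
`|x|^{γ+q}(1+|x|^β)^α` equals `(q/(αβ+γ+N))^q`: the inequality holds with it,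
and any admissible constant is at least as large. -/
theorem hardy_example_optimal
    (N : ℕ) (q α β γ : ℝ) (hq : 1 < q)
    (hα : α < 0) (hβ : 0 < β)
    (h1 : 0 < γ + N) (h2 : |γ + 2| ≤ |α * β + γ + 2|)
    (h3 : Real.sign (α * β + γ + 2) = Real.sign (γ + 2))
    (h4 : 0 < α * β + γ + N)
    (h5 : α * β + 2 * (γ + 1) + N ≤ 0) :
    (∀ φ : EuclideanSpace ℝ (Fin N) → ℝ,
        (∃ L, LipschitzWith L φ) → HasCompactSupport φ →
        ∫ x, |φ x| ^ q * (‖x‖ ^ γ * (1 + ‖x‖ ^ β) ^ α) ≤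
          (q / (α * β + γ + N)) ^ q *
            ∫ x, ‖fderiv ℝ φ x‖ ^ q * (‖x‖ ^ (γ + q) * (1 + ‖x‖ ^ β) ^ α)) ∧
    (∀ C : ℝ,
      (∀ φ : EuclideanSpace ℝ (Fin N) → ℝ,
        (∃ L, LipschitzWith L φ) → HasCompactSupport φ →
        ∫ x, |φ x| ^ q * (‖x‖ ^ γ * (1 + ‖x‖ ^ β) ^ α) ≤
          C * ∫ x, ‖fderiv ℝ φ x‖ ^ q * (‖x‖ ^ (γ + q) * (1 + ‖x‖ ^ β) ^ α)) →
      (q / (α * β + γ + N)) ^ q ≤ C) := by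

  have hab : α * β < 0 := mul_neg_of_neg_of_pos hα hβ
  have hγ : γ + 2 < 0 := by
    by_contra h
    push Not at h
    rcases h.eq_or_lt with h | h
    · rw [← h, Real.sign_zero, Real.sign_eq_zero_iff] at h3
      linarith
    · rw [Real.sign_of_pos h] at h3
      have hp : 0 < α * β + γ + 2 := by
        by_contra hn
        push Not at hn
        rcases hn.eq_or_lt with hn | hn
        · rw [hn, Real.sign_zero] at h3; norm_num at h3
        · rw [Real.sign_of_neg hn] at h3; norm_num at h3
      rw [abs_of_pos h, abs_of_pos hp] at h2
      linarith
  have hN : 1 ≤ N := by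
    rcases Nat.eq_zero_or_pos N with h | h
    · subst h; norm_num at h1; linarith
    · exact h
  have hq0 : 0 < q := by linarith
  refine ⟨fun φ ⟨L, hL⟩ hc => hx_upper q α β γ hq hα hβ h1 h4 hN φ L hL hc, fun C hC => ?_⟩
  have hb : ∀ b : ℝ, (α * β + γ + N) / q < b → 1 ≤ max C 0 * b ^ q := by
    intro b hb
    refine hx_lower q α β γ hq hα hβ h1 h4 hN (max C 0) (le_max_right _ _) (fun φ hL hc => ?_) b hb
    refine (hC φ hL hc).trans ?_
    exact mul_le_mul_of_nonneg_right (le_max_left _ _) (integral_nonneg fun x => by positivity)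
  have hlim : Filter.Tendsto (fun b : ℝ => max C 0 * b ^ q)
      (nhdsWithin ((α * β + γ + N) / q) (Set.Ioi ((α * β + γ + N) / q)))
      (nhds (max C 0 * ((α * β + γ + N) / q) ^ q)) := by
    apply Filter.Tendsto.const_mul
    exact ((Real.continuous_rpow_const hq0.le).tendsto _).mono_left nhdsWithin_le_nhds
  have h := ge_of_tendsto hlim (Filter.eventually_of_mem self_mem_nhdsWithin hb)
  have hpos : 0 < ((α * β + γ + N) / q) ^ q := by positivity
  have hC0 : 0 < C := by
    by_contra hn
    rw [max_eq_right (not_lt.1 hn)] at h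
    norm_num at h
  rw [max_eq_left hC0.le] at h
  rw [← inv_div, Real.inv_rpow (by positivity)]
  exact (inv_le_iff_one_le_mul₀ hpos).2 h
end

section
/- Let 1 < p < 2, N > 2, and N > p/((2-p)(p-1)). Then there exists a finite constant C_H > 0 such that for all compactly supported φ ∈ W^{1,∞}(ℝ^N), ∫_{ℝ^N} |φ|² |x|^{-p/(p-1)} (1+|x|^{p/(p-1)})^{-(p-1)/(2-p)} dx ≤ C_H ∫_{ℝ^N} |∇φ|² |x|^{-(2-p)/(p-1)} (1+|x|^{p/(p-1)})^{-(p-1)/(2-p)} dx. -/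
open MeasureTheory

lemma aux_Ioi (c : ℝ) (hc : 0 < c) :
    ∫⁻ s in Set.Ioi (1:ℝ), ENNReal.ofReal (s ^ (-1 - c)) = ENNReal.ofReal (1 / c) := by
  rw [← ofReal_integral_eq_lintegral_ofReal]
  · rw [integral_Ioi_rpow_of_lt (by linarith) one_pos]
    congr 1
    rw [Real.one_rpow]
    have : -1 - c + 1 = -c := by ring
    rw [this]; field_simp
  · exact integrableOn_Ioi_rpow_of_lt (by linarith) one_pos
  · filter_upwards [ae_restrict_mem measurableSet_Ioi] with s hs
    have : (0:ℝ) < s := lt_trans one_pos hs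
    positivity

lemma aux_1d (u : ℝ → ℝ) (K : NNReal) (hu : LipschitzWith K u) (R : ℝ) (hR : 1 ≤ R)
    (huR : u R = 0) (ε : ℝ) (hε : 0 < ε) :
    ENNReal.ofReal (u 1 ^ 2) ≤ ENNReal.ofReal (1 / ε) *
      ∫⁻ s in Set.Ioi (1:ℝ), ENNReal.ofReal (s ^ (1 + ε) * deriv u s ^ 2) := by
  have h1 : ∫ s in (1:ℝ)..R, deriv u s = u R - u 1 :=
    (hu.lipschitzOnWith (s := Set.uIcc 1 R)).absolutelyContinuousOnInterval.integral_deriv_eq_sub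
  rw [huR, intervalIntegral.integral_of_le hR] at h1
  have h2 : ENNReal.ofReal |u 1| ≤ ∫⁻ s in Set.Ioi (1:ℝ), ENNReal.ofReal |deriv u s| := by
    have e : ENNReal.ofReal |u 1| = ‖∫ s in Set.Ioc 1 R, deriv u s‖ₑ := by
      rw [h1, zero_sub, enorm_neg, Real.enorm_eq_ofReal_abs]
    rw [e]
    refine (enorm_integral_le_lintegral_enorm _).trans ?_
    simp_rw [Real.enorm_eq_ofReal_abs]
    exact lintegral_mono_set Set.Ioc_subset_Ioi_self
  have hm : Measurable (deriv u) := measurable_deriv u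
  have h3 : ∫⁻ s in Set.Ioi (1:ℝ), ENNReal.ofReal |deriv u s| ≤
      (∫⁻ s in Set.Ioi (1:ℝ), ENNReal.ofReal (s ^ (-1 - ε))) ^ (1 / (2:ℝ)) *
      (∫⁻ s in Set.Ioi (1:ℝ), ENNReal.ofReal (s ^ (1 + ε) * deriv u s ^ 2)) ^ (1 / (2:ℝ)) := by
    have := ENNReal.lintegral_mul_le_Lp_mul_Lq (volume.restrict (Set.Ioi (1:ℝ)))
      Real.HolderConjugate.two_two
      (f := fun s => ENNReal.ofReal (s ^ ((-1 - ε) / 2)))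
      (g := fun s => ENNReal.ofReal (s ^ ((1 + ε) / 2) * |deriv u s|))
      (by fun_prop) (by fun_prop)
    refine le_trans (le_of_eq ?_) (this.trans (le_of_eq ?_))
    · refine setLIntegral_congr_fun measurableSet_Ioi fun s hs => ?_
      have hs0 : (0:ℝ) < s := lt_trans one_pos hs
      simp only [Pi.mul_apply]
      rw [← ENNReal.ofReal_mul (by positivity), ← mul_assoc, ← Real.rpow_add hs0]
      have : (-1 - ε) / 2 + (1 + ε) / 2 = 0 := by ring
      rw [this, Real.rpow_zero, one_mul]
    · congr 2
      · refine setLIntegral_congr_fun measurableSet_Ioi fun s hs => ?_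
        have hs0 : (0:ℝ) < s := lt_trans one_pos hs
        rw [ENNReal.ofReal_rpow_of_nonneg (by positivity) (by norm_num), ← Real.rpow_mul hs0.le]
        congr 2; ring
      · refine setLIntegral_congr_fun measurableSet_Ioi fun s hs => ?_
        have hs0 : (0:ℝ) < s := lt_trans one_pos hs
        rw [ENNReal.ofReal_rpow_of_nonneg (by positivity) (by norm_num),
          Real.mul_rpow (by positivity) (by positivity), ← Real.rpow_mul hs0.le]
        norm_num
  have h4 := h2.trans h3
  rw [aux_Ioi ε hε, ← ENNReal.mul_rpow_of_nonneg _ _ (by norm_num)] at h4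
  have h5 := ENNReal.rpow_le_rpow h4 (z := 2) (by norm_num)
  rw [← ENNReal.rpow_mul, ENNReal.ofReal_rpow_of_nonneg (by positivity) (by norm_num)] at h5
  norm_num at h5
  simpa using h5

lemma aux_main (N : ℕ) (hN : 0 < N) (v : EuclideanSpace ℝ (Fin N) → ℝ) (hvm : Measurable v)
    (hv0 : ∀ x, 0 ≤ v x) (hvz : v 0 = 0) (m : ℝ) (hmN : m < N)
    (hv : ∀ s : ℝ, 1 ≤ s → ∀ y, v (s⁻¹ • y) ≤ s ^ m * v y)
    (φ : EuclideanSpace ℝ (Fin N) → ℝ) (L : NNReal) (hL : LipschitzWith L φ)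
    (hφ : HasCompactSupport φ) :
    ∫⁻ x, ENNReal.ofReal (φ x ^ 2 * v x) ≤ ENNReal.ofReal (4 / (N - m) ^ 2) *
      ∫⁻ y, ENNReal.ofReal (‖fderiv ℝ φ y‖ ^ 2 * (‖y‖ ^ 2 * v y)) := by
  set c : ℝ := N - m with hc
  have hc0 : 0 < c := by rw [hc]; linarith
  set A := ∫⁻ y, ENNReal.ofReal (‖fderiv ℝ φ y‖ ^ 2 * (‖y‖ ^ 2 * v y)) with hA
  have hld : Measurable (fun q : EuclideanSpace ℝ (Fin N) × EuclideanSpace ℝ (Fin N) =>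
    lineDeriv ℝ φ q.1 q.2) := measurable_lineDeriv_uncurry hL.continuous
  have hfd : Measurable (fun y => fderiv ℝ φ y) := measurable_fderiv ℝ φ
  let F : EuclideanSpace ℝ (Fin N) → ℝ → ENNReal := fun x s =>
    ENNReal.ofReal (s ^ (1 + c / 2) * lineDeriv ℝ φ (s • x) x ^ 2 * v x)
  have hFm : Measurable (Function.uncurry F) := by
    have h1 : Measurable (fun q : EuclideanSpace ℝ (Fin N) × ℝ =>
        lineDeriv ℝ φ (q.2 • q.1) q.1) :=
      hld.comp (f := fun q : EuclideanSpace ℝ (Fin N) × ℝ => (q.2 • q.1, q.1)) (by fun_prop)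
    simp only [F, Function.uncurry_def]
    fun_prop
  have step1 : ∀ x, ENNReal.ofReal (φ x ^ 2 * v x) ≤
      ENNReal.ofReal (1 / (c / 2)) * ∫⁻ s in Set.Ioi (1:ℝ), F x s := by
    intro x
    by_cases hx : x = 0
    · simp [hx, hvz]
    have hxn : 0 < ‖x‖ := norm_pos_iff.mpr hx
    obtain ⟨R, hR⟩ := hφ.isCompact.isBounded.subset_closedBall (0 : EuclideanSpace ℝ (Fin N))
    let T : ℝ := max 1 ((R + 1) / ‖x‖)
    have hT : φ (T • x) = 0 := by
      by_contra h
      have h1 := hR (subset_tsupport _ h)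
      rw [mem_closedBall_zero_iff, norm_smul, Real.norm_eq_abs] at h1
      have h2 : (R + 1) / ‖x‖ ≤ |T| := (le_max_right _ _).trans (le_abs_self _)
      rw [div_le_iff₀ hxn] at h2
      linarith
    have hlip : LipschitzWith (L * ‖x‖₊) (fun s : ℝ => φ (s • x)) := by
      refine hL.comp (LipschitzWith.of_dist_le_mul fun s t => ?_)
      rw [dist_eq_norm, dist_eq_norm, ← sub_smul, norm_smul, mul_comm]; rfl
    have := aux_1d (fun s => φ (s • x)) _ hlip T (le_max_left _ _) hT (c / 2) (by positivity)
    simp only [one_smul] at this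
    rw [ENNReal.ofReal_mul (by positivity)]
    refine (mul_le_mul_left this _).trans (le_of_eq ?_)
    rw [mul_assoc, ← lintegral_mul_const' _ _ ENNReal.ofReal_ne_top]
    congr 1
    refine setLIntegral_congr_fun measurableSet_Ioi fun s hs => ?_
    have hs0 : (0:ℝ) < s := lt_trans one_pos hs
    simp only [F]
    rw [← ENNReal.ofReal_mul (by positivity)]
    congr 4
    have h3 := deriv_comp_const_add (f := fun s : ℝ => φ (s • x)) s 0
    simp only [add_smul, add_zero] at h3
    rw [← h3]; rfl
  have step2 : ∀ s ∈ Set.Ioi (1:ℝ), ∫⁻ x, F x s ≤ ENNReal.ofReal (s ^ (-1 - c / 2)) * A := by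
    intro s hs
    have hs0 : (0:ℝ) < s := lt_trans one_pos hs
    let G : EuclideanSpace ℝ (Fin N) → ENNReal := fun y =>
      ENNReal.ofReal (s ^ (1 + c / 2) * lineDeriv ℝ φ y (s⁻¹ • y) ^ 2 * v (s⁻¹ • y))
    have hGm : Measurable G := by
      have h1 : Measurable (fun y : EuclideanSpace ℝ (Fin N) =>
        lineDeriv ℝ φ y (s⁻¹ • y)) :=
        hld.comp (f := fun y : EuclideanSpace ℝ (Fin N) => (y, s⁻¹ • y)) (by fun_prop)
      simp only [G]
      fun_prop
    have e1 : ∫⁻ x, F x s = ∫⁻ x, G (s • x) := by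
      refine lintegral_congr fun x => ?_
      simp only [F, G]
      rw [inv_smul_smul₀ hs0.ne']
    rw [e1, ← lintegral_map hGm (by fun_prop), Measure.map_addHaar_smul _ hs0.ne',
      lintegral_smul_measure, finrank_euclideanSpace_fin]
    have e2 : ∫⁻ y, G y ≤ ENNReal.ofReal (s ^ (1 + c / 2 - 2 + m)) * A := by
      rw [hA, ← lintegral_const_mul' _ _ ENNReal.ofReal_ne_top]
      refine lintegral_mono_ae ?_
      filter_upwards [hL.ae_differentiableAt (μ := volume)] with y hy
      simp only [G]
      rw [← ENNReal.ofReal_mul (by positivity)]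
      apply ENNReal.ofReal_le_ofReal
      have h1 : lineDeriv ℝ φ y (s⁻¹ • y) ^ 2 ≤ s ^ (-2:ℝ) * (‖fderiv ℝ φ y‖ ^ 2 * ‖y‖ ^ 2) := by
        rw [hy.lineDeriv_eq_fderiv, map_smul, smul_eq_mul, mul_pow]
        have : s ^ (-2:ℝ) = s⁻¹ ^ 2 := by
          rw [Real.rpow_neg hs0.le, inv_pow]; norm_num
        rw [this, ← mul_pow ‖fderiv ℝ φ y‖]
        gcongr ?_ * ?_
        rw [← sq_abs]
        gcongr
        exact (fderiv ℝ φ y).le_opNorm y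
      have h2 := hv s hs.le y
      have h3 := hv0 y
      have h4 := hv0 (s⁻¹ • y)
      calc _ ≤ s ^ (1 + c / 2) * (s ^ (-2:ℝ) * (‖fderiv ℝ φ y‖ ^ 2 * ‖y‖ ^ 2)) *
            (s ^ m * v y) := by gcongr
        _ = (s ^ (1 + c / 2) * s ^ (-2:ℝ) * s ^ m) *
            (‖fderiv ℝ φ y‖ ^ 2 * (‖y‖ ^ 2 * v y)) := by ring
        _ = _ := by
          rw [← Real.rpow_add hs0, ← Real.rpow_add hs0]; rfl
    refine (mul_le_mul_right e2 _).trans (le_of_eq ?_)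
    rw [← mul_assoc, ← ENNReal.ofReal_mul (by positivity), abs_of_pos (by positivity),
      ← Real.rpow_natCast, ← Real.rpow_neg hs0.le, ← Real.rpow_add hs0]
    congr 3
    rw [hc]; ring
  calc _ ≤ ∫⁻ x, ENNReal.ofReal (1 / (c / 2)) * ∫⁻ s in Set.Ioi (1:ℝ), F x s :=
        lintegral_mono step1
    _ = ENNReal.ofReal (1 / (c / 2)) * ∫⁻ s in Set.Ioi (1:ℝ), ∫⁻ x, F x s := by
        rw [lintegral_const_mul' _ _ ENNReal.ofReal_ne_top, lintegral_lintegral_swap]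
        exact hFm.aemeasurable
    _ ≤ ENNReal.ofReal (1 / (c / 2)) *
          ∫⁻ s in Set.Ioi (1:ℝ), ENNReal.ofReal (s ^ (-1 - c / 2)) * A := by
        gcongr 1
        exact setLIntegral_mono' measurableSet_Ioi step2
    _ = _ := by
        rw [lintegral_mul_const _ (by fun_prop), aux_Ioi _ (by positivity), ← mul_assoc,
          ← ENNReal.ofReal_mul (by positivity)]
        congr 2
        field_simp; norm_num

lemma aux_loc (N : ℕ) (hN : 0 < N) (k : ℝ) (hk : k < N) (R : ℝ) :
    IntegrableOn (fun x : EuclideanSpace ℝ (Fin N) => ‖x‖ ^ (-k)) (Metric.ball 0 R) := by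
  haveI : Nonempty (Fin N) := ⟨⟨0, hN⟩⟩
  haveI : Nontrivial (EuclideanSpace ℝ (Fin N)) := by
    apply Module.nontrivial_of_finrank_pos (R := ℝ)
    simpa using hN
  rw [integrableOn_fun_norm_addHaar volume (f := fun r : ℝ => r ^ (-k))]
  rw [finrank_euclideanSpace_fin]
  have h : IntegrableOn (fun y : ℝ => y ^ ((N:ℝ) - 1 - k)) (Set.Ioo 0 R) := by
    rcases le_or_gt R 0 with h | h
    · rw [Set.Ioo_eq_empty (by linarith)]; simp
    · have := intervalIntegral.intervalIntegrable_rpow' (a := 0) (b := R)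
        (r := (N:ℝ) - 1 - k) (by linarith)
      rw [intervalIntegrable_iff_integrableOn_Ioo_of_le h.le] at this
      exact this
  refine h.congr_fun (fun y hy => ?_) measurableSet_Ioo
  have hy0 : (0:ℝ) < y := hy.1
  simp only [smul_eq_mul]
  rw [← Real.rpow_natCast, ← Real.rpow_add hy0, Nat.cast_sub hN]
  simp [sub_eq_add_neg]

lemma aux_scale (a b r s : ℝ) (ha : 0 ≤ a) (hb : 0 ≤ b) (hr : 0 ≤ r) (hs : 1 ≤ s) :
    (s⁻¹ * r) ^ (-b) * (1 + (s⁻¹ * r) ^ b) ^ (-a) ≤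
      s ^ (b + b * a) * (r ^ (-b) * (1 + r ^ b) ^ (-a)) := by
  have hs0 : 0 < s := by linarith
  have hsb : 1 ≤ s ^ b := Real.one_le_rpow hs hb
  have e1 : (s⁻¹ * r) ^ (-b) = s ^ b * r ^ (-b) := by
    rw [Real.mul_rpow (by positivity) hr, Real.inv_rpow hs0.le, Real.rpow_neg hs0.le, inv_inv]
  have e2 : (1 + (s⁻¹ * r) ^ b) ^ (-a) ≤ s ^ (b * a) * (1 + r ^ b) ^ (-a) := by
    have : s ^ (b * a) = ((s ^ b)⁻¹) ^ (-a) := by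
      rw [Real.rpow_mul hs0.le, Real.inv_rpow (by positivity), Real.rpow_neg (by positivity),
        inv_inv]
    rw [this, ← Real.mul_rpow (by positivity) (by positivity)]
    apply Real.rpow_le_rpow_of_nonpos (by positivity) _ (by linarith)
    rw [Real.mul_rpow (by positivity) hr, Real.inv_rpow hs0.le, mul_add, mul_one]
    gcongr
    exact inv_le_one_of_one_le₀ hsb
  rw [e1, Real.rpow_add hs0]
  calc _ ≤ s ^ b * r ^ (-b) * (s ^ (b * a) * (1 + r ^ b) ^ (-a)) := by gcongr
    _ = _ := by ring

/-- Hardy inequality relevant to the fast-diffusion-range evolution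
`p`-Laplace equation (case `q = 2`, `γ = -p/(p-1)`, `β = p/(p-1)`,
`α = -(p-1)/(2-p)`). -/
theorem hardy_p_laplace
    (N : ℕ) (p : ℝ) (hp1 : 1 < p) (hp2 : p < 2) (hN : 2 < N)
    (hNp : p / ((2 - p) * (p - 1)) < N) :
    ∃ CH : ℝ, 0 < CH ∧
      ∀ φ : EuclideanSpace ℝ (Fin N) → ℝ,
        (∃ L, LipschitzWith L φ) → HasCompactSupport φ →
        ∫ x, |φ x| ^ (2 : ℝ) *
            (‖x‖ ^ (-(p / (p - 1))) *
              (1 + ‖x‖ ^ (p / (p - 1))) ^ (-((p - 1) / (2 - p)))) ≤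
          CH * ∫ x, ‖fderiv ℝ φ x‖ ^ (2 : ℝ) *
            (‖x‖ ^ (-((2 - p) / (p - 1))) *
              (1 + ‖x‖ ^ (p / (p - 1))) ^ (-((p - 1) / (2 - p)))) := by
  have hp10 : 0 < p - 1 := by linarith
  have hp20 : 0 < 2 - p := by linarith
  set b : ℝ := p / (p - 1) with hb
  set a : ℝ := (p - 1) / (2 - p) with ha
  have hb0 : 0 < b := by positivity
  have ha0 : 0 < a := by positivity
  have hk : (2 - p) / (p - 1) = b - 2 := by rw [hb]; field_simp; ring
  have hk0 : 0 < b - 2 := by rw [← hk]; positivity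
  have hm : p / ((2 - p) * (p - 1)) = b + b * a := by
    rw [hb, ha]; field_simp; ring
  rw [hm] at hNp
  rw [hk]
  have hba : 0 < b * a := by positivity
  let v : EuclideanSpace ℝ (Fin N) → ℝ := fun x => ‖x‖ ^ (-b) * (1 + ‖x‖ ^ b) ^ (-a)
  have hv0 : ∀ x, 0 ≤ v x := fun x => by simp only [v]; positivity
  have hvm : Measurable v := by simp only [v]; fun_prop
  have hW : ∀ x, ‖x‖ ^ 2 * v x = ‖x‖ ^ (-(b - 2)) * (1 + ‖x‖ ^ b) ^ (-a) := by
    intro x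
    simp only [v]
    rw [← mul_assoc]
    congr 1
    rcases (norm_nonneg x).eq_or_lt with h | h
    · rw [← h, Real.zero_rpow (by linarith), Real.zero_rpow (by linarith)]; simp
    · rw [← Real.rpow_natCast, ← Real.rpow_add h]; congr 1; push_cast; ring
  refine ⟨4 / ((N:ℝ) - (b + b * a)) ^ 2, ?_, ?_⟩
  · have : 0 < (N:ℝ) - (b + b * a) := by linarith
    positivity
  rintro φ ⟨L, hL⟩ hφ
  have main := aux_main N (by omega) v hvm hv0
    (by simp only [v]; rw [norm_zero, Real.zero_rpow (by linarith)]; simp)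
    (b + b * a) hNp (fun s hs y => by
      simp only [v]
      rw [norm_smul, Real.norm_eq_abs, abs_of_pos (by positivity)]
      exact aux_scale a b ‖y‖ s ha0.le hb0.le (norm_nonneg y) hs) φ L hL hφ
  have hfd : Measurable (fun y => fderiv ℝ φ y) := measurable_fderiv ℝ φ
  have hφm : Measurable φ := hL.continuous.measurable
  simp_rw [← hW, Real.rpow_two, sq_abs]
  change ∫ x, φ x ^ 2 * v x ≤ _
  have hint : Integrable (fun x => ‖fderiv ℝ φ x‖ ^ 2 * (‖x‖ ^ 2 * v x)) := by
    obtain ⟨R, hR⟩ := hφ.isCompact.isBounded.subset_ball (0 : EuclideanSpace ℝ (Fin N))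
    have h1 := aux_loc N (by omega) (b - 2) (by linarith) R
    rw [← integrable_indicator_iff measurableSet_ball] at h1
    refine (h1.const_mul ((L:ℝ) ^ 2)).mono' (by fun_prop) (ae_of_all _ fun x => ?_)
    have hvx := hv0 x
    rw [Real.norm_of_nonneg (by positivity)]
    by_cases hx : x ∈ Metric.ball (0 : EuclideanSpace ℝ (Fin N)) R
    · rw [Set.indicator_of_mem hx, hW]
      have h2 : ‖fderiv ℝ φ x‖ ≤ L := norm_fderiv_le_of_lipschitz ℝ hL
      have h3 : (1 + ‖x‖ ^ b) ^ (-a) ≤ 1 :=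
        Real.rpow_le_one_of_one_le_of_nonpos
          (by have : 0 ≤ ‖x‖ ^ b := by positivity
              linarith) (by linarith)
      gcongr
      exact mul_le_of_le_one_right (by positivity) h3
    · have : fderiv ℝ φ x = 0 := by
        by_contra h
        exact hx (hR (support_fderiv_subset ℝ h))
      rw [Set.indicator_of_notMem hx, this]; simp
  have hRfin := hint.lintegral_lt_top
  rw [integral_eq_lintegral_of_nonneg_ae (ae_of_all _ fun x => mul_nonneg (sq_nonneg _) (hv0 x))
      (by fun_prop),
    integral_eq_lintegral_of_nonneg_ae (ae_of_all _ fun x => mul_nonneg (sq_nonneg _)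
      (mul_nonneg (sq_nonneg _) (hv0 x))) hint.aestronglyMeasurable]
  have := ENNReal.toReal_mono (ENNReal.mul_ne_top ENNReal.ofReal_ne_top hRfin.ne) main
  rwa [ENNReal.toReal_mul, ENNReal.toReal_ofReal (by positivity)] at this
end

section
/- Let 1 < p < 2, N > 2, N > p/((2-p)(p-1)), and assume additionally N ≤ 7 or p ∉ (p₋, p₊) where p₊/₋ = 3/2 ± (1/2)√((N-7)/(N+1)). Then the optimal constant in the inequality ∫_{ℝ^N} |φ|² |x|^{-p/(p-1)}(1+|x|^{p/(p-1)})^{-(p-1)/(2-p)} dx ≤ C_H ∫_{ℝ^N} |∇φ|² |x|^{-(2-p)/(p-1)}(1+|x|^{p/(p-1)})^{-(p-1)/(2-p)} dx is C_H = 4 (N - p/((2-p)(p-1)))^{-2}. -/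
open MeasureTheory

noncomputable def hW (β a r : ℝ) : ℝ := r ^ (-β) * (1 + r ^ β) ^ (-a)

lemma hW_nonneg (β a : ℝ) {r : ℝ} (hr : 0 ≤ r) : 0 ≤ hW β a r := by
  unfold hW; positivity

lemma hW_meas (β a : ℝ) : Measurable (hW β a) := by
  unfold hW; fun_prop

/-- scaling -/
lemma hW_scale {β a s r : ℝ} (hβ : 0 < β) (ha : 0 < a) (hs : 0 < s) (hs1 : s ≤ 1) (hr : 0 ≤ r) :
    s ^ (β + a * β) * hW β a r ≤ hW β a (s⁻¹ * r) := by
  unfold hW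
  have h1 : (s⁻¹ * r) ^ (-β) = s ^ β * r ^ (-β) := by
    rw [Real.mul_rpow (by positivity) hr, Real.inv_rpow hs.le, Real.rpow_neg hs.le, inv_inv]
  have h2 : (s⁻¹ * r) ^ β = (s ^ β)⁻¹ * r ^ β := by
    rw [Real.mul_rpow (by positivity) hr, Real.inv_rpow hs.le]
  have h3 : s ^ (a * β) = ((s ^ β)⁻¹) ^ (-a) := by
    rw [← Real.rpow_neg hs.le, ← Real.rpow_mul hs.le]; ring_nf
  rw [h1, h2, Real.rpow_add hs, h3]
  have hsb : 0 < s ^ β := by positivity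
  have hsb1 : s ^ β ≤ 1 := Real.rpow_le_one hs.le hs1 hβ.le
  have h4 : ((s ^ β)⁻¹) ^ (-a) * (1 + r ^ β) ^ (-a) ≤ (1 + (s ^ β)⁻¹ * r ^ β) ^ (-a) := by
    rw [← Real.mul_rpow (by positivity) (by positivity)]
    apply Real.rpow_le_rpow_of_nonpos (by positivity) _ (by linarith)
    have : 1 ≤ (s ^ β)⁻¹ := (one_le_inv₀ hsb).2 hsb1
    nlinarith
  calc _ = (s ^ β * r ^ (-β)) * (((s ^ β)⁻¹) ^ (-a) * (1 + r ^ β) ^ (-a)) := by ring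
    _ ≤ _ := by gcongr

lemma hW_int {N : ℕ} (hN : 2 < N) {β a : ℝ} (ha : 0 < a) (hb : β < N) (R : ℝ)
    (hR : 0 < R) :
    Integrable (fun x : EuclideanSpace ℝ (Fin N) =>
      (Metric.closedBall (0 : EuclideanSpace ℝ (Fin N)) R).indicator (fun x => hW β a ‖x‖) x) := by
  have : Nontrivial (EuclideanSpace ℝ (Fin N)) := by
    have : Nonempty (Fin N) := ⟨⟨0, by omega⟩⟩
    infer_instance
  have h := (integrable_fun_norm_addHaar (E := EuclideanSpace ℝ (Fin N)) volume
    (f := (Set.Iic R).indicator (hW β a))).2 ?_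
  · refine h.congr (Filter.Eventually.of_forall fun x => ?_)
    simp [Set.indicator]
  · have e : (fun y : ℝ => y ^ (Module.finrank ℝ (EuclideanSpace ℝ (Fin N)) - 1) •
        (Set.Iic R).indicator (hW β a) y) = (Set.Iic R).indicator
        (fun y => y ^ (N - 1) * hW β a y) := by
      ext y; simp [Set.indicator]
    rw [e, integrableOn_indicator_iff measurableSet_Iic, Set.inter_comm, Set.Ioi_inter_Iic]
    have h0 : IntegrableOn (fun y : ℝ => y ^ ((N : ℝ) - 1 - β)) (Set.Ioc 0 R) := by
      rw [integrableOn_Ioc_iff_integrableOn_Ioo, intervalIntegral.integrableOn_Ioo_rpow_iff hR]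
      linarith
    refine Integrable.mono' h0 ?_ ?_
    · exact ((measurable_id.pow_const _).mul (hW_meas β a)).aestronglyMeasurable
    · refine (ae_restrict_iff' measurableSet_Ioc).2 (Filter.Eventually.of_forall fun y hy => ?_)
      have hy0 : 0 < y := hy.1
      rw [Real.norm_of_nonneg (mul_nonneg (by positivity) (hW_nonneg _ _ hy0.le))]
      have : y ^ ((N : ℝ) - 1 - β) = y ^ (N - 1) * (y ^ (-β) * 1) := by
        rw [← Real.rpow_natCast, mul_one, ← Real.rpow_add hy0, Nat.cast_sub (by omega)]
        simp [sub_eq_add_neg]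
      rw [this]
      unfold hW
      gcongr
      apply Real.rpow_le_one_of_one_le_of_nonpos _ (by linarith)
      have : 0 ≤ y ^ β := by positivity
      linarith

lemma int_of_bound {N : ℕ} (hN : 2 < N) {β a : ℝ} (ha : 0 < a) (hb : β < N) {R : ℝ}
    (hR : 0 < R) {f : EuclideanSpace ℝ (Fin N) → ℝ} (hf : Measurable f) {K : ℝ}
    (hK : ∀ x, ‖x‖ ≤ R → |f x| ≤ K) (h0 : ∀ x, R < ‖x‖ → f x = 0) :
    Integrable (fun x => f x * hW β a ‖x‖) := by
  refine Integrable.mono' ((hW_int hN ha hb R hR).const_mul K)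
    (hf.mul ((hW_meas β a).comp measurable_norm)).aestronglyMeasurable
    (Filter.Eventually.of_forall fun x => ?_)
  rw [norm_mul, Real.norm_of_nonneg (hW_nonneg _ _ (norm_nonneg x)), Real.norm_eq_abs]
  by_cases hx : ‖x‖ ≤ R
  · simp only [Set.indicator, Metric.mem_closedBall, dist_zero_right, hx, if_true]
    exact mul_le_mul_of_nonneg_right (hK x hx) (hW_nonneg _ _ (norm_nonneg x))
  · simp [Set.indicator, hx, h0 x (not_le.1 hx)]

lemma hardy_ineq {N : ℕ} (hN : 2 < N) {β a δ : ℝ} (hβ : 0 < β) (ha : 0 < a)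
    (hδ : δ = N - (β + a * β)) (hδ0 : 0 < δ)
    (φ : EuclideanSpace ℝ (Fin N) → ℝ) {L : NNReal} (hL : LipschitzWith L φ)
    (hc : HasCompactSupport φ) :
    ∫ x, φ x ^ 2 * hW β a ‖x‖ ≤
      4 / δ ^ 2 * ∫ x, (‖fderiv ℝ φ x‖ ^ 2 * ‖x‖ ^ 2) * hW β a ‖x‖ := by
  have hb : β < N := by nlinarith
  obtain ⟨R, hR, hsupp⟩ : ∃ R : ℝ, 0 < R ∧ ∀ x, R < ‖x‖ → x ∉ tsupport φ := by
    obtain ⟨R, hR⟩ := (Metric.isBounded_iff_subset_closedBall (0 : EuclideanSpace ℝ (Fin N))).1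
      hc.isCompact.isBounded
    refine ⟨max R 1, by positivity, fun x hx h => ?_⟩
    have := hR h
    simp only [Metric.mem_closedBall, dist_zero_right] at this
    have := le_max_left R 1
    linarith
  have hφ0 : ∀ x, R < ‖x‖ → φ x = 0 := fun x hx => image_eq_zero_of_notMem_tsupport (hsupp x hx)
  have hD0 : ∀ x, R < ‖x‖ → fderiv ℝ φ x = 0 := fun x hx => by
    by_contra h
    exact hsupp x hx (support_fderiv_subset ℝ h)
  have hDL : ∀ x, ‖fderiv ℝ φ x‖ ≤ L := fun x => norm_fderiv_le_of_lipschitz ℝ hL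
  obtain ⟨B, hB⟩ : ∃ B, ∀ x, |φ x| ≤ B := by
    obtain ⟨B, hB⟩ := hc.exists_bound_of_continuous hL.continuous
    exact ⟨B, hB⟩
  have hB0 : 0 ≤ B := (abs_nonneg _).trans (hB 0)
  have hmφ : Measurable φ := hL.continuous.measurable
  have hmD : Measurable (fun x => fderiv ℝ φ x x) := by
    exact (continuous_fst.clm_apply continuous_snd).measurable.comp
      ((measurable_fderiv ℝ φ).prodMk measurable_id)
  have hmDn : Measurable (fun x => ‖fderiv ℝ φ x‖) := (measurable_fderiv ℝ φ).norm
  have hDx : ∀ x, |fderiv ℝ φ x x| ≤ ‖fderiv ℝ φ x‖ * ‖x‖ := fun x => (fderiv ℝ φ x).le_opNorm x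
  -- integrability
  have iA : Integrable (fun x => φ x ^ 2 * hW β a ‖x‖) :=
    int_of_bound hN ha hb hR (hmφ.pow_const 2) (K := B ^ 2)
      (fun x _ => by rw [abs_pow]; gcongr; exact hB x) (fun x hx => by simp [hφ0 x hx])
  have iB : Integrable (fun x => (‖fderiv ℝ φ x‖ ^ 2 * ‖x‖ ^ 2) * hW β a ‖x‖) :=
    int_of_bound hN ha hb hR ((hmDn.pow_const 2).mul (measurable_norm.pow_const 2))
      (K := L ^ 2 * R ^ 2)
      (fun x hx => by rw [abs_of_nonneg (by positivity)]; gcongr; exact hDL x)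
      (fun x hx => by simp [hD0 x hx])
  have iX : Integrable (fun x => (2 * φ x * (-fderiv ℝ φ x x)) * hW β a ‖x‖) :=
    int_of_bound hN ha hb hR ((hmφ.const_mul 2).mul hmD.neg)
      (K := 2 * B * (L * R))
      (fun x hx => by
        rw [abs_mul, abs_mul, abs_two, abs_neg]
        gcongr
        · exact hB x
        · exact (hDx x).trans (by gcongr; exact hDL x))
      (fun x hx => by simp [hD0 x hx])
  -- scaled function
  have iS : ∀ t ∈ Set.Ioo (0 : ℝ) (1 / 2),
      Integrable (fun x => φ ((1 - t) • x) ^ 2 * hW β a ‖x‖) := fun t ht =>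
    int_of_bound hN ha hb (R := 2 * R) (by positivity)
      ((hmφ.comp (measurable_const_smul (1 - t))).pow_const 2) (K := B ^ 2)
      (fun x _ => by rw [abs_pow]; gcongr; exact hB _)
      (fun x hx => by
        change φ ((1 - t) • x) ^ 2 = 0
        rw [hφ0, zero_pow two_ne_zero]
        rw [norm_smul, Real.norm_of_nonneg (by linarith [ht.2])]
        nlinarith [ht.2])
  set A := ∫ x, φ x ^ 2 * hW β a ‖x‖ with hA
  have hA0 : 0 ≤ A := integral_nonneg fun x =>
    mul_nonneg (sq_nonneg _) (hW_nonneg _ _ (norm_nonneg x))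
  have key1 : ∀ t ∈ Set.Ioo (0 : ℝ) (1 / 2), δ * A ≤
      ∫ x, (t⁻¹ * (φ ((1 - t) • x) ^ 2 - φ x ^ 2)) * hW β a ‖x‖ := by
    intro t ht
    have hs : 0 < 1 - t := by linarith [ht.2]
    have e1 : ∫ x, φ ((1 - t) • x) ^ 2 * hW β a ‖x‖ =
        ((1 - t) ^ N)⁻¹ * ∫ x, φ x ^ 2 * hW β a ((1 - t)⁻¹ * ‖x‖) := by
      have := Measure.integral_comp_smul (volume : Measure (EuclideanSpace ℝ (Fin N)))
        (fun x => φ x ^ 2 * hW β a ((1 - t)⁻¹ * ‖x‖)) (1 - t)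
      rw [finrank_euclideanSpace_fin, abs_of_pos (by positivity), smul_eq_mul] at this
      rw [← this]
      congr 1
      ext x
      rw [norm_smul, Real.norm_of_nonneg hs.le, inv_mul_cancel_left₀ hs.ne']
    have iS' : Integrable (fun x => φ x ^ 2 * hW β a ((1 - t)⁻¹ * ‖x‖)) := by
      have := (iS t ht).comp_smul (R := (1 - t)⁻¹) (by positivity)
      refine this.congr (Filter.Eventually.of_forall fun x => ?_)
      simp only [norm_smul, Real.norm_of_nonneg (inv_pos.2 hs).le]
      rw [smul_inv_smul₀ hs.ne']
    have e2 : (1 - t) ^ (β + a * β) * A ≤ ∫ x, φ x ^ 2 * hW β a ((1 - t)⁻¹ * ‖x‖) := by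
      rw [hA, ← integral_const_mul]
      refine integral_mono (iA.const_mul _) iS' fun x => ?_
      have := hW_scale hβ ha hs (by linarith [ht.1]) (norm_nonneg x)
      calc _ = φ x ^ 2 * ((1 - t) ^ (β + a * β) * hW β a ‖x‖) := by ring
        _ ≤ _ := by gcongr
    have e3 : (1 + δ * t) ≤ ((1 - t) ^ N)⁻¹ * (1 - t) ^ (β + a * β) := by
      rw [← Real.rpow_natCast, ← Real.rpow_neg hs.le, ← Real.rpow_add hs,
        show -(N : ℝ) + (β + a * β) = -δ by rw [hδ]; ring, Real.rpow_def_of_pos hs]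
      have h1 : Real.log (1 - t) ≤ -t := by linarith [Real.log_le_sub_one_of_pos hs]
      have h2 : δ * t ≤ Real.log (1 - t) * -δ := by nlinarith
      linarith [Real.add_one_le_exp (Real.log (1 - t) * -δ)]
    have e4 : (1 + δ * t) * A ≤ ∫ x, φ ((1 - t) • x) ^ 2 * hW β a ‖x‖ := by
      rw [e1]
      calc _ ≤ (((1 - t) ^ N)⁻¹ * (1 - t) ^ (β + a * β)) * A := by gcongr
        _ = ((1 - t) ^ N)⁻¹ * ((1 - t) ^ (β + a * β) * A) := by ring
        _ ≤ _ := by gcongr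
    have e5 : ∫ x, (t⁻¹ * (φ ((1 - t) • x) ^ 2 - φ x ^ 2)) * hW β a ‖x‖ =
        t⁻¹ * ((∫ x, φ ((1 - t) • x) ^ 2 * hW β a ‖x‖) - A) := by
      rw [hA, ← integral_sub (iS t ht) iA, ← integral_const_mul]
      congr 1; ext x; ring
    rw [e5, inv_mul_eq_div, le_div_iff₀ ht.1]
    linarith
  have key2 : Filter.Tendsto
      (fun t : ℝ => ∫ x, (t⁻¹ * (φ ((1 - t) • x) ^ 2 - φ x ^ 2)) * hW β a ‖x‖)
      (nhdsWithin 0 (Set.Ioi 0)) (nhds (∫ x, (2 * φ x * (-fderiv ℝ φ x x)) * hW β a ‖x‖)) := by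
    refine tendsto_integral_filter_of_dominated_convergence
      (fun x => (2 * B * (L * (2 * R))) *
        (Metric.closedBall (0 : EuclideanSpace ℝ (Fin N)) (2 * R)).indicator
          (fun x => hW β a ‖x‖) x) ?_ ?_ ((hW_int hN ha hb _ (by positivity)).const_mul _) ?_
    · refine Filter.Eventually.of_forall fun t => Measurable.aestronglyMeasurable ?_
      exact (((((hmφ.comp (measurable_const_smul (1 - t))).pow_const 2).sub
        (hmφ.pow_const 2)).const_mul _).mul ((hW_meas β a).comp measurable_norm))
    · filter_upwards [Ioo_mem_nhdsGT (show (0 : ℝ) < 1 / 2 by norm_num)] with t ht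
      refine Filter.Eventually.of_forall fun x => ?_
      rw [norm_mul, Real.norm_of_nonneg (hW_nonneg _ _ (norm_nonneg x)), Real.norm_eq_abs]
      by_cases hx : ‖x‖ ≤ 2 * R
      · simp only [Set.indicator, Metric.mem_closedBall, dist_zero_right, hx, if_true]
        refine mul_le_mul_of_nonneg_right ?_ (hW_nonneg _ _ (norm_nonneg x))
        have h1 : |φ ((1 - t) • x) - φ x| ≤ L * (t * ‖x‖) := by
          have := hL.dist_le_mul ((1 - t) • x) x
          rw [Real.dist_eq, dist_eq_norm, show (1 - t) • x - x = (-t) • x by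
            rw [sub_smul, one_smul, neg_smul]; abel, norm_smul, norm_neg,
            Real.norm_of_nonneg ht.1.le] at this
          exact this
        have h2 : |φ ((1 - t) • x) + φ x| ≤ 2 * B :=
          (abs_add_le _ _).trans (by linarith [hB ((1 - t) • x), hB x])
        rw [sq_sub_sq, abs_mul, abs_of_pos (inv_pos.2 ht.1), abs_mul, inv_mul_le_iff₀ ht.1]
        calc _ ≤ (2 * B) * (L * (t * ‖x‖)) := by gcongr
          _ ≤ (2 * B) * (L * (t * (2 * R))) := by
            have := ht.1.le
            gcongr
          _ = _ := by ring
      · have hx' := not_le.1 hx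
        rw [hφ0 x (by linarith), hφ0 ((1 - t) • x)]
        · simp [Set.indicator, hx]
        rw [norm_smul, Real.norm_of_nonneg (by linarith [ht.2])]
        nlinarith [ht.2]
    · filter_upwards [hL.ae_differentiableAt (μ := volume)] with x hx
      refine Filter.Tendsto.mul_const _ ?_
      have h1 : HasDerivAt (fun t : ℝ => (1 - t) • x) (-x) 0 := by
        have := ((hasDerivAt_id (0 : ℝ)).const_sub 1).smul_const x
        simpa using this
      have h2 : HasDerivAt (fun t : ℝ => φ ((1 - t) • x)) (fderiv ℝ φ x (-x)) 0 := by
        have hx' : HasFDerivAt φ (fderiv ℝ φ x) ((1 - (0 : ℝ)) • x) := by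
          simpa using hx.hasFDerivAt
        exact hx'.comp_hasDerivAt (0 : ℝ) h1
      have h3 := (h2.pow 2).tendsto_slope_zero_right
      simpa using h3
  have key3 : δ * A ≤ ∫ x, (2 * φ x * (-fderiv ℝ φ x x)) * hW β a ‖x‖ := by
    refine ge_of_tendsto key2 ?_
    filter_upwards [Ioo_mem_nhdsGT (show (0 : ℝ) < 1 / 2 by norm_num)] with t ht using key1 t ht
  have key4 : ∫ x, (2 * φ x * (-fderiv ℝ φ x x)) * hW β a ‖x‖ ≤
      δ / 2 * A + 2 / δ * ∫ x, (‖fderiv ℝ φ x‖ ^ 2 * ‖x‖ ^ 2) * hW β a ‖x‖ := by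
    rw [hA, ← integral_const_mul, ← integral_const_mul, ← integral_add (iA.const_mul _)
      (iB.const_mul _)]
    refine integral_mono iX ((iA.const_mul _).add (iB.const_mul _)) fun x => ?_
    have h1 : 2 * φ x * (-fderiv ℝ φ x x) ≤
        δ / 2 * φ x ^ 2 + 2 / δ * (‖fderiv ℝ φ x‖ ^ 2 * ‖x‖ ^ 2) := by
      have h2 : (fderiv ℝ φ x x) ^ 2 ≤ ‖fderiv ℝ φ x‖ ^ 2 * ‖x‖ ^ 2 := by
        rw [← mul_pow, ← sq_abs]; gcongr; exact hDx x
      have h3 : 2 / δ * (fderiv ℝ φ x x) ^ 2 ≤ 2 / δ * (‖fderiv ℝ φ x‖ ^ 2 * ‖x‖ ^ 2) := by gcongr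
      have h4 : 0 ≤ 2 / δ * (δ / 2 * φ x + fderiv ℝ φ x x) ^ 2 := by positivity
      have h5 : 2 / δ * (δ / 2 * φ x + fderiv ℝ φ x x) ^ 2 = δ / 2 * φ x ^ 2 +
        2 * φ x * fderiv ℝ φ x x + 2 / δ * (fderiv ℝ φ x x) ^ 2 := by field_simp; ring
      linarith
    calc _ ≤ _ := mul_le_mul_of_nonneg_right h1 (hW_nonneg β a (norm_nonneg x))
      _ = _ := by ring
  have h : δ / 2 * A ≤ 2 / δ * ∫ x, (‖fderiv ℝ φ x‖ ^ 2 * ‖x‖ ^ 2) * hW β a ‖x‖ := by linarith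
  calc A = 2 / δ * (δ / 2 * A) := by field_simp
    _ ≤ 2 / δ * (2 / δ * ∫ x, (‖fderiv ℝ φ x‖ ^ 2 * ‖x‖ ^ 2) * hW β a ‖x‖) := by gcongr
    _ = _ := by field_simp; ring

lemma radial {N : ℕ} (hN : 2 < N) (F : ℝ → ℝ) {m T : ℝ} (hm : 0 < m) :
    ∫ x : EuclideanSpace ℝ (Fin N), F ‖x‖ =
      (N * volume.real (Metric.ball (0 : EuclideanSpace ℝ (Fin N)) 1) * m) *
        ∫ s : ℝ, Real.exp (N * (T + m * s)) * F (Real.exp (T + m * s)) := by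
  have : Nontrivial (EuclideanSpace ℝ (Fin N)) := by
    have : Nonempty (Fin N) := ⟨⟨0, by omega⟩⟩
    infer_instance
  rw [integral_fun_norm_addHaar volume F, finrank_euclideanSpace_fin, nsmul_eq_mul, smul_eq_mul,
    mul_assoc, mul_assoc, ← integral_const_mul m]
  congr 2
  have him : Set.Ioi (0 : ℝ) = (fun s => Real.exp (T + m * s)) '' Set.univ := by
    ext y
    simp only [Set.mem_Ioi, Set.image_univ, Set.mem_range]
    constructor
    · intro hy
      refine ⟨(Real.log y - T) / m, ?_⟩
      rw [mul_div_cancel₀ _ hm.ne', add_sub_cancel, Real.exp_log hy]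
    · rintro ⟨s, rfl⟩; exact Real.exp_pos _
  have hd : ∀ s ∈ Set.univ, HasDerivWithinAt (fun s => Real.exp (T + m * s))
      (Real.exp (T + m * s) * m) Set.univ s := by
    intro s _
    have h1 : HasDerivAt (fun s : ℝ => T + m * s) m s := by
      simpa using ((hasDerivAt_id s).const_mul m).const_add T
    exact h1.exp.hasDerivWithinAt
  rw [him, integral_image_eq_integral_abs_deriv_smul MeasurableSet.univ hd, setIntegral_univ]
  · congr 1; ext s
    rw [abs_of_pos (by positivity), smul_eq_mul, smul_eq_mul, ← Real.exp_nat_mul]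
    have : (N : ℝ) * (T + m * s) = (T + m * s) + ((N - 1 : ℕ) : ℝ) * (T + m * s) := by
      rw [Nat.cast_sub (by omega)]; push_cast; ring
    rw [this, Real.exp_add (T + m * s)]; ring_nf
  · intro x _ y _ hxy
    have := Real.exp_injective hxy
    simpa [hm.ne'] using this

noncomputable def hK (β a t : ℝ) : ℝ := (1 + Real.exp (-(β * t))) ^ (-a)

lemma hK_eq {N : ℕ} {β a δ : ℝ} (hδ : δ = N - (β + a * β)) (t : ℝ) :
    Real.exp (N * t) * (Real.exp (-(δ * t)) * hW β a (Real.exp t)) = hK β a t := by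
  unfold hW hK
  have h1 : (1 + Real.exp (-(β * t))) = Real.exp (-(β * t)) * (1 + (Real.exp t) ^ β) := by
    rw [← Real.exp_mul, mul_add, ← Real.exp_add, mul_one,
      show -(β * t) + t * β = 0 by ring, Real.exp_zero, add_comm]
  rw [h1, Real.mul_rpow (by positivity) (by positivity), ← Real.exp_mul (-(β * t)),
    ← Real.exp_mul t (-β), ← mul_assoc, ← mul_assoc, ← Real.exp_add, ← Real.exp_add]
  congr 2
  rw [hδ]; ring

lemma hK_nonneg (β a t : ℝ) : 0 ≤ hK β a t := by unfold hK; positivity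

lemma hK_le {β a : ℝ} (ha : 0 < a) (t : ℝ) : hK β a t ≤ 1 := by
  unfold hK
  apply Real.rpow_le_one_of_one_le_of_nonpos _ (by linarith)
  linarith [Real.exp_pos (-(β * t))]

lemma hK_tendsto {β a : ℝ} (hβ : 0 < β) (s : ℝ) :
    Filter.Tendsto (fun n : ℕ => hK β a ((n : ℝ) ^ 2 + n * s)) Filter.atTop (nhds 1) := by
  unfold hK
  have h1 : Filter.Tendsto (fun n : ℕ => (n : ℝ) ^ 2 + n * s) Filter.atTop Filter.atTop := by
    have : (fun n : ℕ => (n : ℝ) ^ 2 + n * s) = fun n : ℕ => (n : ℝ) * (n + s) := by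
      ext n; ring
    rw [this]
    exact tendsto_natCast_atTop_atTop.atTop_mul_atTop₀
      (Filter.tendsto_atTop_add_const_right _ _ tendsto_natCast_atTop_atTop)
  have h2 : Filter.Tendsto (fun n : ℕ => Real.exp (-(β * ((n : ℝ) ^ 2 + n * s)))) Filter.atTop
      (nhds 0) :=
    Real.tendsto_exp_neg_atTop_nhds_zero.comp (h1.const_mul_atTop hβ)
  have h3 := (h2.const_add 1).rpow_const (p := -a) (Or.inl (by norm_num))
  simpa using h3

lemma hK_cont (β a : ℝ) : Continuous (hK β a) := by
  unfold hK
  refine Continuous.rpow_const (by fun_prop) fun t => Or.inl ?_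
  positivity

noncomputable def tg (h : ℝ → ℝ) (δ T m r : ℝ) : ℝ := h ((Real.log r - T) / m) * r ^ (-(δ / 2))

noncomputable def tg1 (h : ℝ → ℝ) (δ T m r : ℝ) : ℝ :=
  (deriv h ((Real.log r - T) / m) / m - δ / 2 * h ((Real.log r - T) / m)) * r ^ (-(δ / 2) - 1)

lemma tg_deriv {h : ℝ → ℝ} (hh : ContDiff ℝ 1 h) (δ T m : ℝ) {r : ℝ} (hr : 0 < r) :
    HasDerivAt (tg h δ T m) (tg1 h δ T m r) r := by
  have h1 : HasDerivAt (fun r => (Real.log r - T) / m) (r⁻¹ / m) r :=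
    ((Real.hasDerivAt_log hr.ne').sub_const T).div_const m
  have h2 : HasDerivAt h (deriv h ((Real.log r - T) / m)) ((Real.log r - T) / m) :=
    (hh.differentiable (by norm_num) _).hasDerivAt
  have h3 := (h2.comp r h1).mul (Real.hasDerivAt_rpow_const (p := -(δ / 2)) (Or.inl hr.ne'))
  refine h3.congr_deriv ?_
  unfold tg1
  have : r ^ (-(δ / 2)) = r ^ (-(δ / 2) - 1) * r := by
    rw [← Real.rpow_add_one hr.ne']; ring_nf
  simp only [Function.comp]
  rw [this]
  field_simp
  ring

lemma csq_c {h : ℝ → ℝ} (hc : HasCompactSupport h) : HasCompactSupport (fun s => h s ^ 2) := by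
  have := hc.comp_left (g := fun y : ℝ => y ^ 2) (by norm_num)
  exact this

lemma csq {h : ℝ → ℝ} (hh : Continuous h) (hc : HasCompactSupport h) :
    Integrable (fun s => h s ^ 2) := by
  have h1 : Continuous (fun s => h s ^ 2) := by fun_prop
  exact h1.integrable_of_hasCompactSupport (csq_c hc)

lemma opt_main {N : ℕ} (hN : 2 < N) {β a δ : ℝ}
    (hδ : δ = N - (β + a * β)) (hδ0 : 0 < δ) (C : ℝ)
    (H : ∀ φ : EuclideanSpace ℝ (Fin N) → ℝ, (∃ L, LipschitzWith L φ) → HasCompactSupport φ →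
      ∫ x, φ x ^ 2 * hW β a ‖x‖ ≤ C * ∫ x, (‖fderiv ℝ φ x‖ ^ 2 * ‖x‖ ^ 2) * hW β a ‖x‖)
    {h : ℝ → ℝ} (hh : ContDiff ℝ 1 h) (h0 : ∀ x, 2 ≤ |x| → h x = 0) (n : ℕ) (hn : 3 ≤ n) :
    ∫ s, h s ^ 2 * hK β a ((n : ℝ) ^ 2 + n * s) ≤
      C * ∫ s, (deriv h s / n - δ / 2 * h s) ^ 2 * hK β a ((n : ℝ) ^ 2 + n * s) := by
  have hnt : Nontrivial (EuclideanSpace ℝ (Fin N)) := by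
    have : Nonempty (Fin N) := ⟨⟨0, by omega⟩⟩
    infer_instance
  have hn3 : (3 : ℝ) ≤ n := by exact_mod_cast hn
  have hn0 : (0 : ℝ) < n := by linarith
  set T : ℝ := (n : ℝ) ^ 2 with hT
  let φ : EuclideanSpace ℝ (Fin N) → ℝ := fun x => tg h δ T n ‖x‖
  have z1 : ∀ x : EuclideanSpace ℝ (Fin N), ‖x‖ < Real.exp (T - 2 * n) → φ x = 0 := by
    intro x hx
    by_cases hx0 : ‖x‖ = 0
    · simp only [φ, tg, hx0]
      rw [Real.zero_rpow (by linarith), mul_zero]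
    · have hxp : 0 < ‖x‖ := lt_of_le_of_ne (norm_nonneg x) (Ne.symm hx0)
      have hl := (Real.log_lt_iff_lt_exp hxp).2 hx
      simp only [φ, tg]
      rw [h0, zero_mul]
      rw [le_abs]; right
      rw [← neg_div, le_div_iff₀ hn0]; linarith
  have z2 : ∀ x : EuclideanSpace ℝ (Fin N), Real.exp (T + 2 * n) < ‖x‖ → φ x = 0 := by
    intro x hx
    have hxp : 0 < ‖x‖ := (Real.exp_pos _).trans hx
    have hl := (Real.lt_log_iff_exp_lt hxp).2 hx
    simp only [φ, tg]
    rw [h0, zero_mul]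
    rw [le_abs]; left
    rw [le_div_iff₀ hn0]; linarith
  have hφc : HasCompactSupport φ := by
    refine HasCompactSupport.intro (isCompact_closedBall (0 : EuclideanSpace ℝ (Fin N))
      (Real.exp (T + 2 * n))) fun x hx => z2 x ?_
    simpa using hx
  have hφd : ContDiff ℝ 1 φ := by
    rw [contDiff_iff_contDiffAt]
    intro x
    by_cases hx : x = 0
    · subst hx
      have : φ =ᶠ[nhds 0] fun _ => 0 := by
        filter_upwards [Metric.ball_mem_nhds (0 : EuclideanSpace ℝ (Fin N))
          (Real.exp_pos (T - 2 * n))] with x hx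
        exact z1 x (by simpa using hx)
      exact contDiffAt_const.congr_of_eventuallyEq this
    · have hnx : ContDiffAt ℝ 1 (fun x : EuclideanSpace ℝ (Fin N) => ‖x‖) x :=
        contDiffAt_norm ℝ hx
      have hxn : ‖x‖ ≠ 0 := norm_ne_zero_iff.2 hx
      simp only [φ, tg]
      refine ContDiffAt.mul ?_ (hnx.rpow_const_of_ne hxn)
      exact hh.contDiffAt.comp x (((hnx.log hxn).sub contDiffAt_const).div_const _)
  have hH := H φ (ContDiff.lipschitzWith_of_hasCompactSupport hφc hφd (by norm_num)) hφc
  have hfd : ∀ x : EuclideanSpace ℝ (Fin N), x ≠ 0 → ‖fderiv ℝ φ x‖ = |tg1 h δ T n ‖x‖| := by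
    intro x hx
    have hd : DifferentiableAt ℝ (fun x : EuclideanSpace ℝ (Fin N) => ‖x‖) x :=
      (contDiffAt_norm (n := 1) ℝ hx).differentiableAt (by norm_num)
    have h1 := (tg_deriv hh δ T n (norm_pos_iff.2 hx)).comp_hasFDerivAt x hd.hasFDerivAt
    have h2 : fderiv ℝ φ x = _ := h1.fderiv
    rw [h2, norm_smul, norm_fderiv_norm hd, mul_one, Real.norm_eq_abs]
  have hR : ∫ x, (‖fderiv ℝ φ x‖ ^ 2 * ‖x‖ ^ 2) * hW β a ‖x‖ =
      ∫ x : EuclideanSpace ℝ (Fin N), (tg1 h δ T n ‖x‖ ^ 2 * ‖x‖ ^ 2) * hW β a ‖x‖ := by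
    refine integral_congr_ae ?_
    have : ∀ᵐ x : EuclideanSpace ℝ (Fin N), x ≠ 0 := by
      simp [ae_iff, measure_singleton]
    filter_upwards [this] with x hx
    rw [hfd x hx, sq_abs]
  rw [hR] at hH
  have r1 := radial hN (fun r => tg h δ T n r ^ 2 * hW β a r) (T := T) hn0
  have r2 := radial hN (fun r => (tg1 h δ T n r ^ 2 * r ^ 2) * hW β a r) (T := T) hn0
  change ∫ x : EuclideanSpace ℝ (Fin N), tg h δ T n ‖x‖ ^ 2 * hW β a ‖x‖ ≤ _ at hH
  rw [r1, r2] at hH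
  have hs : ∀ s : ℝ, (T + n * s - T) / n = s := fun s => by field_simp; ring
  have q1 : ∀ s : ℝ, Real.exp (N * (T + n * s)) * (tg h δ T n (Real.exp (T + n * s)) ^ 2 *
      hW β a (Real.exp (T + n * s))) = h s ^ 2 * hK β a (T + n * s) := by
    intro s
    rw [← hK_eq hδ, tg, Real.log_exp, hs, ← Real.exp_mul, mul_pow, ← Real.exp_nat_mul]
    rw [show ((2 : ℕ) : ℝ) * ((T + n * s) * -(δ / 2)) = -(δ * (T + n * s)) by push_cast; ring]
    ring
  have q2 : ∀ s : ℝ, Real.exp (N * (T + n * s)) * ((tg1 h δ T n (Real.exp (T + n * s)) ^ 2 *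
      Real.exp (T + n * s) ^ 2) * hW β a (Real.exp (T + n * s))) =
      (deriv h s / n - δ / 2 * h s) ^ 2 * hK β a (T + n * s) := by
    intro s
    rw [← hK_eq hδ, tg1, Real.log_exp, hs, ← mul_pow, ← Real.exp_mul, mul_assoc, ← Real.exp_add,
      mul_pow, ← Real.exp_nat_mul]
    rw [show ((2 : ℕ) : ℝ) * ((T + n * s) * (-(δ / 2) - 1) + (T + n * s)) =
      -(δ * (T + n * s)) by push_cast; ring]
    ring
  simp only [q1, q2] at hH
  have hvol : 0 < volume.real (Metric.ball (0 : EuclideanSpace ℝ (Fin N)) 1) :=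
    ENNReal.toReal_pos (Metric.measure_ball_pos _ _ one_pos).ne' measure_ball_lt_top.ne
  have hNp : (0 : ℝ) < N := by exact_mod_cast (by omega : 0 < N)
  have hcc : 0 < N * volume.real (Metric.ball (0 : EuclideanSpace ℝ (Fin N)) 1) * n := by
    positivity
  rw [mul_left_comm] at hH
  exact le_of_mul_le_mul_left hH hcc

lemma opt_lim1 {β a : ℝ} (hβ : 0 < β) (ha : 0 < a) {h : ℝ → ℝ} (hh : ContDiff ℝ 1 h)
    (hc : HasCompactSupport h) : Filter.Tendsto (fun n : ℕ => ∫ s, h s ^ 2 * hK β a ((n : ℝ) ^ 2 + n * s))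
    Filter.atTop (nhds (∫ s, h s ^ 2)) := by
  refine tendsto_integral_of_dominated_convergence (fun s => h s ^ 2) (fun n => ?_)
    (csq hh.continuous hc)
    (fun n => Filter.Eventually.of_forall fun s => ?_)
    (Filter.Eventually.of_forall fun s => ?_)
  · exact ((hh.continuous.pow 2).mul ((hK_cont β a).comp (by fun_prop))).aestronglyMeasurable
  · rw [Real.norm_of_nonneg (mul_nonneg (sq_nonneg _) (hK_nonneg _ _ _))]
    exact mul_le_of_le_one_right (sq_nonneg _) (hK_le ha _)
  · simpa using (hK_tendsto (a := a) hβ s).const_mul (h s ^ 2)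

lemma opt_lim2 {β a : ℝ} (hβ : 0 < β) (ha : 0 < a) {h : ℝ → ℝ} (hh : ContDiff ℝ 1 h)
    (hc : HasCompactSupport h) (δ : ℝ) : Filter.Tendsto (fun n : ℕ => ∫ s, (deriv h s / n - δ / 2 * h s) ^ 2 *
    hK β a ((n : ℝ) ^ 2 + n * s)) Filter.atTop (nhds (∫ s, (δ / 2 * h s) ^ 2)) := by
  have hdc : Continuous (deriv h) := hh.continuous_deriv le_rfl
  refine tendsto_integral_of_dominated_convergence
    (fun s => 2 * (deriv h s) ^ 2 + 2 * (δ / 2 * h s) ^ 2) (fun n => ?_) ?_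
    (fun n => Filter.Eventually.of_forall fun s => ?_)
    (Filter.Eventually.of_forall fun s => ?_)
  · exact ((((hdc.div_const _).sub (hh.continuous.const_mul _)).pow 2).mul
      ((hK_cont β a).comp (by fun_prop))).aestronglyMeasurable
  · refine Integrable.add (Integrable.const_mul ?_ _) (Integrable.const_mul ?_ _)
    · exact csq hdc hc.deriv
    · simp only [mul_pow]
      exact (csq hh.continuous hc).const_mul _
  · rw [Real.norm_of_nonneg (mul_nonneg (sq_nonneg _) (hK_nonneg _ _ _))]
    refine (mul_le_of_le_one_right (sq_nonneg _) (hK_le ha _)).trans ?_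
    have h1 : (deriv h s / n) ^ 2 ≤ deriv h s ^ 2 := by
      rcases Nat.eq_zero_or_pos n with hn | hn
      · subst hn; simp; positivity
      · rw [div_pow]
        refine div_le_self (sq_nonneg _) ?_
        have : (1 : ℝ) ≤ n := by exact_mod_cast hn
        nlinarith
    nlinarith [sq_nonneg (deriv h s / n + δ / 2 * h s)]
  · have h1 : Filter.Tendsto (fun n : ℕ => deriv h s / (n : ℝ)) Filter.atTop (nhds 0) :=
      tendsto_const_div_atTop_nhds_zero_nat _
    have h2 := ((h1.sub_const (δ / 2 * h s)).pow 2).mul (hK_tendsto (a := a) hβ s)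
    simpa using h2

lemma hardy_opt {N : ℕ} (hN : 2 < N) {β a δ : ℝ} (hβ : 0 < β) (ha : 0 < a)
    (hδ : δ = N - (β + a * β)) (hδ0 : 0 < δ) (C : ℝ)
    (H : ∀ φ : EuclideanSpace ℝ (Fin N) → ℝ, (∃ L, LipschitzWith L φ) → HasCompactSupport φ →
      ∫ x, φ x ^ 2 * hW β a ‖x‖ ≤ C * ∫ x, (‖fderiv ℝ φ x‖ ^ 2 * ‖x‖ ^ 2) * hW β a ‖x‖) :
    4 / δ ^ 2 ≤ C := by
  obtain ⟨h, hh, h0, hc, hpos⟩ : ∃ h : ℝ → ℝ, ContDiff ℝ 1 h ∧ (∀ x, 2 ≤ |x| → h x = 0) ∧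
      HasCompactSupport h ∧ h 0 = 1 := by
    let b : ContDiffBump (0 : ℝ) := ⟨1, 2, by norm_num, by norm_num⟩
    refine ⟨b, b.contDiff, fun x hx => b.zero_of_le_dist (by simpa [b] using hx),
      b.hasCompactSupport, b.one_of_mem_closedBall (by simp [b])⟩
  have fin := le_of_tendsto_of_tendsto (opt_lim1 hβ ha hh hc)
    ((opt_lim2 hβ ha hh hc δ).const_mul C)
    (Filter.eventually_atTop.2 ⟨3, opt_main hN hδ hδ0 C H hh h0⟩)
  have hI : 0 < ∫ s, h s ^ 2 := by
    have h1 : Continuous (fun s => h s ^ 2) := hh.continuous.pow 2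
    refine h1.integral_pos_of_hasCompactSupport_nonneg_nonzero (csq_c hc) ?_ (x := 0) ?_
    · intro s; exact sq_nonneg _
    · simp [hpos]
  simp only [mul_pow] at fin
  rw [integral_const_mul, ← mul_assoc] at fin
  have : 1 ≤ C * (δ / 2) ^ 2 := by
    by_contra hcon
    push Not at hcon
    nlinarith
  rw [div_le_iff₀ (by positivity)]
  nlinarith

/-- Optimality of the constant `C_H = 4 (N - p/((2-p)(p-1)))^{-2}` in the
Hardy inequality for the evolution `p`-Laplace equation, under `N ≤ 7` or
`p ∉ (p₋, p₊)` with `p₊/₋ = 3/2 ± (1/2)√((N-7)/(N+1))`. -/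
theorem hardy_p_laplace_optimal
    (N : ℕ) (p : ℝ) (hp1 : 1 < p) (hp2 : p < 2) (hN : 2 < N)
    (hNp : p / ((2 - p) * (p - 1)) < N)
    (hextra : N ≤ 7 ∨
      ¬(3 / 2 - (1 / 2) * Real.sqrt (((N : ℝ) - 7) / ((N : ℝ) + 1)) < p ∧
        p < 3 / 2 + (1 / 2) * Real.sqrt (((N : ℝ) - 7) / ((N : ℝ) + 1)))) :
    (∀ φ : EuclideanSpace ℝ (Fin N) → ℝ,
        (∃ L, LipschitzWith L φ) → HasCompactSupport φ →
        ∫ x, |φ x| ^ (2 : ℝ) *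
            (‖x‖ ^ (-(p / (p - 1))) *
              (1 + ‖x‖ ^ (p / (p - 1))) ^ (-((p - 1) / (2 - p)))) ≤
          (4 * ((N : ℝ) - p / ((2 - p) * (p - 1))) ^ (-(2 : ℝ))) *
            ∫ x, ‖fderiv ℝ φ x‖ ^ (2 : ℝ) *
              (‖x‖ ^ (-((2 - p) / (p - 1))) *
                (1 + ‖x‖ ^ (p / (p - 1))) ^ (-((p - 1) / (2 - p))))) ∧
    (∀ C : ℝ,
      (∀ φ : EuclideanSpace ℝ (Fin N) → ℝ,
        (∃ L, LipschitzWith L φ) → HasCompactSupport φ →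
        ∫ x, |φ x| ^ (2 : ℝ) *
            (‖x‖ ^ (-(p / (p - 1))) *
              (1 + ‖x‖ ^ (p / (p - 1))) ^ (-((p - 1) / (2 - p)))) ≤
          C * ∫ x, ‖fderiv ℝ φ x‖ ^ (2 : ℝ) *
            (‖x‖ ^ (-((2 - p) / (p - 1))) *
              (1 + ‖x‖ ^ (p / (p - 1))) ^ (-((p - 1) / (2 - p))))) →
      4 * ((N : ℝ) - p / ((2 - p) * (p - 1))) ^ (-(2 : ℝ)) ≤ C) := by
  clear hextra
  have hp : 0 < p - 1 := by linarith
  have hq : 0 < 2 - p := by linarith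
  have hβ : 0 < p / (p - 1) := by positivity
  have ha : 0 < (p - 1) / (2 - p) := by positivity
  have hsum : p / ((2 - p) * (p - 1)) =
      p / (p - 1) + (p - 1) / (2 - p) * (p / (p - 1)) := by
    field_simp; ring
  have hγ : -((2 - p) / (p - 1)) = 2 + -(p / (p - 1)) := by
    field_simp; ring
  have hδ0 : 0 < (N : ℝ) - p / ((2 - p) * (p - 1)) := by linarith
  have hconst : 4 * ((N : ℝ) - p / ((2 - p) * (p - 1))) ^ (-(2 : ℝ)) =
      4 / ((N : ℝ) - p / ((2 - p) * (p - 1))) ^ 2 := by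
    rw [Real.rpow_neg hδ0.le, Real.rpow_two, ← div_eq_mul_inv]
  have hδ : (N : ℝ) - p / ((2 - p) * (p - 1)) =
      N - (p / (p - 1) + (p - 1) / (2 - p) * (p / (p - 1))) := by rw [hsum]
  have hl : ∀ φ : EuclideanSpace ℝ (Fin N) → ℝ,
      ∫ x, |φ x| ^ (2 : ℝ) * (‖x‖ ^ (-(p / (p - 1))) *
        (1 + ‖x‖ ^ (p / (p - 1))) ^ (-((p - 1) / (2 - p)))) =
      ∫ x, φ x ^ 2 * hW (p / (p - 1)) ((p - 1) / (2 - p)) ‖x‖ := by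
    intro φ
    congr 1; ext x
    rw [Real.rpow_two, sq_abs, hW]
  have hnt : Nontrivial (EuclideanSpace ℝ (Fin N)) := by
    have : Nonempty (Fin N) := ⟨⟨0, by omega⟩⟩
    infer_instance
  have hr : ∀ φ : EuclideanSpace ℝ (Fin N) → ℝ,
      ∫ x, ‖fderiv ℝ φ x‖ ^ (2 : ℝ) * (‖x‖ ^ (-((2 - p) / (p - 1))) *
        (1 + ‖x‖ ^ (p / (p - 1))) ^ (-((p - 1) / (2 - p)))) =
      ∫ x, (‖fderiv ℝ φ x‖ ^ 2 * ‖x‖ ^ 2) * hW (p / (p - 1)) ((p - 1) / (2 - p)) ‖x‖ := by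
    intro φ
    refine integral_congr_ae ?_
    have : ∀ᵐ x : EuclideanSpace ℝ (Fin N), x ≠ 0 := by
      simp [ae_iff, measure_singleton]
    filter_upwards [this] with x hx
    rw [Real.rpow_two, hW, hγ, Real.rpow_add (norm_pos_iff.2 hx), Real.rpow_two]
    ring
  simp only [hl, hr, hconst]
  refine ⟨fun φ ⟨L, hL⟩ hc => hardy_ineq hN hβ ha hδ hδ0 φ hL hc, fun C H => ?_⟩
  exact hardy_opt hN hβ ha hδ hδ0 C H
end
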